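/- Let N > 2, let Ω ⊂ ℝ^N be a bounded domain whose boundary ∂Ω is of class C^{2,α} for some α ∈ (0,1), and let a, c ∈ C^{0,α}(Ω̄) satisfy a(x) > 0 and c(x) > 0 for every x ∈ Ω̄. Then there exists a function u ∈ C(Ω̄) ∩ C^{2,α}(Ω) with u > 0 in Ω, u = 0 on ∂Ω, and −Δu(x) + c(x)·u(x)^{−1}·|∇u(x)|² = a(x) for every x ∈ Ω. -/

import Mathlib

open Set Filter MeasureTheory

/-- The Laplacian of `u : ℝ^N → ℝ`: the sum of its second partial derivatives. -/
noncomputable def lap {N : ℕ} (u : EuclideanSpace ℝ (Fin N) → ℝ)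
    (x : EuclideanSpace ℝ (Fin N)) : ℝ :=
  ∑ i : Fin N, fderiv ℝ (fun y => fderiv ℝ u y (EuclideanSpace.single i 1)) x
    (EuclideanSpace.single i 1)

/-- `u ∈ C^{2,α}(s)` in the interior/local sense: `u` is twice continuously differentiable on
`s` and its second derivatives are α-Hölder continuous on every compact subset of `s`. -/
def HolderC2On {N : ℕ} (α : NNReal) (u : EuclideanSpace ℝ (Fin N) → ℝ)
    (s : Set (EuclideanSpace ℝ (Fin N))) : Prop :=
  ContDiffOn ℝ 2 u s ∧
  ∀ K ⊆ s, IsCompact K → ∃ C : NNReal, HolderOnWith C α (iteratedFDerivWithin ℝ 2 u s) K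

/-- The boundary `∂Ω` is of class `C^{2,α}`: near each boundary point, after a rigid motion,
`Ω` coincides with the region above the graph of a `C^{2,α}` function of `N - 1` variables. -/
def IsC2HolderBoundary {N : ℕ} (α : NNReal) (Ω : Set (EuclideanSpace ℝ (Fin N))) : Prop :=
  ∀ x ∈ frontier Ω, ∃ U : Set (EuclideanSpace ℝ (Fin N)), IsOpen U ∧ x ∈ U ∧
    ∃ T : EuclideanSpace ℝ (Fin N) ≃ᵃⁱ[ℝ] WithLp 2 (EuclideanSpace ℝ (Fin (N - 1)) × ℝ),
    ∃ ψ : EuclideanSpace ℝ (Fin (N - 1)) → ℝ,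
      ContDiff ℝ 2 ψ ∧
      (∀ K : Set (EuclideanSpace ℝ (Fin (N - 1))), IsCompact K →
        ∃ C : NNReal, HolderOnWith C α (iteratedFDeriv ℝ 2 ψ) K) ∧
      Ω ∩ U = {y | ψ (WithLp.equiv 2 _ (T y)).1 < (WithLp.equiv 2 _ (T y)).2} ∩ U

section

open Set Filter MeasureTheory
open scoped Topology ContDiff

/-! ## Part A: one-dimensional second derivative calculus and the Laplacian -/

/-- Euclidean space. -/
abbrev Eu (N : ℕ) := EuclideanSpace ℝ (Fin N)

/-- the standard basis vector -/
noncomputable abbrev eb {N : ℕ} (i : Fin N) : Eu N := EuclideanSpace.single i (1 : ℝ)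

/-- second derivative as a bilinear form -/
noncomputable abbrev D2 {N : ℕ} (u : Eu N → ℝ) (x : Eu N) : Eu N →L[ℝ] Eu N →L[ℝ] ℝ :=
  fderiv ℝ (fderiv ℝ u) x

/-- `g` has first derivative `d1` and second derivative `d2` at `0`. -/
def D2At (g : ℝ → ℝ) (d1 d2 : ℝ) : Prop :=
  ∃ g' : ℝ → ℝ, (∀ᶠ s in 𝓝 (0:ℝ), HasDerivAt g (g' s) s) ∧ g' 0 = d1 ∧ HasDerivAt g' d2 0

namespace D2At

variable {g h : ℝ → ℝ} {a b c d : ℝ}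

theorem add (hg : D2At g a b) (hh : D2At h c d) : D2At (fun s => g s + h s) (a + c) (b + d) := by
  obtain ⟨g', h1, h2, h3⟩ := hg
  obtain ⟨h', k1, k2, k3⟩ := hh
  refine ⟨fun s => g' s + h' s, ?_, by simp [h2, k2], h3.add k3⟩
  filter_upwards [h1, k1] with s hs ks using hs.add ks

theorem neg (hg : D2At g a b) : D2At (fun s => - g s) (-a) (-b) := by
  obtain ⟨g', h1, h2, h3⟩ := hg
  refine ⟨fun s => - g' s, ?_, by simp [h2], h3.neg⟩
  filter_upwards [h1] with s hs using hs.neg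

theorem sub (hg : D2At g a b) (hh : D2At h c d) : D2At (fun s => g s - h s) (a - c) (b - d) := by
  simpa [sub_eq_add_neg] using hg.add hh.neg

theorem const_mul (k : ℝ) (hg : D2At g a b) : D2At (fun s => k * g s) (k * a) (k * b) := by
  obtain ⟨g', h1, h2, h3⟩ := hg
  refine ⟨fun s => k * g' s, ?_, by simp [h2], h3.const_mul k⟩
  filter_upwards [h1] with s hs using hs.const_mul k

theorem const (k : ℝ) : D2At (fun _ => k) 0 0 :=
  ⟨fun _ => 0, Eventually.of_forall fun s => hasDerivAt_const s k, rfl, hasDerivAt_const _ _⟩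

theorem deriv_eq (hg : D2At g a b) : HasDerivAt g a 0 := by
  obtain ⟨g', h1, h2, h3⟩ := hg
  rw [← h2]; exact h1.self_of_nhds

theorem unique (hg : D2At g a b) (hh : D2At g c d) : a = c ∧ b = d := by
  refine ⟨hg.deriv_eq.unique hh.deriv_eq, ?_⟩
  obtain ⟨g', h1, h2, h3⟩ := hg
  obtain ⟨h', k1, k2, k3⟩ := hh
  have : g' =ᶠ[𝓝 0] h' := by
    filter_upwards [h1, k1] with s hs ks using hs.unique ks
  exact (h3.congr_of_eventuallyEq this.symm).unique k3

theorem congr (hg : D2At g a b) (e : g =ᶠ[𝓝 0] h) : D2At h a b := by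
  obtain ⟨g', h1, h2, h3⟩ := hg
  refine ⟨g', ?_, h2, h3⟩
  filter_upwards [h1, e.eventually_nhds] with s hs es
  have esh : g =ᶠ[𝓝 s] h := es
  exact hs.congr_of_eventuallyEq esh.symm

/-- composition with a function of one variable -/
theorem comp {γ γ' : ℝ → ℝ} {γ'' : ℝ} (hg : D2At g a b)
    (h1 : ∀ᶠ t in 𝓝 (g 0), HasDerivAt γ (γ' t) t) (h2 : HasDerivAt γ' γ'' (g 0)) :
    D2At (fun s => γ (g s)) (γ' (g 0) * a) (γ'' * a ^ 2 + γ' (g 0) * b) := by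
  have hgd := hg.deriv_eq
  obtain ⟨g', k1, k2, k3⟩ := hg
  refine ⟨fun s => γ' (g s) * g' s, ?_, by simp [k2], ?_⟩
  · filter_upwards [k1, hgd.continuousAt.eventually h1] with s hs ks
    exact ks.comp s hs
  · have e1 : HasDerivAt (fun s => γ' (g s)) (γ'' * a) 0 := h2.comp 0 hgd
    exact (e1.mul k3).congr_deriv (by rw [k2]; ring)

theorem affine (t c : ℝ) : D2At (fun s => t + s * c) c 0 := by
  refine ⟨fun _ => c, Eventually.of_forall fun s => ?_, rfl, hasDerivAt_const _ _⟩
  simpa using ((hasDerivAt_id s).mul_const c).const_add t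

theorem of_localMax (hg : D2At g a b) (hm : IsLocalMax g 0) : a = 0 ∧ b ≤ 0 := by
  have ha : a = 0 := hm.hasDerivAt_eq_zero hg.deriv_eq
  refine ⟨ha, ?_⟩
  by_contra hb
  push Not at hb
  have hg0 := hg
  obtain ⟨g', h1, h2, h3⟩ := hg
  have e1 : deriv g =ᶠ[𝓝 0] g' := by
    filter_upwards [h1] with s hs using hs.deriv
  have e2 : deriv (deriv g) 0 = b := by
    rw [e1.deriv_eq, h3.deriv]
  have hmin : IsLocalMin g 0 := isLocalMin_of_deriv_deriv_pos (by rw [e2]; exact hb)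
    (by rw [hg0.deriv_eq.deriv, ha]) hg0.deriv_eq.continuousAt
  have hconst : g =ᶠ[𝓝 0] fun _ => g 0 := by
    filter_upwards [hm, hmin] with s h1 h2 using le_antisymm h1 h2
  have := (hg0.congr hconst).unique (D2At.const (g 0))
  linarith [this.2]

end D2At

section lap
variable {N : ℕ} {u v : Eu N → ℝ} {x : Eu N}

theorem ContDiffAt.fderiv_diff (hu : ContDiffAt ℝ 2 u x) : DifferentiableAt ℝ (fderiv ℝ u) x :=
  (hu.fderiv_right (m := 1) (by norm_num)).differentiableAt (by norm_num)

theorem ContDiffAt.ev2 (hu : ContDiffAt ℝ 2 u x) : ∀ᶠ y in 𝓝 x, ContDiffAt ℝ 2 u y :=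
  hu.eventually (by simp)

theorem lap_eq (hu : ContDiffAt ℝ 2 u x) : lap u x = ∑ i, D2 u x (eb i) (eb i) := by
  unfold lap
  refine Finset.sum_congr rfl fun i _ => ?_
  have := fderiv_clm_apply (hu.fderiv_diff) (differentiableAt_const (eb i))
  rw [this]
  simp

theorem d2at_line (hu : ContDiffAt ℝ 2 u x) (ξ : Eu N) :
    D2At (fun s : ℝ => u (x + s • ξ)) (fderiv ℝ u x ξ) (D2 u x ξ ξ) := by
  have hl : ∀ s : ℝ, HasDerivAt (fun s : ℝ => x + s • ξ) ξ s := fun s => by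
    simpa using ((hasDerivAt_id s).smul_const ξ).const_add x
  have h0 : x + (0:ℝ) • ξ = x := by simp
  refine ⟨fun s => fderiv ℝ u (x + s • ξ) ξ, ?_, by simp, ?_⟩
  · have ht : Tendsto (fun s : ℝ => x + s • ξ) (𝓝 0) (𝓝 x) := by
      have := (hl 0).continuousAt.tendsto
      rwa [h0] at this
    filter_upwards [ht.eventually hu.ev2] with s hs
    have := (hs.differentiableAt (by norm_num)).hasFDerivAt
    exact this.comp_hasDerivAt s (hl s)
  · have h1 : HasFDerivAt (fderiv ℝ u) (D2 u x) (x + (0:ℝ) • ξ) := by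
      rw [h0]; exact hu.fderiv_diff.hasFDerivAt
    have h2 := h1.comp_hasDerivAt (0:ℝ) (hl 0)
    have h3 := h2.clm_apply (hasDerivAt_const (0:ℝ) ξ)
    simpa using h3

theorem d2at_normSq (x ξ y : Eu N) :
    D2At (fun s : ℝ => ‖x + s • ξ - y‖ ^ 2) (2 * inner ℝ (x - y) ξ) (2 * ‖ξ‖ ^ 2) := by
  have e : (fun s : ℝ => ‖x + s • ξ - y‖ ^ 2) =
      fun s => ‖x - y‖ ^ 2 + 2 * s * inner ℝ (x - y) ξ + s ^ 2 * ‖ξ‖ ^ 2 := by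
    funext s
    have : x + s • ξ - y = (x - y) + s • ξ := by abel
    rw [this, norm_add_sq_real, inner_smul_right, norm_smul, mul_pow]
    simp; ring
  rw [e]
  refine ⟨fun s => 2 * inner ℝ (x - y) ξ + 2 * s * ‖ξ‖ ^ 2, Eventually.of_forall fun s => ?_,
    by simp, ?_⟩
  · have h1 := ((hasDerivAt_id s).const_mul 2).mul_const (inner ℝ (x - y) ξ)
    have h2 := ((hasDerivAt_id s).pow 2).mul_const (‖ξ‖ ^ 2)
    exact ((h1.const_add (‖x - y‖ ^ 2)).add h2).congr_deriv (by simp)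
  · have h1 := ((hasDerivAt_id (0:ℝ)).const_mul 2).mul_const (‖ξ‖ ^ 2)
    exact (h1.const_add (2 * inner ℝ (x - y) ξ)).congr_deriv (by simp)

theorem D2At.lap_eq (hu : ContDiffAt ℝ 2 u x) {d1 d2 : Fin N → ℝ}
    (h : ∀ i, D2At (fun s : ℝ => u (x + s • eb i)) (d1 i) (d2 i)) : lap u x = ∑ i, d2 i := by
  rw [_root_.lap_eq hu]
  exact Finset.sum_congr rfl fun i _ => ((d2at_line hu (eb i)).unique (h i)).2

theorem lap_add (hu : ContDiffAt ℝ 2 u x) (hv : ContDiffAt ℝ 2 v x) :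
    lap (fun y => u y + v y) x = lap u x + lap v x := by
  rw [D2At.lap_eq (hu.add hv) fun i => (d2at_line hu (eb i)).add (d2at_line hv (eb i)),
    lap_eq hu, lap_eq hv, Finset.sum_add_distrib]

theorem lap_const_mul (k : ℝ) (hu : ContDiffAt ℝ 2 u x) :
    lap (fun y => k * u y) x = k * lap u x := by
  rw [D2At.lap_eq (contDiffAt_const.mul hu) fun i => (d2at_line hu (eb i)).const_mul k,
    lap_eq hu, Finset.mul_sum]

theorem lap_neg (hu : ContDiffAt ℝ 2 u x) :
    lap (fun y => - u y) x = - lap u x := by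
  rw [D2At.lap_eq hu.neg fun i => (d2at_line hu (eb i)).neg,
    lap_eq hu, Finset.sum_neg_distrib]

theorem lap_sub (hu : ContDiffAt ℝ 2 u x) (hv : ContDiffAt ℝ 2 v x) :
    lap (fun y => u y - v y) x = lap u x - lap v x := by
  rw [D2At.lap_eq (hu.sub hv) fun i => (d2at_line hu (eb i)).sub (d2at_line hv (eb i)),
    lap_eq hu, lap_eq hv, Finset.sum_sub_distrib]

theorem lap_const (k : ℝ) : lap (fun _ : Eu N => k) x = 0 := by
  rw [D2At.lap_eq contDiffAt_const fun i => D2At.const k]; simp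

theorem lap_congr (h : u =ᶠ[𝓝 x] v) : lap u x = lap v x := by
  unfold lap
  refine Finset.sum_congr rfl fun i _ => ?_
  have : (fun y => fderiv ℝ u y (eb i)) =ᶠ[𝓝 x] (fun y => fderiv ℝ v y (eb i)) := by
    filter_upwards [h.eventually_nhds] with y hy
    have hy' : u =ᶠ[𝓝 y] v := hy
    rw [hy'.fderiv_eq]
  rw [this.fderiv_eq]

theorem sum_sq_apply (L : Eu N →L[ℝ] ℝ) : ∑ i, (L (eb i)) ^ 2 = ‖L‖ ^ 2 := by
  set p := (InnerProductSpace.toDual ℝ (Eu N)).symm L with hp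
  have h1 : ‖L‖ = ‖p‖ := by simp [hp]
  have h2 : ∀ i, L (eb i) = p i := fun i => by
    have : L (eb i) = inner ℝ p (eb i) := by
      rw [hp, InnerProductSpace.toDual_symm_apply]
    rw [this, EuclideanSpace.inner_single_right]; simp
  rw [h1, EuclideanSpace.norm_sq_eq]
  exact Finset.sum_congr rfl fun i _ => by rw [h2 i]; simp

theorem lap_comp {γ γ' : ℝ → ℝ} {γ'' : ℝ} (hu : ContDiffAt ℝ 2 u x)
    (hγ : ContDiffAt ℝ 2 γ (u x))
    (h1 : ∀ᶠ t in 𝓝 (u x), HasDerivAt γ (γ' t) t) (h2 : HasDerivAt γ' γ'' (u x)) :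
    lap (fun y => γ (u y)) x = γ'' * ‖fderiv ℝ u x‖ ^ 2 + γ' (u x) * lap u x := by
  have e0 : ∀ i : Fin N, u (x + (0:ℝ) • eb i) = u x := fun i => by simp
  rw [D2At.lap_eq (u := fun y => γ (u y)) (hγ.comp x hu) fun i => (d2at_line hu (eb i)).comp (γ := γ) (γ' := γ')
    (γ'' := γ'') (by rw [e0]; exact h1) (by rw [e0]; exact h2)]
  simp only [e0]
  rw [Finset.sum_add_distrib, ← Finset.mul_sum, ← Finset.mul_sum, sum_sq_apply, lap_eq hu]

theorem lap_normSq (y x : Eu N) : lap (fun z => ‖z - y‖ ^ 2) x = 2 * N := by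
  have hc : ContDiffAt ℝ 2 (fun z : Eu N => ‖z - y‖ ^ 2) x :=
    ((contDiff_id.sub contDiff_const).norm_sq ℝ).contDiffAt
  rw [D2At.lap_eq hc fun i => d2at_normSq x (eb i) y]
  simp; ring

theorem lap_scale (hr : ℝ) (z : Eu N) (hu : ContDiffAt ℝ 2 u (z + hr • x)) :
    lap (fun y => u (z + hr • y)) x = hr ^ 2 * lap u (z + hr • x) := by
  have hc : ContDiffAt ℝ 2 (fun y : Eu N => z + hr • y) x :=
    (by fun_prop)
  have key : ∀ i, D2At (fun s : ℝ => u (z + hr • (x + s • eb i)))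
      (fderiv ℝ u (z + hr • x) (hr • eb i)) (D2 u (z + hr • x) (hr • eb i) (hr • eb i)) := by
    intro i
    have := d2at_line hu (hr • eb i)
    refine this.congr (Eventually.of_forall fun s => ?_)
    simp only
    congr 1
    rw [smul_add, smul_comm hr s, add_assoc]
  rw [D2At.lap_eq (u := fun y => u (z + hr • y)) (hu.comp x hc) key, lap_eq hu, Finset.mul_sum]
  refine Finset.sum_congr rfl fun i _ => ?_
  simp; ring

/-! ### maximum principles -/

theorem localMax_lap (hu : ContDiffAt ℝ 2 u x) (hm : IsLocalMax u x) :
    fderiv ℝ u x = 0 ∧ lap u x ≤ 0 := by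
  refine ⟨hm.fderiv_eq_zero, ?_⟩
  rw [lap_eq hu]
  refine Finset.sum_nonpos fun i _ => ?_
  have h := d2at_line hu (eb i)
  refine (h.of_localMax ?_).2
  have ht : Tendsto (fun s : ℝ => x + s • eb i) (𝓝 0) (𝓝 x) := by
    have : Continuous (fun s : ℝ => x + s • eb i) := by fun_prop
    simpa using this.tendsto 0
  have := ht.eventually hm
  unfold IsLocalMax IsMaxFilter
  simpa using this

/-- an interior maximum point exists when the boundary values are smaller -/
theorem exists_interior_max {X : Type*} [PseudoMetricSpace X] [ProperSpace X] {U : Set X}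
    (hU : Bornology.IsBounded U) (hUo : IsOpen U) {v : X → ℝ}
    (hc : ContinuousOn v (closure U)) {κ : ℝ} (hb : ∀ y ∈ frontier U, v y ≤ κ)
    {z : X} (hz : z ∈ U) (hzκ : κ < v z) :
    ∃ x ∈ U, κ < v x ∧ IsLocalMax v x := by
  have hK : IsCompact (closure U) := hU.isCompact_closure
  obtain ⟨x, hx, hmax⟩ := hK.exists_isMaxOn ⟨z, subset_closure hz⟩ hc
  have h1 : κ < v x := lt_of_lt_of_le hzκ (hmax (subset_closure hz))
  have hxU : x ∈ U := by
    by_contra hn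
    have : x ∈ frontier U := by
      rw [hUo.frontier_eq]; exact ⟨hx, hn⟩
    linarith [hb x this]
  refine ⟨x, hxU, h1, ?_⟩
  filter_upwards [hUo.mem_nhds hxU] with y hy using hmax (subset_closure hy)

theorem weak_max {U : Set (Eu N)} (hN : 0 < N) (hU : Bornology.IsBounded U) (hUo : IsOpen U)
    (hc : ContinuousOn v (closure U)) (h2 : ∀ y ∈ U, ContDiffAt ℝ 2 v y)
    (hl : ∀ y ∈ U, 0 ≤ lap v y) {κ : ℝ} (hb : ∀ y ∈ frontier U, v y ≤ κ) :
    ∀ y ∈ U, v y ≤ κ := by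
  intro z hz
  by_contra hcon
  push Not at hcon
  obtain ⟨R, hR⟩ := hU.subset_closedBall 0
  have hclo : closure U ⊆ Metric.closedBall 0 R :=
    closure_minimal hR Metric.isClosed_closedBall
  obtain ⟨ε, hε, hεR⟩ : ∃ ε > 0, ε * R ^ 2 < v z - κ := by
    refine ⟨(v z - κ) / (2 * (R ^ 2 + 1)), by apply div_pos <;> nlinarith [sq_nonneg R], ?_⟩
    rw [div_mul_eq_mul_div, div_lt_iff₀ (by positivity)]
    nlinarith [sq_nonneg R]
  set w : Eu N → ℝ := fun y => v y + ε * ‖y - 0‖ ^ 2 with hw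
  have hnc : ∀ y, ContDiffAt ℝ 2 (fun z : Eu N => ‖z - 0‖ ^ 2) y := fun y =>
    ((contDiff_id.sub contDiff_const).norm_sq ℝ).contDiffAt
  obtain ⟨x, hxU, -, hmax⟩ := exists_interior_max (v := w) (κ := κ + ε * R ^ 2) hU hUo
    (hc.add (by fun_prop)) (fun y hy => by
      have h1 := hb y hy
      have h3 := hclo (frontier_subset_closure hy)
      rw [Metric.mem_closedBall, dist_eq_norm] at h3
      have : ‖y - 0‖ ^ 2 ≤ R ^ 2 := by gcongr
      simp only [hw]
      nlinarith) hz (by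
      simp only [hw]
      have : 0 ≤ ε * ‖z - 0‖ ^ 2 := by positivity
      linarith)
  have h3 := localMax_lap ((h2 x hxU).add (contDiffAt_const.mul (hnc x))) hmax
  rw [lap_add (h2 x hxU) (contDiffAt_const.mul (hnc x)), lap_const_mul ε (hnc x),
    lap_normSq] at h3
  have h4 := hl x hxU
  have : (0:ℝ) < N := by exact_mod_cast hN
  have : 0 < ε * (2 * N) := by positivity
  linarith [h3.2]

end lap

end

section

open Set Filter MeasureTheory
open scoped Topology ContDiff

/-! ## Part C: the interior gradient estimate (doubling of variables) -/

section grad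
variable {N : ℕ}

theorem deriv_le_of_right {f : ℝ → ℝ} {d a κ : ℝ} (hf : HasDerivAt f d 0)
    (h : ∀ᶠ s in 𝓝[>] (0:ℝ), f s ≤ f 0 + a * s + κ * s ^ 2) : d ≤ a := by
  have h1 := hf.tendsto_slope_zero_right
  have h2 : Tendsto (fun s : ℝ => a + κ * s) (𝓝[>] 0) (𝓝 (a + κ * 0)) :=
    (Continuous.tendsto (by fun_prop) 0).mono_left nhdsWithin_le_nhds
  have h3 : d ≤ a + κ * 0 := by
    refine le_of_tendsto_of_tendsto h1 h2 ?_
    filter_upwards [h, self_mem_nhdsWithin] with s hs hs0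
    have hs0 : 0 < s := hs0
    simp only [zero_add, smul_eq_mul]
    rw [inv_mul_le_iff₀ hs0]
    nlinarith
  linarith

theorem grad_of_localMax {f : Eu N → ℝ} {x y x0 : Eu N} {ψ : ℝ → ℝ} {p κ : ℝ} (hκ : 0 ≤ κ)
    (hp : 0 ≤ p)
    (hf : DifferentiableAt ℝ f x) (hxy : x ≠ y) (hψ : HasDerivAt ψ p ‖x - y‖)
    (hm : IsLocalMax (fun z => f z - ψ ‖z - y‖ - κ * ‖z - x0‖ ^ 2) x) :
    ‖fderiv ℝ f x‖ ≤ p + 2 * κ * ‖x - x0‖ := by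
  refine ContinuousLinearMap.opNorm_le_bound _ (by positivity) fun ξ => ?_
  have hl : HasDerivAt (fun s : ℝ => x + s • ξ) ξ 0 := by
    simpa using ((hasDerivAt_id (0:ℝ)).smul_const ξ).const_add x
  have h1 : HasDerivAt (fun s : ℝ => f (x + s • ξ)) (fderiv ℝ f x ξ) 0 := by
    have : HasFDerivAt f (fderiv ℝ f x) (x + (0:ℝ) • ξ) := by simpa using hf.hasFDerivAt
    exact this.comp_hasDerivAt 0 hl
  have ht : 0 < ‖x - y‖ := norm_pos_iff.2 (sub_ne_zero.2 hxy)
  have h2 : HasDerivAt (fun s : ℝ => ‖x + s • ξ - y‖) (inner ℝ (x - y) ξ / ‖x - y‖) 0 := by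
    have h3 := (d2at_normSq x ξ y).deriv_eq
    have h4 := h3.sqrt (by simpa using ht.ne')
    refine (h4.congr_of_eventuallyEq (Eventually.of_forall fun s => ?_)).congr_deriv ?_
    · simp [Real.sqrt_sq]
    · simp [Real.sqrt_sq]; field_simp
  have h5 : HasDerivAt (fun s : ℝ => ψ ‖x + s • ξ - y‖) (p * (inner ℝ (x - y) ξ / ‖x - y‖)) 0 := by
    have : HasDerivAt ψ p ‖x + (0:ℝ) • ξ - y‖ := by simpa using hψ
    exact this.comp (0:ℝ) h2
  have h6 := (d2at_normSq x ξ x0).deriv_eq.const_mul κ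
  have h7 := (h1.sub h5).sub h6
  have hmax : IsLocalMax (fun s : ℝ => f (x + s • ξ) - ψ ‖x + s • ξ - y‖
      - κ * ‖x + s • ξ - x0‖ ^ 2) 0 := by
    have ht : Tendsto (fun s : ℝ => x + s • ξ) (𝓝 0) (𝓝 x) := by
      simpa using hl.continuousAt.tendsto
    have := ht.eventually hm
    unfold IsLocalMax IsMaxFilter
    simpa using this
  have h8 := hmax.hasDerivAt_eq_zero h7
  have h9 : fderiv ℝ f x ξ = p * (inner ℝ (x - y) ξ / ‖x - y‖) + κ * (2 * inner ℝ (x - x0) ξ) := by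
    linarith
  rw [h9, Real.norm_eq_abs]
  have e1 : |inner ℝ (x - y) ξ| ≤ ‖x - y‖ * ‖ξ‖ := abs_real_inner_le_norm _ _
  have e2 : |inner ℝ (x - x0) ξ| ≤ ‖x - x0‖ * ‖ξ‖ := abs_real_inner_le_norm _ _
  have e3 : |inner ℝ (x - y) ξ / ‖x - y‖| ≤ ‖ξ‖ := by
    rw [abs_div, abs_of_pos ht, div_le_iff₀ ht]; linarith
  calc _ ≤ |p * (inner ℝ (x - y) ξ / ‖x - y‖)| + |κ * (2 * inner ℝ (x - x0) ξ)| := abs_add_le _ _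
    _ = p * |inner ℝ (x - y) ξ / ‖x - y‖| + κ * (2 * |inner ℝ (x - x0) ξ|) := by
        rw [abs_mul, abs_mul, abs_mul, abs_of_nonneg hp, abs_of_nonneg hκ, abs_two]
    _ ≤ p * ‖ξ‖ + κ * (2 * (‖x - x0‖ * ‖ξ‖)) := by gcongr
    _ = _ := by ring

/-- second order condition in the doubled variables -/
theorem lap_of_localMax {u : Eu N → ℝ} {x y x0 : Eu N} {ψ ψ' : ℝ → ℝ} {p2 κ : ℝ}
    (hx : ContDiffAt ℝ 2 u x) (hy : ContDiffAt ℝ 2 u y) (hxy : x ≠ y)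
    (hψ1 : ∀ᶠ t in 𝓝 ‖x - y‖, HasDerivAt ψ (ψ' t) t) (hψ2 : HasDerivAt ψ' p2 ‖x - y‖)
    (hm : IsLocalMax (fun z : Eu N × Eu N => u z.1 - u z.2 - ψ ‖z.1 - z.2‖
      - κ * ‖z.1 - x0‖ ^ 2 - κ * ‖z.2 - x0‖ ^ 2) (x, y)) :
    lap u x - lap u y ≤ 4 * p2 + 4 * N * κ := by
  set t := ‖x - y‖ with ht
  have htpos : 0 < t := norm_pos_iff.2 (sub_ne_zero.2 hxy)
  obtain ⟨e, he⟩ : ∃ e : Eu N, e = t⁻¹ • (x - y) := ⟨_, rfl⟩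
  have hen : ‖e‖ = 1 := by
    rw [he, norm_smul, norm_inv, Real.norm_of_nonneg htpos.le, ← ht]; field_simp
  have hxye : x - y = t • e := by rw [he, smul_smul, mul_inv_cancel₀ htpos.ne', one_smul]
  obtain ⟨c, hc⟩ : ∃ c : Fin N → ℝ, ∀ i, c i = inner ℝ e (eb i) := ⟨_, fun _ => rfl⟩
  have hci : ∀ i, c i = e i := fun i => by
    rw [hc, EuclideanSpace.inner_single_right]; simp
  obtain ⟨η, hη⟩ : ∃ η : Fin N → Eu N, ∀ i, η i = eb i - (2 * c i) • e := ⟨_, fun _ => rfl⟩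
  have hηn : ∀ i, ‖η i‖ ^ 2 = 1 := fun i => by
    rw [hη, norm_sub_sq_real, inner_smul_right, norm_smul, mul_pow, hen, real_inner_comm, ← hc,
      Real.norm_eq_abs, sq_abs]
    simp; ring
  have key : ∀ i, D2 u x (eb i) (eb i) - D2 u y (η i) (η i) - p2 * (2 * c i) ^ 2 - κ * 2 - κ * 2
      ≤ 0 := by
    intro i
    have h1 := d2at_line hx (eb i)
    have h2 := d2at_line hy (η i)
    have h3 := (D2At.affine t (2 * c i)).comp (γ := ψ) (γ' := ψ') (γ'' := p2)
      (by simpa using hψ1) (by simpa using hψ2)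
    have h4 := (d2at_normSq x (eb i) x0).const_mul κ
    have h5 := (d2at_normSq y (η i) x0).const_mul κ
    have h6 := (((h1.sub h2).sub h3).sub h4).sub h5
    have h7 : IsLocalMax (fun s : ℝ => u (x + s • eb i) - u (y + s • η i) - ψ (t + s * (2 * c i))
        - κ * ‖x + s • eb i - x0‖ ^ 2 - κ * ‖y + s • η i - x0‖ ^ 2) 0 := by
      have hcont : Continuous (fun s : ℝ => (x + s • eb i, y + s • η i)) := by fun_prop
      have htd : Tendsto (fun s : ℝ => (x + s • eb i, y + s • η i)) (𝓝 0) (𝓝 (x, y)) := by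
        simpa using hcont.tendsto 0
      have hev := htd.eventually hm
      have hpos : ∀ᶠ s in 𝓝 (0:ℝ), 0 < t + s * (2 * c i) := by
        have : Continuous (fun s : ℝ => t + s * (2 * c i)) := by fun_prop
        exact (this.tendsto 0).eventually (lt_mem_nhds (by simpa using htpos))
      unfold IsLocalMax IsMaxFilter
      filter_upwards [hev, hpos] with s hs hsp
      have hn : ‖x + s • eb i - (y + s • η i)‖ = t + s * (2 * c i) := by
        have : x + s • eb i - (y + s • η i) = (t + s * (2 * c i)) • e := by
          have h9 : x + s • eb i - (y + s • η i) = (x - y) + s • (eb i - η i) := by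
            rw [smul_sub]; abel
          rw [h9, hxye, hη, sub_sub_cancel, smul_smul, ← add_smul]
        rw [this, norm_smul, hen, mul_one, Real.norm_of_nonneg hsp.le]
      simp only [hn] at hs
      simpa [← ht] using hs
    have h8 := (h6.of_localMax h7).2
    have hn1 : ‖(eb i : Eu N)‖ ^ 2 = 1 := by simp
    rw [hn1, hηn i] at h8
    linarith
  have hsum := Finset.sum_nonpos fun i (_ : i ∈ Finset.univ) => key i
  have hes : ∑ i, c i • eb i = e := by
    ext j
    simp [hci, Pi.single_apply]
  have hcs : ∑ i, c i ^ 2 = 1 := by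
    have := EuclideanSpace.norm_sq_eq e
    rw [hen] at this
    simp only [hci]
    simpa using this.symm
  have hD : ∀ i, D2 u y (η i) (η i) = D2 u y (eb i) (eb i) - 2 * (D2 u y (c i • eb i) e) -
      2 * (D2 u y e (c i • eb i)) + 4 * c i ^ 2 * D2 u y e e := by
    intro i
    simp only [hη, map_sub, map_smul, sub_apply, smul_apply,
      smul_eq_mul]
    ring
  have hs2 : ∑ i, D2 u y (η i) (η i) = lap u y := by
    simp_rw [hD]
    rw [Finset.sum_add_distrib, Finset.sum_sub_distrib, Finset.sum_sub_distrib, ← Finset.mul_sum,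
      ← Finset.mul_sum, ← Finset.sum_mul, ← Finset.mul_sum, hcs, ← map_sum, hes,
      ← sum_apply, ← map_sum, hes, lap_eq hy]
    ring
  have e4 : ∑ i, p2 * (2 * c i) ^ 2 = 4 * p2 := by
    have : ∀ i, p2 * (2 * c i) ^ 2 = 4 * p2 * c i ^ 2 := fun i => by ring
    simp_rw [this]
    rw [← Finset.mul_sum, hcs, mul_one]
  simp only [Finset.sum_sub_distrib, hs2, e4, ← lap_eq hx, Finset.sum_const, Finset.card_univ,
    Fintype.card_fin, nsmul_eq_mul] at hsum
  linarith

set_option maxHeartbeats 1000000 in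
theorem grad_est (N : ℕ) {r A B M : ℝ} (hr : 0 < r) (hA : 0 ≤ A) (hB : 1 ≤ B) (hM : 0 ≤ M) :
    ∃ K : ℝ, 0 ≤ K ∧ ∀ (x0 : Eu N) (u : Eu N → ℝ), (∀ y ∈ Metric.ball x0 r, ContDiffAt ℝ 2 u y) →
      (∀ y ∈ Metric.ball x0 r, |u y| ≤ M) →
      (∀ y ∈ Metric.ball x0 r, |lap u y| ≤ A + B * ‖fderiv ℝ u y‖ ^ 2) →
      ‖fderiv ℝ u x0‖ ≤ K := by
  obtain ⟨ρ, hρ⟩ : ∃ ρ, ρ = r / 2 := ⟨_, rfl⟩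
  have hρ0 : 0 < ρ := by linarith
  obtain ⟨κ, hκ⟩ : ∃ κ, κ = 2 * M / ρ ^ 2 := ⟨_, rfl⟩
  have hκ0 : 0 ≤ κ := by rw [hκ]; positivity
  have hκρ : κ * ρ ^ 2 = 2 * M := by rw [hκ]; field_simp
  obtain ⟨C, hC⟩ : ∃ C, C = 4 * N * κ + 2 * A + 16 * B * κ ^ 2 * ρ ^ 2 + 1 := ⟨_, rfl⟩
  have hC1 : 1 ≤ C := by
    rw [hC]
    have : 0 ≤ 4 * N * κ + 2 * A + 16 * B * κ ^ 2 * ρ ^ 2 := by positivity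
    linarith
  have hBC : 1 ≤ B * C := by nlinarith
  obtain ⟨δ, hδ⟩ : ∃ δ, δ = 1 / (4 * (B * C)) := ⟨_, rfl⟩
  have hδ0 : 0 < δ := by rw [hδ]; positivity
  have hδ1 : C < 1 / (4 * B * δ ^ 2) := by
    have : 1 / (4 * B * δ ^ 2) = C * (4 * (B * C)) := by
      rw [hδ]; field_simp
    rw [this]; nlinarith
  obtain ⟨K, hK⟩ : ∃ K, K = Real.exp (4 * B * M) / δ := ⟨_, rfl⟩
  have hK0 : 0 < K := by rw [hK]; positivity
  have hKδ : K * δ = Real.exp (4 * B * M) := by rw [hK]; field_simp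
  have hKδ1 : 1 ≤ K * δ := by rw [hKδ]; exact Real.one_le_exp (by positivity)
  refine ⟨K / (2 * B), by positivity, ?_⟩
  intro x0 u hu huM hlap
  let ψ : ℝ → ℝ := fun t => 1 / (2 * B) * Real.log (1 + K * t)
  let ψ' : ℝ → ℝ := fun t => K / (2 * B) * (1 + K * t)⁻¹
  have hψ1 : ∀ t : ℝ, 0 ≤ t → HasDerivAt ψ (ψ' t) t := by
    intro t ht
    have h1 : HasDerivAt (fun t : ℝ => 1 + K * t) K t := by
      simpa using ((hasDerivAt_id t).const_mul K).const_add 1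
    have h2 := (h1.log (by positivity)).const_mul (1 / (2 * B))
    refine h2.congr_deriv ?_
    simp only [ψ']; field_simp
  have hψ1' : ∀ t : ℝ, 0 < t → ∀ᶠ s in 𝓝 t, HasDerivAt ψ (ψ' s) s := fun t ht => by
    filter_upwards [lt_mem_nhds ht] with s hs using hψ1 s hs.le
  have hψ2 : ∀ t : ℝ, 0 ≤ t → HasDerivAt ψ' (-(2 * B) * ψ' t ^ 2) t := by
    intro t ht
    have h1 : HasDerivAt (fun t : ℝ => 1 + K * t) K t := by
      simpa using ((hasDerivAt_id t).const_mul K).const_add 1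
    have h2 := (h1.inv (by positivity)).const_mul (K / (2 * B))
    refine h2.congr_deriv ?_
    simp only [ψ']; field_simp
  have hψnn : ∀ t : ℝ, 0 ≤ t → 0 ≤ ψ t := fun t ht => by
    simp only [ψ]
    have : 0 ≤ Real.log (1 + K * t) := Real.log_nonneg (by nlinarith)
    positivity
  have hψδ : 2 * M ≤ ψ δ := by
    simp only [ψ]
    have h1 : 4 * B * M ≤ Real.log (1 + K * δ) := by
      rw [hKδ, Real.le_log_iff_exp_le (by positivity)]; linarith
    calc 2 * M = 1 / (2 * B) * (4 * B * M) := by field_simp; ring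
      _ ≤ _ := by gcongr
  have hψle : ∀ t : ℝ, 0 ≤ t → ψ t ≤ K / (2 * B) * t := fun t ht => by
    simp only [ψ]
    have h1 : Real.log (1 + K * t) ≤ K * t := by
      have := Real.log_le_sub_one_of_pos (show 0 < 1 + K * t by positivity)
      linarith
    calc _ ≤ 1 / (2 * B) * (K * t) := by gcongr
      _ = _ := by ring
  have hψ'pos : ∀ t : ℝ, 0 ≤ t → 0 ≤ ψ' t := fun t ht => by simp only [ψ']; positivity
  let S : Set (Eu N × Eu N) := {z | ‖z.1 - x0‖ < ρ ∧ ‖z.2 - x0‖ < ρ ∧ ‖z.1 - z.2‖ < δ}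
  let S' : Set (Eu N × Eu N) := {z | ‖z.1 - x0‖ ≤ ρ ∧ ‖z.2 - x0‖ ≤ ρ ∧ ‖z.1 - z.2‖ ≤ δ}
  have hSo : IsOpen S := by
    have c1 : Continuous (fun z : Eu N × Eu N => ‖z.1 - x0‖) := by fun_prop
    have c2 : Continuous (fun z : Eu N × Eu N => ‖z.2 - x0‖) := by fun_prop
    have c3 : Continuous (fun z : Eu N × Eu N => ‖z.1 - z.2‖) := by fun_prop
    exact (isOpen_lt c1 continuous_const).inter
      ((isOpen_lt c2 continuous_const).inter (isOpen_lt c3 continuous_const))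
  have hS'c : IsClosed S' := by
    have c1 : Continuous (fun z : Eu N × Eu N => ‖z.1 - x0‖) := by fun_prop
    have c2 : Continuous (fun z : Eu N × Eu N => ‖z.2 - x0‖) := by fun_prop
    have c3 : Continuous (fun z : Eu N × Eu N => ‖z.1 - z.2‖) := by fun_prop
    exact (isClosed_le c1 continuous_const).inter
      ((isClosed_le c2 continuous_const).inter (isClosed_le c3 continuous_const))
  have hSS' : S ⊆ S' := fun z hz => ⟨hz.1.le, hz.2.1.le, hz.2.2.le⟩
  have hcl : closure S ⊆ S' := closure_minimal hSS' hS'c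
  have hSb : Bornology.IsBounded S := by
    refine ((Metric.isBounded_ball (x := x0) (r := ρ)).prod
      (Metric.isBounded_ball (x := x0) (r := ρ))).subset fun z hz => ?_
    exact ⟨by simpa [dist_eq_norm] using hz.1, by simpa [dist_eq_norm] using hz.2.1⟩
  have hball : ∀ y, ‖y - x0‖ ≤ ρ → y ∈ Metric.ball x0 r := fun y hy => by
    rw [Metric.mem_ball, dist_eq_norm]; linarith
  let Φ : Eu N × Eu N → ℝ := fun z => u z.1 - u z.2 - ψ ‖z.1 - z.2‖
      - κ * ‖z.1 - x0‖ ^ 2 - κ * ‖z.2 - x0‖ ^ 2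
  have hΦc : ContinuousOn Φ (closure S) := by
    refine ContinuousOn.mono ?_ hcl
    have h1 : ContinuousOn (fun z : Eu N × Eu N => u z.1) S' := fun z hz =>
      ((hu z.1 (hball _ hz.1)).continuousAt.comp (x := z) continuousAt_fst).continuousWithinAt
    have h2 : ContinuousOn (fun z : Eu N × Eu N => u z.2) S' := fun z hz =>
      ((hu z.2 (hball _ hz.2.1)).continuousAt.comp (x := z) continuousAt_snd).continuousWithinAt
    have h3 : ContinuousOn (fun z : Eu N × Eu N => ψ ‖z.1 - z.2‖) S' := fun z hz => by
      have : ContinuousAt ψ ‖z.1 - z.2‖ := (hψ1 _ (norm_nonneg _)).continuousAt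
      exact (ContinuousAt.comp (x := z) (f := fun z : Eu N × Eu N => ‖z.1 - z.2‖) this
        (by fun_prop)).continuousWithinAt
    exact (((h1.sub h2).sub h3).sub (by fun_prop)).sub (by fun_prop)
  have hΦle : ∀ z ∈ S', Φ z ≤ 2 * M - ψ ‖z.1 - z.2‖ - κ * ‖z.1 - x0‖ ^ 2 - κ * ‖z.2 - x0‖ ^ 2 := by
    intro z hz
    have h1 := abs_le.1 (huM z.1 (hball _ hz.1))
    have h2 := abs_le.1 (huM z.2 (hball _ hz.2.1))
    simp only [Φ]; linarith [h1.2, h2.1]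
  have hfr : ∀ z ∈ frontier S, Φ z ≤ 0 := by
    intro z hz
    rw [hSo.frontier_eq] at hz
    have hz' := hcl hz.1
    have h0 := hΦle z hz'
    have p1 : 0 ≤ κ * ‖z.1 - x0‖ ^ 2 := by positivity
    have p2 : 0 ≤ κ * ‖z.2 - x0‖ ^ 2 := by positivity
    have p3 := hψnn ‖z.1 - z.2‖ (norm_nonneg _)
    have hor : ‖z.1 - x0‖ = ρ ∨ ‖z.2 - x0‖ = ρ ∨ ‖z.1 - z.2‖ = δ := by
      by_contra hcon
      push Not at hcon
      exact hz.2 ⟨lt_of_le_of_ne hz'.1 hcon.1, lt_of_le_of_ne hz'.2.1 hcon.2.1,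
        lt_of_le_of_ne hz'.2.2 hcon.2.2⟩
    rcases hor with h | h | h
    · rw [h, hκρ] at h0; linarith
    · rw [h, hκρ] at h0; linarith
    · rw [h] at h0; linarith
  have hmain : ∀ z ∈ S, Φ z ≤ 0 := by
    intro z hz
    by_contra hcon
    push Not at hcon
    obtain ⟨⟨x, y⟩, hxyS, hpos, hmax⟩ := exists_interior_max hSb hSo hΦc hfr hz hcon
    have hxr : ‖x - x0‖ < ρ := hxyS.1
    have hyr : ‖y - x0‖ < ρ := hxyS.2.1
    have htδ : ‖x - y‖ < δ := hxyS.2.2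
    have hne : x ≠ y := by
      rintro rfl
      have p1 : 0 ≤ κ * ‖x - x0‖ ^ 2 := by positivity
      have p3 := hψnn ‖x - x‖ (norm_nonneg _)
      simp only [Φ] at hpos
      linarith
    have htpos : 0 < ‖x - y‖ := norm_pos_iff.2 (sub_ne_zero.2 hne)
    have hux := hu x (hball x hxr.le)
    have huy := hu y (hball y hyr.le)
    have q1 := lap_of_localMax hux huy hne (hψ1' _ htpos) (hψ2 _ htpos.le) hmax
    obtain ⟨P, hP⟩ : ∃ P, P = ψ' ‖x - y‖ := ⟨_, rfl⟩
    have hP0 : 0 ≤ P := by rw [hP]; exact hψ'pos _ htpos.le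
    have g1 : ‖fderiv ℝ u x‖ ≤ P + 2 * κ * ρ := by
      have := grad_of_localMax (f := u) (x := x) (y := y) (x0 := x0) (ψ := ψ) (p := P) hκ0 hP0
        (hux.differentiableAt (by norm_num)) hne (by rw [hP]; exact hψ1 _ htpos.le) (by
          have htd : Tendsto (fun z : Eu N => (z, y)) (𝓝 x) (𝓝 (x, y)) :=
            (Continuous.tendsto (by fun_prop) x)
          have h := htd.eventually hmax
          unfold IsLocalMax IsMaxFilter
          filter_upwards [h] with z hz
          simp only [Φ] at hz
          linarith)
      have : 2 * κ * ‖x - x0‖ ≤ 2 * κ * ρ := by gcongr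
      linarith
    have g2 : ‖fderiv ℝ u y‖ ≤ P + 2 * κ * ρ := by
      have := grad_of_localMax (f := fun z => - u z) (x := y) (y := x) (x0 := x0) (ψ := ψ) (p := P)
        hκ0 hP0 (huy.differentiableAt (by norm_num)).neg hne.symm
        (by rw [norm_sub_rev y x, hP]; exact hψ1 _ htpos.le) (by
          have htd : Tendsto (fun z : Eu N => (x, z)) (𝓝 y) (𝓝 (x, y)) :=
            (Continuous.tendsto (by fun_prop) y)
          have h := htd.eventually hmax
          unfold IsLocalMax IsMaxFilter
          filter_upwards [h] with z hz
          simp only [Φ] at hz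
          rw [norm_sub_rev z x, norm_sub_rev y x]
          linarith)
      rw [fderiv_fun_neg, norm_neg] at this
      have : 2 * κ * ‖y - x0‖ ≤ 2 * κ * ρ := by gcongr
      linarith
    have hPlow : 1 / (4 * B * δ) ≤ P := by
      rw [hP]
      simp only [ψ']
      have h1 : 0 < 1 + K * ‖x - y‖ := by positivity
      have h2 : 1 + K * ‖x - y‖ ≤ 2 * (K * δ) := by nlinarith
      rw [← div_eq_mul_inv, div_div, div_le_div_iff₀ (by positivity) (by positivity)]
      have : 2 * B * (1 + K * ‖x - y‖) ≤ 2 * B * (2 * (K * δ)) := by gcongr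
      linarith
    have hP2 : C < 4 * B * P ^ 2 := by
      have h1 : (1 / (4 * B * δ)) ^ 2 ≤ P ^ 2 := by gcongr
      have h2 : 4 * B * (1 / (4 * B * δ)) ^ 2 = 1 / (4 * B * δ ^ 2) := by field_simp
      have h3 : 4 * B * (1 / (4 * B * δ)) ^ 2 ≤ 4 * B * P ^ 2 := by gcongr
      linarith
    have hsq : ∀ g : ℝ, 0 ≤ g → g ≤ P + 2 * κ * ρ → g ^ 2 ≤ 2 * P ^ 2 + 8 * κ ^ 2 * ρ ^ 2 := by
      intro g hg0 hg
      have h1 : g ^ 2 ≤ (P + 2 * κ * ρ) ^ 2 := by gcongr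
      nlinarith [sq_nonneg (P - 2 * κ * ρ)]
    have l1 := abs_le.1 (hlap x (hball x hxr.le))
    have l2 := abs_le.1 (hlap y (hball y hyr.le))
    have m1 := mul_le_mul_of_nonneg_left (hsq _ (norm_nonneg _) g1) (by linarith : (0:ℝ) ≤ B)
    have m2 := mul_le_mul_of_nonneg_left (hsq _ (norm_nonneg _) g2) (by linarith : (0:ℝ) ≤ B)
    rw [← hP] at q1
    linarith [l1.1, l2.2]
  have hone : ∀ ξ : Eu N, fderiv ℝ u x0 ξ ≤ K / (2 * B) * ‖ξ‖ := by
    intro ξ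
    have hx0 := (hu x0 (hball x0 (by simpa using hρ0.le))).differentiableAt (by norm_num)
    have hl : HasDerivAt (fun s : ℝ => x0 + s • ξ) ξ 0 := by
      simpa using ((hasDerivAt_id (0:ℝ)).smul_const ξ).const_add x0
    have h1 : HasDerivAt (fun s : ℝ => u (x0 + s • ξ)) (fderiv ℝ u x0 ξ) 0 := by
      have : HasFDerivAt u (fderiv ℝ u x0) (x0 + (0:ℝ) • ξ) := by simpa using hx0.hasFDerivAt
      exact this.comp_hasDerivAt 0 hl
    refine deriv_le_of_right (κ := κ * ‖ξ‖ ^ 2) h1 ?_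
    have hev : ∀ᶠ s in 𝓝[>] (0:ℝ), s * ‖ξ‖ < min ρ δ := by
      have : Tendsto (fun s : ℝ => s * ‖ξ‖) (𝓝 0) (𝓝 (0 * ‖ξ‖)) :=
        Continuous.tendsto (by fun_prop) 0
      exact (this.eventually (gt_mem_nhds (by simp [hρ0, hδ0]))).filter_mono nhdsWithin_le_nhds
    filter_upwards [hev, self_mem_nhdsWithin] with s hs hs0
    have hs0 : 0 < s := hs0
    have hn : ‖x0 + s • ξ - x0‖ = s * ‖ξ‖ := by
      rw [add_sub_cancel_left, norm_smul, Real.norm_of_nonneg hs0.le]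
    have hm := hmain (x0 + s • ξ, x0) ⟨by
        simp only [hn]; exact hs.trans_le (min_le_left _ _), by simpa using hρ0, by
        simp only [hn]; exact hs.trans_le (min_le_right _ _)⟩
    simp only [Φ, hn, sub_self, norm_zero] at hm
    have h3 := hψle (s * ‖ξ‖) (by positivity)
    simp only [zero_smul, add_zero]
    linarith
  refine ContinuousLinearMap.opNorm_le_bound _ (by positivity) fun ξ => ?_
  rw [Real.norm_eq_abs, abs_le]
  have h1 := hone ξ
  have h2 := hone (-ξ)
  rw [map_neg, norm_neg] at h2
  constructor <;> linarith

/-- Linear interior gradient estimate, scale invariant. -/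
theorem grad_lin (N : ℕ) : ∃ C : ℝ, 0 ≤ C ∧ ∀ (x0 : Eu N) (u : Eu N → ℝ) (r A M : ℝ), 0 < r →
      (∀ y ∈ Metric.ball x0 r, ContDiffAt ℝ 2 u y) →
      (∀ y ∈ Metric.ball x0 r, |u y| ≤ M) →
      (∀ y ∈ Metric.ball x0 r, |lap u y| ≤ A) →
      ‖fderiv ℝ u x0‖ ≤ C * (M / r + r * A) := by
  obtain ⟨K, hK0, hK⟩ := grad_est N (r := 1) (A := 1) (B := 1) (M := 1) one_pos zero_le_one le_rfl
    zero_le_one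
  refine ⟨K, hK0, fun x0 u r A M hr hu hM hA => ?_⟩
  have hx0 : x0 ∈ Metric.ball x0 r := Metric.mem_ball_self hr
  have hM0 : 0 ≤ M := (abs_nonneg _).trans (hM x0 hx0)
  have hA0 : 0 ≤ A := (abs_nonneg _).trans (hA x0 hx0)
  have key : ∀ ε > 0, ‖fderiv ℝ u x0‖ * r ≤ K * (M + r ^ 2 * A + ε) := by
    intro ε hε
    have hL : 0 < M + r ^ 2 * A + ε := by positivity
    obtain ⟨k, hk⟩ : ∃ k, k = (M + r ^ 2 * A + ε)⁻¹ := ⟨_, rfl⟩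
    have hk0 : 0 < k := by rw [hk]; positivity
    have hkL : k * (M + r ^ 2 * A + ε) = 1 := by rw [hk]; field_simp
    have hb : ∀ y ∈ Metric.ball (0 : Eu N) 1, x0 + r • y ∈ Metric.ball x0 r := fun y hy => by
      rw [mem_ball_zero_iff] at hy
      rw [Metric.mem_ball, dist_eq_norm, add_sub_cancel_left, norm_smul, Real.norm_of_nonneg hr.le]
      nlinarith
    have hc : ∀ y ∈ Metric.ball (0 : Eu N) 1, ContDiffAt ℝ 2 (fun y => u (x0 + r • y)) y :=
      fun y hy => (hu _ (hb y hy)).comp y (by fun_prop)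
    have h := hK 0 (fun y => k * u (x0 + r • y)) (fun y hy => contDiffAt_const.mul (hc y hy))
      (fun y hy => by
        rw [abs_mul, abs_of_pos hk0]
        have h1 := hM _ (hb y hy)
        have h2 : k * |u (x0 + r • y)| ≤ k * (M + r ^ 2 * A + ε) := by
          gcongr
          have : 0 ≤ r ^ 2 * A := by positivity
          linarith
        linarith)
      (fun y hy => by
        rw [lap_const_mul k (hc y hy), lap_scale r x0 (hu _ (hb y hy)), abs_mul, abs_of_pos hk0,
          abs_mul, abs_of_nonneg (sq_nonneg r)]
        have h1 := hA _ (hb y hy)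
        have h2 : k * (r ^ 2 * |lap u (x0 + r • y)|) ≤ k * (M + r ^ 2 * A + ε) := by
          gcongr
          have : r ^ 2 * |lap u (x0 + r • y)| ≤ r ^ 2 * A := by gcongr
          linarith
        have : 0 ≤ ‖fderiv ℝ (fun y => k * u (x0 + r • y)) y‖ ^ 2 := by positivity
        linarith)
    have hd : HasFDerivAt (fun y => k * u (x0 + r • y)) ((k * r) • fderiv ℝ u x0) 0 := by
      have h1 : HasFDerivAt u (fderiv ℝ u x0) (x0 + r • (0 : Eu N)) := by
        simpa using ((hu x0 hx0).differentiableAt (by norm_num)).hasFDerivAt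
      have h2 : HasFDerivAt (fun y : Eu N => x0 + r • y) (r • ContinuousLinearMap.id ℝ (Eu N)) 0 :=
        ((hasFDerivAt_id (0 : Eu N)).const_smul r).const_add x0
      refine ((h1.comp 0 h2).const_mul k).congr_fderiv ?_
      ext v
      simp; ring
    rw [hd.fderiv, norm_smul, Real.norm_of_nonneg (by positivity)] at h
    calc ‖fderiv ℝ u x0‖ * r = (M + r ^ 2 * A + ε) * (k * r * ‖fderiv ℝ u x0‖) := by
          linear_combination (-(‖fderiv ℝ u x0‖ * r)) * hkL
      _ ≤ (M + r ^ 2 * A + ε) * K := by gcongr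
      _ = _ := by ring
  have h2 : ‖fderiv ℝ u x0‖ * r ≤ K * (M + r ^ 2 * A) := by
    have ht : Tendsto (fun ε : ℝ => K * (M + r ^ 2 * A + ε)) (𝓝[>] 0)
        (𝓝 (K * (M + r ^ 2 * A + 0))) :=
      (Continuous.tendsto (by fun_prop) 0).mono_left nhdsWithin_le_nhds
    rw [add_zero] at ht
    exact ge_of_tendsto ht (by filter_upwards [self_mem_nhdsWithin] with ε hε using key ε hε)
  have h3 : K * (M / r + r * A) = K * (M + r ^ 2 * A) / r := by field_simp
  rw [h3, le_div_iff₀ hr]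
  exact h2

end grad

end

section

open Set Filter MeasureTheory
open scoped Topology ContDiff

/-! ## Part D: the Dirichlet problem with polynomial data -/

section poly
variable {N : ℕ}

/-- polynomial functions on Euclidean space -/
noncomputable def pev (p : MvPolynomial (Fin N) ℝ) (x : Eu N) : ℝ :=
  MvPolynomial.eval (fun i => x i) p

theorem pev_hasFDerivAt (p : MvPolynomial (Fin N) ℝ) (x : Eu N) :
    HasFDerivAt (pev p)
      (∑ i, pev (MvPolynomial.pderiv i p) x • (EuclideanSpace.proj i : Eu N →L[ℝ] ℝ)) x := by
  induction p using MvPolynomial.induction_on with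
  | C a =>
    have : pev (MvPolynomial.C a : MvPolynomial (Fin N) ℝ) = fun _ => a := by
      funext y; simp [pev]
    rw [this]
    refine (hasFDerivAt_const a x).congr_fderiv ?_
    simp [pev]
  | add p q hp hq =>
    have : pev (p + q) = fun y => pev p y + pev q y := by funext y; simp [pev]
    rw [this]
    refine (hp.add hq).congr_fderiv ?_
    rw [← Finset.sum_add_distrib]
    refine Finset.sum_congr rfl fun i _ => ?_
    simp [pev, add_smul]
  | mul_X p j hp =>
    have : pev (p * MvPolynomial.X j) = fun y => pev p y * (EuclideanSpace.proj j : Eu N →L[ℝ] ℝ) y := by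
      funext y; simp [pev]
    rw [this]
    refine (hp.mul (EuclideanSpace.proj j : Eu N →L[ℝ] ℝ).hasFDerivAt).congr_fderiv ?_
    have h1 : ∀ i, pev (MvPolynomial.pderiv i (p * MvPolynomial.X j)) x
        = pev (MvPolynomial.pderiv i p) x * x j + pev p x * (if j = i then 1 else 0) := by
      intro i
      rw [MvPolynomial.pderiv_mul, MvPolynomial.pderiv_X]
      by_cases hij : j = i
      · subst hij; simp [pev]
      · have : i ≠ j := fun h => hij h.symm
        simp [pev, hij]
    simp_rw [h1, add_smul]
    rw [Finset.sum_add_distrib, Finset.smul_sum, add_comm]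
    congr 1
    · refine Finset.sum_congr rfl fun i _ => ?_
      rw [smul_smul, mul_comm]; rfl
    · simp

theorem pev_contDiff (p : MvPolynomial (Fin N) ℝ) : ContDiff ℝ ∞ (pev p) := by
  induction p using MvPolynomial.induction_on with
  | C a =>
    have : pev (MvPolynomial.C a : MvPolynomial (Fin N) ℝ) = fun _ => a := by
      funext y; simp [pev]
    rw [this]; exact contDiff_const
  | add p q hp hq =>
    have : pev (p + q) = fun y => pev p y + pev q y := by funext y; simp [pev]
    rw [this]; exact hp.add hq
  | mul_X p j hp =>
    have : pev (p * MvPolynomial.X j) = fun y => pev p y * (EuclideanSpace.proj j : Eu N →L[ℝ] ℝ) y := by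
      funext y; simp [pev]
    rw [this]; exact hp.mul (EuclideanSpace.proj j : Eu N →L[ℝ] ℝ).contDiff

theorem pev_pderiv (p : MvPolynomial (Fin N) ℝ) (i : Fin N) (x : Eu N) :
    fderiv ℝ (pev p) x (eb i) = pev (MvPolynomial.pderiv i p) x := by
  rw [(pev_hasFDerivAt p x).fderiv]
  simp [sum_apply]

/-- polynomial Laplacian -/
noncomputable def PLap : MvPolynomial (Fin N) ℝ →ₗ[ℝ] MvPolynomial (Fin N) ℝ :=
  ∑ i, (MvPolynomial.pderiv i).toLinearMap ∘ₗ (MvPolynomial.pderiv i).toLinearMap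

theorem PLap_apply (p : MvPolynomial (Fin N) ℝ) :
    PLap p = ∑ i, MvPolynomial.pderiv i (MvPolynomial.pderiv i p) := by
  simp [PLap]

theorem lap_pev (p : MvPolynomial (Fin N) ℝ) (x : Eu N) : lap (pev p) x = pev (PLap p) x := by
  unfold lap
  have : ∀ i, (fun y => fderiv ℝ (pev p) y (EuclideanSpace.single i 1)) =
      pev (MvPolynomial.pderiv i p) := fun i => by funext y; exact pev_pderiv p i y
  simp_rw [this]
  rw [PLap_apply]
  have h2 : ∀ i, fderiv ℝ (pev (MvPolynomial.pderiv i p)) x (EuclideanSpace.single i 1) =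
    pev (MvPolynomial.pderiv i (MvPolynomial.pderiv i p)) x := fun i => pev_pderiv _ i x
  simp_rw [h2]
  simp [pev]

theorem totalDegree_pderiv_le (p : MvPolynomial (Fin N) ℝ) (i : Fin N) :
    (MvPolynomial.pderiv i p).totalDegree ≤ p.totalDegree - 1 := by
  unfold MvPolynomial.totalDegree
  refine Finset.sup_le fun m hm => ?_
  rw [MvPolynomial.mem_support_iff, MvPolynomial.coeff_pderiv] at hm
  have h1 : m + Finsupp.single i 1 ∈ p.support := by
    rw [MvPolynomial.mem_support_iff]; exact left_ne_zero_of_mul hm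
  have h2 := MvPolynomial.le_totalDegree h1
  rw [Finsupp.sum_add_index' (by simp) (by simp)] at h2
  simp only [Finsupp.sum_single_index] at h2
  unfold MvPolynomial.totalDegree at h2
  omega

/-- `1 - |x|^2` -/
noncomputable def pS (N : ℕ) : MvPolynomial (Fin N) ℝ := 1 - ∑ i, MvPolynomial.X i ^ 2

theorem pev_pS (x : Eu N) : pev (pS N) x = 1 - ‖x‖ ^ 2 := by
  rw [EuclideanSpace.norm_sq_eq]
  simp [pev, pS]

theorem pS_degree : (pS N).totalDegree ≤ 2 := by
  unfold pS
  refine (MvPolynomial.totalDegree_sub _ _).trans (max_le (by simp) ?_)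
  refine MvPolynomial.totalDegree_finsetSum_le fun i _ => ?_
  refine (MvPolynomial.totalDegree_pow _ _).trans ?_
  simp

theorem pev_eq_zero (hN : 0 < N) (q : MvPolynomial (Fin N) ℝ)
    (h : ∀ x ∈ Metric.ball (0 : Eu N) 1, pev q x = 0) : q = 0 := by
  have hN' : (0:ℝ) < N := by exact_mod_cast hN
  have hN1 : (1:ℝ) ≤ N := by exact_mod_cast hN
  refine MvPolynomial.funext_set (fun _ => Ioo (0:ℝ) (1 / N)) (fun _ => Ioo_infinite (by positivity)) ?_
  intro x hx
  have h1 := h (WithLp.toLp 2 x) ?_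
  · simpa [pev] using h1
  rw [mem_ball_zero_iff, ← sq_lt_one_iff₀ (norm_nonneg _), EuclideanSpace.norm_sq_eq]
  have hlt : ∀ i, ‖(WithLp.toLp 2 x : Eu N) i‖ ^ 2 < 1 / N := fun i => by
    have := hx i (mem_univ _)
    simp only [mem_Ioo] at this
    have h3 : (1:ℝ) / N ≤ 1 := by rw [div_le_one hN']; exact hN1
    simp only [Real.norm_eq_abs, sq_abs]
    nlinarith [this.1, this.2]
  have : Nonempty (Fin N) := ⟨⟨0, hN⟩⟩
  calc _ < ∑ i : Fin N, (1:ℝ) / N := Finset.sum_lt_sum_of_nonempty Finset.univ_nonempty fun i _ => hlt i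
    _ = 1 := by simp; field_simp

theorem poly_dirichlet (hN : 0 < N) (p g : MvPolynomial (Fin N) ℝ) :
    ∃ w : MvPolynomial (Fin N) ℝ, PLap w = p ∧ ∀ x : Eu N, ‖x‖ = 1 → pev w x = pev g x := by
  obtain ⟨m, hm⟩ : ∃ m, m = (p - PLap g).totalDegree := ⟨_, rfl⟩
  let L0 : MvPolynomial (Fin N) ℝ →ₗ[ℝ] MvPolynomial (Fin N) ℝ :=
    PLap ∘ₗ LinearMap.mulLeft ℝ (pS N)
  have hmaps : ∀ q ∈ MvPolynomial.restrictTotalDegree (Fin N) ℝ m,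
      L0 q ∈ MvPolynomial.restrictTotalDegree (Fin N) ℝ m := by
    intro q hq
    rw [MvPolynomial.mem_restrictTotalDegree] at hq ⊢
    simp only [L0, LinearMap.comp_apply, LinearMap.mulLeft_apply, PLap_apply]
    refine MvPolynomial.totalDegree_finsetSum_le fun i _ => ?_
    have h1 := totalDegree_pderiv_le (MvPolynomial.pderiv i (pS N * q)) i
    have h2 := totalDegree_pderiv_le (pS N * q) i
    have h3 := MvPolynomial.totalDegree_mul (pS N) q
    have h4 := pS_degree (N := N)
    omega
  let L := L0.restrict hmaps
  have hinj : Function.Injective L := by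
    rw [← LinearMap.ker_eq_bot, LinearMap.ker_eq_bot']
    intro q hq
    have hq0 : PLap (pS N * (q : MvPolynomial (Fin N) ℝ)) = 0 := by
      have := congrArg Subtype.val hq
      simpa [L, L0] using this
    have hlap : ∀ x, lap (pev (pS N * (q : MvPolynomial (Fin N) ℝ))) x = 0 := fun x => by
      rw [lap_pev, hq0]; simp [pev]
    have hmul : ∀ x, pev (pS N * (q : MvPolynomial (Fin N) ℝ)) x = (1 - ‖x‖ ^ 2) * pev q x := fun x => by
      rw [← pev_pS]; simp [pev]
    have hcd : ∀ x, ContDiffAt ℝ 2 (pev (pS N * (q : MvPolynomial (Fin N) ℝ))) x := fun x =>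
      (contDiff_infty.1 (pev_contDiff _) 2).contDiffAt
    have hfr : ∀ y ∈ frontier (Metric.ball (0 : Eu N) 1), ‖y‖ = 1 := fun y hy => by
      rw [frontier_ball _ one_ne_zero] at hy; simpa using hy
    have h1 := weak_max (v := pev (pS N * (q : MvPolynomial (Fin N) ℝ))) hN Metric.isBounded_ball
      Metric.isOpen_ball (pev_contDiff _).continuous.continuousOn (fun y _ => hcd y)
      (fun y _ => (hlap y).ge) (κ := 0) (fun y hy => by rw [hmul, hfr y hy]; simp)
    have h2 := weak_max (v := fun y => - pev (pS N * (q : MvPolynomial (Fin N) ℝ)) y) hN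
      Metric.isBounded_ball
      Metric.isOpen_ball (pev_contDiff _).continuous.neg.continuousOn (fun y _ => (hcd y).neg)
      (fun y _ => by rw [lap_neg (hcd y), hlap]; simp) (κ := 0)
      (fun y hy => by rw [hmul, hfr y hy]; simp)
    ext1
    refine pev_eq_zero hN _ fun x hx => ?_
    have h3 := h1 x hx
    have h4 := h2 x hx
    have h5 : (1 - ‖x‖ ^ 2) * pev q x = 0 := by rw [← hmul]; linarith
    rcases mul_eq_zero.1 h5 with h | h
    · rw [mem_ball_zero_iff] at hx
      nlinarith [norm_nonneg x]
    · exact h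
  have hsurj : Function.Surjective L := LinearMap.injective_iff_surjective.1 hinj
  obtain ⟨q, hq⟩ := hsurj ⟨p - PLap g, by
    rw [MvPolynomial.mem_restrictTotalDegree, hm]⟩
  have hq0 : PLap (pS N * (q : MvPolynomial (Fin N) ℝ)) = p - PLap g := by
    have := congrArg Subtype.val hq
    simpa [L, L0] using this
  refine ⟨g + pS N * q, by rw [map_add, hq0]; abel, fun x hx => ?_⟩
  have : pev (g + pS N * (q : MvPolynomial (Fin N) ℝ)) x = pev g x + pev (pS N) x * pev q x := by
    simp [pev]
  rw [this, pev_pS, hx]; simp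

theorem poly_dense (f : Eu N → ℝ) (hf : ContinuousOn f (Metric.closedBall 0 1)) {ε : ℝ}
    (hε : 0 < ε) : ∃ p : MvPolynomial (Fin N) ℝ, ∀ x ∈ Metric.closedBall (0 : Eu N) 1,
      |pev p x - f x| < ε := by
  let K := Metric.closedBall (0 : Eu N) 1
  have : CompactSpace K := isCompact_iff_compactSpace.1 (isCompact_closedBall _ _)
  let F : Fin N → C(K, ℝ) := fun i => ⟨fun x => x.1 i, by fun_prop⟩
  let A : Subalgebra ℝ C(K, ℝ) := (MvPolynomial.aeval F).range
  have hev : ∀ (p : MvPolynomial (Fin N) ℝ) (x : K), (MvPolynomial.aeval F p) x = pev p x.1 := by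
    intro p x
    induction p using MvPolynomial.induction_on with
    | C a => simp [pev]
    | add p q hp hq => simp [pev] at *; rw [hp, hq]
    | mul_X p j hp => simp [pev] at *; rw [hp]; rfl
  have hsep : A.SeparatesPoints := by
    intro x y hxy
    have : ∃ i, x.1 i ≠ y.1 i := by
      by_contra hcon
      push Not at hcon
      exact hxy (Subtype.ext (by ext i; exact hcon i))
    obtain ⟨i, hi⟩ := this
    refine ⟨F i, ⟨F i, ⟨MvPolynomial.X i, by simp⟩, rfl⟩, hi⟩
  obtain ⟨⟨g, ⟨p, hp⟩⟩, hg⟩ :=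
    ContinuousMap.exists_mem_subalgebra_near_continuous_of_separatesPoints A hsep
      (fun x => f x.1) (continuousOn_iff_continuous_domRestrict.1 hf) ε hε
  refine ⟨p, fun x hx => ?_⟩
  have h1 := hg ⟨x, hx⟩
  have h2 := hev p ⟨x, hx⟩
  have hp' : MvPolynomial.aeval F p = g := hp
  rw [← h2, hp']
  simpa using h1

end poly

end

section

open Set Filter MeasureTheory
open scoped Topology ContDiff

/-! ## Part E1: harmonic functions, quadratic approximation -/

section harm
variable {N : ℕ}

/-- smooth entire harmonic functions -/
def Harm (h : Eu N → ℝ) : Prop := ContDiff ℝ ∞ h ∧ ∀ x, lap h x = 0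

theorem Harm.c2 {h : Eu N → ℝ} (hh : Harm h) (x : Eu N) : ContDiffAt ℝ 2 h x :=
  (contDiff_infty.1 hh.1 2).contDiffAt

theorem contDiff_dir {h : Eu N → ℝ} (hh : ContDiff ℝ ∞ h) (ξ : Eu N) :
    ContDiff ℝ ∞ (fun y => fderiv ℝ h y ξ) :=
  (hh.fderiv_right (m := ∞) (by simp)).clm_apply contDiff_const

theorem fderiv_dir {h : Eu N → ℝ} {x : Eu N} (hh : ContDiffAt ℝ 2 h x) (ξ ζ : Eu N) :
    fderiv ℝ (fun y => fderiv ℝ h y ξ) x ζ = D2 h x ζ ξ := by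
  have := fderiv_clm_apply (hh.fderiv_diff) (differentiableAt_const ξ)
  rw [this]; simp

theorem D2_symm {h : Eu N → ℝ} {x : Eu N} (hh : ContDiffAt ℝ 2 h x) (ξ ζ : Eu N) :
    D2 h x ζ ξ = D2 h x ξ ζ := by
  have := hh.isSymmSndFDerivAt (by simp)
  exact this ζ ξ

theorem Harm.dir {h : Eu N → ℝ} (hh : Harm h) (ξ : Eu N) : Harm (fun y => fderiv ℝ h y ξ) := by
  refine ⟨contDiff_dir hh.1 ξ, fun x => ?_⟩
  have c2 : ∀ (v : Eu N → ℝ), ContDiff ℝ ∞ v → ∀ x, ContDiffAt ℝ 2 v x := fun v hv x =>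
    (contDiff_infty.1 hv 2).contDiffAt
  have sw : ∀ (v : Eu N → ℝ), ContDiff ℝ ∞ v → ∀ (a b : Eu N) x,
      fderiv ℝ (fun y => fderiv ℝ v y a) x b = fderiv ℝ (fun y => fderiv ℝ v y b) x a := by
    intro v hv a b x
    rw [fderiv_dir (c2 v hv x), fderiv_dir (c2 v hv x), D2_symm (c2 v hv x)]
  have key : ∀ i : Fin N, fderiv ℝ (fun y => fderiv ℝ (fun y => fderiv ℝ h y ξ) y (eb i)) x (eb i)
      = fderiv ℝ (fun z => fderiv ℝ (fun y => fderiv ℝ h y (eb i)) z (eb i)) x ξ := by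
    intro i
    have e1 : (fun y => fderiv ℝ (fun y => fderiv ℝ h y ξ) y (eb i)) =
        fun y => fderiv ℝ (fun y => fderiv ℝ h y (eb i)) y ξ := by
      funext y; exact sw h hh.1 ξ (eb i) y
    rw [e1]
    exact sw _ (contDiff_dir hh.1 (eb i)) ξ (eb i) x
  have h0 : (fun z => lap h z) = fun _ => 0 := by funext z; exact hh.2 z
  have h1 : fderiv ℝ (fun z => lap h z) x ξ = 0 := by rw [h0]; simp
  unfold lap at h1 ⊢
  rw [fderiv_fun_sum] at h1
  · rw [← h1, sum_apply]
    exact Finset.sum_congr rfl fun i _ => key i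
  · intro i _
    exact ((contDiff_dir (contDiff_dir hh.1 (eb i)) (eb i)).differentiable (by simp)) x

theorem taylor3 {g g1 g2 g3 : ℝ → ℝ} {K : ℝ} (h0 : ∀ s, HasDerivAt g (g1 s) s)
    (h1 : ∀ s, HasDerivAt g1 (g2 s) s) (h2 : ∀ s, HasDerivAt g2 (g3 s) s)
    (hK : ∀ s ∈ Icc (0:ℝ) 1, |g3 s| ≤ K) : |g 1 - g 0 - g1 0 - 1 / 2 * g2 0| ≤ K := by
  have hK0 : 0 ≤ K := (abs_nonneg _).trans (hK 0 (by simp))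
  have mv : ∀ (f f' : ℝ → ℝ), (∀ s, HasDerivAt f (f' s) s) → (∀ s ∈ Icc (0:ℝ) 1, |f' s| ≤ K) →
      ∀ s ∈ Icc (0:ℝ) 1, |f s - f 0| ≤ K := by
    intro f f' hf hf' s hs
    have := (convex_Icc (0:ℝ) 1).norm_image_sub_le_of_norm_hasDerivWithin_le
      (f := f) (f' := f') (fun x _ => (hf x).hasDerivWithinAt) hf' (by simp : (0:ℝ) ∈ Icc (0:ℝ) 1) hs
    simp only [Real.norm_eq_abs, sub_zero] at this
    have h3 : |s| ≤ 1 := by rw [abs_le]; constructor <;> linarith [hs.1, hs.2]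
    calc _ ≤ K * |s| := this
      _ ≤ K * 1 := by gcongr
      _ = K := by ring
  have a2 := mv g2 g3 h2 hK
  have a1 := mv (fun s => g1 s - g2 0 * s) (fun s => g2 s - g2 0)
    (fun s => ((h1 s).sub ((hasDerivAt_id s).const_mul (g2 0))).congr_deriv (by simp)) a2
  have a0 := mv (fun s => g s - g1 0 * s - g2 0 / 2 * s ^ 2) (fun s => g1 s - g1 0 - g2 0 * s)
    (fun s => by
      refine (((h0 s).sub ((hasDerivAt_id s).const_mul (g1 0))).sub
        (((hasDerivAt_id s).pow 2).const_mul (g2 0 / 2))).congr_deriv ?_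
      simp; ring)
    (fun s hs => by
      have := a1 s hs
      simp only [mul_zero, sub_zero] at this
      convert this using 2; ring)
  have := a0 1 (by simp)
  convert this using 2
  simp; ring

theorem harm_quad1 (N : ℕ) : ∃ C : ℝ, 0 ≤ C ∧ ∀ (h : Eu N → ℝ) (M : ℝ), Harm h →
    (∀ y ∈ Metric.ball (0 : Eu N) 1, |h y| ≤ M) →
    |h 0| ≤ C * M ∧ ‖fderiv ℝ h 0‖ ≤ C * M ∧ ‖D2 h 0‖ ≤ C * M ∧
    ∀ y, ‖y‖ < 1 / 2 → |h y - h 0 - fderiv ℝ h 0 y - 1 / 2 * D2 h 0 y y| ≤ C * M * ‖y‖ ^ 3 := by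
  obtain ⟨C0, hC0, hg⟩ := grad_lin N
  obtain ⟨C, hC⟩ : ∃ C, C = 6 * C0 + 1 := ⟨_, rfl⟩
  have hC1 : 1 ≤ C := by rw [hC]; linarith
  have step : ∀ (h : Eu N → ℝ) (R M : ℝ), Harm h → (∀ y ∈ Metric.ball (0 : Eu N) R, |h y| ≤ M) →
      ∀ ξ, ∀ y ∈ Metric.ball (0 : Eu N) (R - 1 / 6), |fderiv ℝ h y ξ| ≤ C * M * ‖ξ‖ := by
    intro h R M hh hM ξ y hy
    have hsub : Metric.ball y (1 / 6) ⊆ Metric.ball (0 : Eu N) R := by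
      refine Metric.ball_subset_ball' ?_
      rw [Metric.mem_ball] at hy; linarith
    have hM0 : 0 ≤ M := (abs_nonneg _).trans (hM y (hsub (Metric.mem_ball_self (by norm_num))))
    have h1 := hg y h (1 / 6) 0 M (by norm_num) (fun z _ => hh.c2 z) (fun z hz => hM z (hsub hz))
      (fun z _ => by rw [hh.2 z]; simp)
    have h2 : ‖fderiv ℝ h y‖ ≤ C * M := by
      refine h1.trans ?_
      rw [hC]; linarith
    calc |fderiv ℝ h y ξ| ≤ ‖fderiv ℝ h y‖ * ‖ξ‖ := (fderiv ℝ h y).le_opNorm ξ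
      _ ≤ C * M * ‖ξ‖ := by gcongr
  refine ⟨C ^ 3, by positivity, fun h M hh hM => ?_⟩
  have hM0 : 0 ≤ M := (abs_nonneg _).trans (hM 0 (by simp))
  have d1 := step h 1 M hh hM
  have d2 : ∀ ξ ζ, ∀ y ∈ Metric.ball (0 : Eu N) (4 / 6), |D2 h y ζ ξ| ≤ C ^ 2 * M * ‖ξ‖ * ‖ζ‖ := by
    intro ξ ζ y hy
    have := step _ (5 / 6) _ (hh.dir ξ) (fun y hy => d1 ξ y (by norm_num at hy ⊢; exact hy)) ζ y
      (by norm_num at hy ⊢; exact hy)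
    rw [fderiv_dir (hh.c2 y)] at this
    calc _ ≤ _ := this
      _ = _ := by ring
  have d3 : ∀ ξ, ∀ y ∈ Metric.ball (0 : Eu N) (1 / 2),
      |fderiv ℝ (fun z => D2 h z ξ ξ) y ξ| ≤ C ^ 3 * M * ‖ξ‖ ^ 3 := by
    intro ξ y hy
    have e : (fun z => D2 h z ξ ξ) = fun z => fderiv ℝ (fun y => fderiv ℝ h y ξ) z ξ := by
      funext z; rw [fderiv_dir (hh.c2 z)]
    have := step _ (4 / 6) _ ((hh.dir ξ).dir ξ) (fun y hy => by
      rw [← congrFun e y]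
      exact d2 ξ ξ y hy) ξ y
      (by norm_num at hy ⊢; exact hy)
    rw [e]
    calc _ ≤ _ := this
      _ = _ := by ring
  have hp1 : 1 ≤ C ^ 2 := one_le_pow₀ hC1
  have hCC2 : C ≤ C ^ 3 := by nlinarith
  have hCC3 : C ^ 2 ≤ C ^ 3 := by nlinarith
  have hCC1 : 1 ≤ C ^ 3 := by nlinarith
  refine ⟨?_, ?_, ?_, ?_⟩
  · have := hM 0 (by simp)
    nlinarith
  · refine ContinuousLinearMap.opNorm_le_bound _ (by positivity) fun ξ => ?_
    have := d1 ξ 0 (by norm_num)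
    calc _ ≤ _ := this
      _ ≤ _ := by gcongr
  · refine ContinuousLinearMap.opNorm_le_bound₂ _ (by positivity) fun ξ ζ => ?_
    have := d2 ζ ξ 0 (by norm_num)
    calc _ ≤ _ := this
      _ = C ^ 2 * M * ‖ξ‖ * ‖ζ‖ := by ring
      _ ≤ _ := by gcongr
  · intro y hy
    have hl : ∀ s : ℝ, HasDerivAt (fun s : ℝ => s • y) y s := fun s => by
      simpa using ((hasDerivAt_id s).smul_const y)
    have hd : ∀ v : Eu N → ℝ, ContDiff ℝ ∞ v → ∀ s : ℝ,
        HasDerivAt (fun s : ℝ => v (s • y)) (fderiv ℝ v (s • y) y) s := fun v hv s =>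
      ((hv.differentiable (by simp)) (s • y)).hasFDerivAt.comp_hasDerivAt s (hl s)
    have e : (fun z => D2 h z y y) = fun z => fderiv ℝ (fun x => fderiv ℝ h x y) z y := by
      funext z; rw [fderiv_dir (hh.c2 z)]
    have := taylor3 (g := fun s => h (s • y)) (g1 := fun s => fderiv ℝ h (s • y) y)
      (g2 := fun s => D2 h (s • y) y y) (g3 := fun s => fderiv ℝ (fun z => D2 h z y y) (s • y) y)
      (K := C ^ 3 * M * ‖y‖ ^ 3) (hd h hh.1)
      (fun s => by
        have := hd _ (contDiff_dir hh.1 y) s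
        rwa [fderiv_dir (hh.c2 _)] at this)
      (fun s => hd (fun z => D2 h z y y) (by rw [e]; exact contDiff_dir (contDiff_dir hh.1 y) y) s)
      (fun s hs => d3 y _ (by
        rw [mem_ball_zero_iff, norm_smul, Real.norm_of_nonneg hs.1]
        nlinarith [hs.2, norm_nonneg y]))
    simpa using this

theorem Harm.scale {h : Eu N → ℝ} (hh : Harm h) (x0 : Eu N) (r : ℝ) :
    Harm (fun y => h (x0 + r • y)) := by
  refine ⟨hh.1.comp (by fun_prop), fun x => ?_⟩
  rw [lap_scale r x0 (hh.c2 _), hh.2, mul_zero]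

/-- quadratic approximation of a harmonic function, with scaling -/
theorem harm_quad (N : ℕ) : ∃ C : ℝ, 1 ≤ C ∧ ∀ (x0 : Eu N) (r : ℝ) (h : Eu N → ℝ) (M : ℝ), 0 < r →
    Harm h → (∀ y, ‖y‖ < r → |h (x0 + y)| ≤ M) →
    ∃ (c : ℝ) (L : Eu N →L[ℝ] ℝ) (Q : Eu N →L[ℝ] Eu N →L[ℝ] ℝ),
      |c| ≤ C * M ∧ ‖L‖ ≤ C * M / r ∧ ‖Q‖ ≤ C * M / r ^ 2 ∧ (∀ ξ ζ, Q ξ ζ = Q ζ ξ) ∧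
      (∑ i, Q (eb i) (eb i) = 0) ∧
      ∀ y, ‖y‖ < r / 2 → |h (x0 + y) - (c + L y + 1 / 2 * Q y y)| ≤ C * M * (‖y‖ / r) ^ 3 := by
  obtain ⟨C, hC0, hC⟩ := harm_quad1 N
  refine ⟨C + 1, by linarith, fun x0 r h M hr hh hM => ?_⟩
  have hM0 : 0 ≤ M := (abs_nonneg _).trans (hM 0 (by simpa using hr))
  have hs := hh.scale x0 r
  obtain ⟨h1, h2, h3, h4⟩ := hC (fun y => h (x0 + r • y)) M hs (fun y hy => hM _ (by
    rw [mem_ball_zero_iff] at hy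
    rw [norm_smul, Real.norm_of_nonneg hr.le]; nlinarith))
  obtain ⟨L, hL⟩ : ∃ L, L = fderiv ℝ (fun y => h (x0 + r • y)) 0 := ⟨_, rfl⟩
  obtain ⟨Q, hQ⟩ : ∃ Q, Q = D2 (fun y => h (x0 + r • y)) 0 := ⟨_, rfl⟩
  have hsym : ∀ ξ ζ, Q ξ ζ = Q ζ ξ := fun ξ ζ => by rw [hQ]; exact D2_symm (hs.c2 0) ζ ξ
  have htr : ∑ i, Q (eb i) (eb i) = 0 := by rw [hQ, ← lap_eq (hs.c2 0)]; exact hs.2 0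
  rw [← hL] at h2
  rw [← hQ] at h3
  rw [← hL, ← hQ] at h4
  have hCM : C * M ≤ (C + 1) * M := by nlinarith
  refine ⟨h (x0 + r • 0), r⁻¹ • L, (r⁻¹ ^ 2) • Q, h1.trans hCM, ?_, ?_, ?_, ?_, ?_⟩
  · rw [norm_smul, norm_inv, Real.norm_of_nonneg hr.le, div_eq_inv_mul]
    gcongr
    exact h2.trans hCM
  · refine ContinuousLinearMap.opNorm_le_bound₂ _ (by positivity) fun ξ ζ => ?_
    have h5 := Q.le_opNorm₂ ξ ζ
    have h6 : ((r⁻¹ ^ 2) • Q) ξ ζ = r⁻¹ ^ 2 * Q ξ ζ := by simp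
    rw [h6, norm_mul, Real.norm_of_nonneg (by positivity : (0:ℝ) ≤ r⁻¹ ^ 2)]
    calc _ ≤ r⁻¹ ^ 2 * (‖Q‖ * ‖ξ‖ * ‖ζ‖) := by gcongr
      _ ≤ r⁻¹ ^ 2 * ((C + 1) * M * ‖ξ‖ * ‖ζ‖) := by gcongr; exact h3.trans hCM
      _ = _ := by rw [inv_pow]; field_simp
  · intro ξ ζ; simp [hsym ξ ζ]
  · have : ∀ i : Fin N, ((r⁻¹ ^ 2) • Q) (eb i) (eb i) = r⁻¹ ^ 2 * Q (eb i) (eb i) := fun i => by simp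
    simp_rw [this]
    rw [← Finset.mul_sum, htr, mul_zero]
  · intro y hy
    have h5 := h4 (r⁻¹ • y) (by
      rw [norm_smul, norm_inv, Real.norm_of_nonneg hr.le, inv_mul_lt_iff₀ hr]; linarith)
    rw [smul_smul, mul_inv_cancel₀ hr.ne', one_smul, norm_smul, norm_inv,
      Real.norm_of_nonneg hr.le] at h5
    simp only [map_smul, smul_apply, smul_eq_mul] at h5 ⊢
    calc _ = |h (x0 + y) - h (x0 + r • 0) - r⁻¹ * L y - 1 / 2 * (r⁻¹ * (r⁻¹ * Q y y))| := by
          congr 1; ring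
      _ ≤ _ := h5
      _ ≤ (C + 1) * M * (r⁻¹ * ‖y‖) ^ 3 := by gcongr
      _ = _ := by rw [div_eq_inv_mul]

/-- approximate solution of the Dirichlet problem in a ball -/
theorem harm_dirichlet (hN : 0 < N) {x0 : Eu N} {r : ℝ} (hr : 0 < r) {φ : Eu N → ℝ}
    (hφ : ContinuousOn φ (Metric.closedBall x0 r)) {ε : ℝ} (hε : 0 < ε) :
    ∃ h, Harm h ∧ ∀ x, ‖x - x0‖ = r → |h x - φ x| ≤ ε := by
  have hc : ContinuousOn (fun y => φ (x0 + r • y)) (Metric.closedBall (0 : Eu N) 1) := by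
    refine hφ.comp (by fun_prop) fun y hy => ?_
    rw [mem_closedBall_zero_iff] at hy
    rw [Metric.mem_closedBall, dist_eq_norm, add_sub_cancel_left, norm_smul,
      Real.norm_of_nonneg hr.le]
    nlinarith
  obtain ⟨p, hp⟩ := poly_dense _ hc hε
  obtain ⟨w, hw, hwp⟩ := poly_dirichlet hN 0 p
  have hH : Harm (pev w) := ⟨pev_contDiff w, fun x => by rw [lap_pev, hw]; simp [pev]⟩
  refine ⟨fun x => pev w (-(r⁻¹ • x0) + r⁻¹ • x), hH.scale _ _, fun x hx => ?_⟩
  have e : -(r⁻¹ • x0) + r⁻¹ • x = r⁻¹ • (x - x0) := by rw [smul_sub]; abel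
  have hn : ‖r⁻¹ • (x - x0)‖ = 1 := by
    rw [norm_smul, norm_inv, Real.norm_of_nonneg hr.le, hx, inv_mul_cancel₀ hr.ne']
  have h2 := hp (r⁻¹ • (x - x0)) (by rw [mem_closedBall_zero_iff, hn])
  simp only [e]
  rw [hwp _ hn]
  rw [smul_smul, mul_inv_cancel₀ hr.ne', one_smul, add_sub_cancel] at h2
  exact h2.le

end harm

end

section

open Set Filter MeasureTheory
open scoped Topology ContDiff

/-! ## Part E: generalized solutions of the Poisson equation -/

section gsol

variable {N : ℕ}

/-- generalized solution of `Δ u = f` on `S`: locally uniform limit of `C²` functions whose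
Laplacians converge locally uniformly. -/
def GSol (S : Set (Eu N)) (u f : Eu N → ℝ) : Prop :=
  ∀ K ⊆ S, IsCompact K → ∀ ε > 0, ∃ v : Eu N → ℝ, ∀ y ∈ K,
    ContDiffAt ℝ 2 v y ∧ |v y - u y| ≤ ε ∧ |lap v y - f y| ≤ ε

theorem GSol.mono {S T : Set (Eu N)} {u f : Eu N → ℝ} (h : GSol S u f) (hT : T ⊆ S) : GSol T u f :=
  fun K hK => h K (hK.trans hT)

theorem GSol.congr {S : Set (Eu N)} {u f u' f' : Eu N → ℝ} (h : GSol S u f)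
    (hu : ∀ y ∈ S, u y = u' y) (hf : ∀ y ∈ S, f y = f' y) : GSol S u' f' := by
  intro K hK hKc ε hε
  obtain ⟨v, hv⟩ := h K hK hKc ε hε
  exact ⟨v, fun y hy => by rw [← hu y (hK hy), ← hf y (hK hy)]; exact hv y hy⟩

theorem GSol.of_c2 {S : Set (Eu N)} {u : Eu N → ℝ} (hu : ∀ y ∈ S, ContDiffAt ℝ 2 u y) :
    GSol S u (lap u) :=
  fun K hK _ ε hε => ⟨u, fun y hy => ⟨hu y (hK hy), by simpa using hε.le, by simpa using hε.le⟩⟩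

theorem GSol.sub {S : Set (Eu N)} {u f u' f' : Eu N → ℝ} (h : GSol S u f) (h' : GSol S u' f') :
    GSol S (fun y => u y - u' y) (fun y => f y - f' y) := by
  intro K hK hKc ε hε
  obtain ⟨v, hv⟩ := h K hK hKc (ε / 2) (half_pos hε)
  obtain ⟨w, hw⟩ := h' K hK hKc (ε / 2) (half_pos hε)
  refine ⟨fun y => v y - w y, fun y hy => ?_⟩
  obtain ⟨a1, a2, a3⟩ := hv y hy
  obtain ⟨b1, b2, b3⟩ := hw y hy
  refine ⟨a1.sub b1, ?_, ?_⟩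
  · rw [abs_le] at *; constructor <;> linarith
  · rw [lap_sub a1 b1]; rw [abs_le] at *; constructor <;> linarith

theorem GSol.scale {S T : Set (Eu N)} {u f : Eu N → ℝ} (h : GSol S u f) (z : Eu N) (r : ℝ)
    (hT : ∀ y ∈ T, z + r • y ∈ S) :
    GSol T (fun y => u (z + r • y)) (fun y => r ^ 2 * f (z + r • y)) := by
  intro K hK hKc ε hε
  have hc : Continuous fun y : Eu N => z + r • y := by fun_prop
  obtain ⟨v, hv⟩ := h ((fun y => z + r • y) '' K)
    (by rintro _ ⟨y, hy, rfl⟩; exact hT y (hK hy)) (hKc.image hc)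
    (ε / (1 + r ^ 2)) (by positivity)
  refine ⟨fun y => v (z + r • y), fun y hy => ?_⟩
  obtain ⟨a1, a2, a3⟩ := hv _ ⟨y, hy, rfl⟩
  refine ⟨?_, a2.trans ?_, ?_⟩
  · exact ContDiffAt.comp y a1 (by fun_prop)
  · exact div_le_self hε.le (by nlinarith [sq_nonneg r])
  · rw [lap_scale r z a1, ← mul_sub, abs_mul, abs_of_nonneg (sq_nonneg r)]
    rw [le_div_iff₀ (by positivity)] at a3
    nlinarith [abs_nonneg (lap v (z + r • y) - f (z + r • y))]

theorem GSol.translate {S T : Set (Eu N)} {u f : Eu N → ℝ} (h : GSol S u f) (z : Eu N)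
    (hT : ∀ y ∈ T, y + z ∈ S) :
    GSol T (fun y => u (y + z)) (fun y => f (y + z)) := by
  refine (h.scale (T := T) z 1 (fun y hy => ?_)).congr (fun y _ => ?_) (fun y _ => ?_)
  · rw [one_smul, add_comm]; exact hT y hy
  · rw [one_smul, add_comm]
  · rw [one_smul, add_comm, one_pow, one_mul]

theorem GSol.continuousAt {S : Set (Eu N)} (hS : IsOpen S) {u f : Eu N → ℝ} (h : GSol S u f)
    {x : Eu N} (hx : x ∈ S) : ContinuousAt u x := by
  refine continuousAt_of_locally_uniform_approx_of_continuousAt fun w hw => ?_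
  obtain ⟨ε, hε, hw⟩ := Metric.mem_uniformity_dist.1 hw
  obtain ⟨r, hr, hrS⟩ := Metric.isOpen_iff.1 hS x hx
  have hsub : Metric.closedBall x (r / 2) ⊆ S :=
    (Metric.closedBall_subset_ball (by linarith)).trans hrS
  obtain ⟨v, hv⟩ := h _ hsub (isCompact_closedBall _ _) (ε / 2) (half_pos hε)
  refine ⟨_, Metric.closedBall_mem_nhds x (half_pos hr), v,
    (hv x (Metric.mem_closedBall_self (by linarith))).1.continuousAt, fun y hy => hw ?_⟩
  rw [dist_comm, Real.dist_eq]
  linarith [(hv y hy).2.1]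

theorem cmax1 (hN : 0 < N) {v : Eu N → ℝ} {x0 : Eu N} {r ε θ : ℝ} (hr : 0 < r) (hθ : 0 ≤ θ)
    (hc : ContinuousOn v (Metric.closedBall x0 r))
    (h2 : ∀ y ∈ Metric.ball x0 r, ContDiffAt ℝ 2 v y)
    (hl : ∀ y ∈ Metric.ball x0 r, -θ ≤ lap v y)
    (hb : ∀ y ∈ Metric.sphere x0 r, v y ≤ ε) :
    ∀ y ∈ Metric.closedBall x0 r, v y ≤ ε + θ * (r ^ 2 - ‖y - x0‖ ^ 2) := by
  intro y hy
  have hnc : ∀ y, ContDiffAt ℝ 2 (fun z : Eu N => ‖z - x0‖ ^ 2) y := fun y =>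
    ((contDiff_id.sub contDiff_const).norm_sq ℝ).contDiffAt
  have hN1 : (1:ℝ) ≤ N := by exact_mod_cast hN
  rcases (Metric.mem_closedBall.1 hy).eq_or_lt with h | h
  · have h1 := hb y h
    rw [dist_eq_norm] at h
    rw [h]; linarith
  · have := weak_max (v := fun y => v y + θ * ‖y - x0‖ ^ 2) hN (U := Metric.ball x0 r)
      Metric.isBounded_ball Metric.isOpen_ball (κ := ε + θ * r ^ 2)
      (by
        rw [closure_ball x0 hr.ne']
        exact hc.add (by fun_prop))
      (fun y hy => (h2 y hy).add (contDiffAt_const.mul (hnc y)))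
      (fun y hy => by
        rw [lap_add (h2 y hy) (contDiffAt_const.mul (hnc y)), lap_const_mul θ (hnc y), lap_normSq]
        nlinarith [hl y hy])
      (fun y hy => by
        rw [frontier_ball x0 hr.ne'] at hy
        have h1 := hb y hy
        rw [Metric.mem_sphere, dist_eq_norm] at hy
        rw [hy]; linarith) y h
    linarith

theorem gsol_max1 (hN : 0 < N) {S : Set (Eu N)} {u f : Eu N → ℝ} (h : GSol S u f)
    {x0 : Eu N} {r ε θ : ℝ} (hr : 0 < r) (hθ : 0 ≤ θ)
    (hS : Metric.closedBall x0 r ⊆ S)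
    (hl : ∀ y ∈ Metric.closedBall x0 r, -θ ≤ f y)
    (hb : ∀ y ∈ Metric.sphere x0 r, u y ≤ ε) :
    ∀ y ∈ Metric.closedBall x0 r, u y ≤ ε + θ * (r ^ 2 - ‖y - x0‖ ^ 2) := by
  intro y hy
  have key : ∀ δ > 0, u y ≤ ε + θ * (r ^ 2 - ‖y - x0‖ ^ 2) + δ * (2 + r ^ 2) := by
    intro δ hδ
    obtain ⟨v, hv⟩ := h _ hS (isCompact_closedBall _ _) δ hδ
    have hsub : ∀ z ∈ Metric.ball x0 r, z ∈ Metric.closedBall x0 r :=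
      fun z hz => Metric.ball_subset_closedBall hz
    have h1 := cmax1 hN (v := v) (ε := ε + δ) (θ := θ + δ) hr (by linarith)
      (fun z hz => (hv z hz).1.continuousAt.continuousWithinAt)
      (fun z hz => (hv z (hsub z hz)).1)
      (fun z hz => by
        have := (abs_le.1 (hv z (hsub z hz)).2.2).1
        linarith [hl z (hsub z hz)])
      (fun z hz => by
        have := (abs_le.1 (hv z (Metric.sphere_subset_closedBall hz)).2.1).2
        linarith [hb z hz]) y hy
    have h2 := (abs_le.1 (hv y hy).2.1).1
    nlinarith [sq_nonneg ‖y - x0‖]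
  refine le_of_forall_pos_le_add fun δ hδ => ?_
  have := key (δ / (2 + r ^ 2)) (by positivity)
  rwa [div_mul_cancel₀ _ (by positivity)] at this

theorem GSol.neg {S : Set (Eu N)} {u f : Eu N → ℝ} (h : GSol S u f) :
    GSol S (fun y => - u y) (fun y => - f y) := by
  have h0 : GSol S (fun _ => 0) (fun _ => 0) :=
    (GSol.of_c2 (u := fun _ => (0:ℝ)) (fun y _ => contDiffAt_const)).congr (fun _ _ => rfl)
      (fun y _ => lap_const 0)
  exact (h0.sub h).congr (fun y _ => by ring) (fun y _ => by ring)

theorem gsol_max (hN : 0 < N) {S : Set (Eu N)} {u f : Eu N → ℝ} (h : GSol S u f)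
    {x0 : Eu N} {r ε θ : ℝ} (hr : 0 < r) (hθ : 0 ≤ θ)
    (hS : Metric.closedBall x0 r ⊆ S)
    (hl : ∀ y ∈ Metric.closedBall x0 r, |f y| ≤ θ)
    (hb : ∀ y ∈ Metric.sphere x0 r, |u y| ≤ ε) :
    ∀ y ∈ Metric.closedBall x0 r, |u y| ≤ ε + θ * (r ^ 2 - ‖y - x0‖ ^ 2) := by
  intro y hy
  rw [abs_le]
  have h1 := gsol_max1 hN h hr hθ hS (fun y hy => (abs_le.1 (hl y hy)).1)
    (fun y hy => (abs_le.1 (hb y hy)).2) y hy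
  have h2 := gsol_max1 hN (ε := ε) h.neg hr hθ hS (fun y hy => by linarith [(abs_le.1 (hl y hy)).2])
    (fun y hy => by linarith [(abs_le.1 (hb y hy)).1]) y hy
  constructor <;> linarith

/-- Generalized solutions are `C¹`, with the linear gradient estimate. -/
theorem gsol_c1 (N : ℕ) : ∃ C : ℝ, 0 ≤ C ∧ ∀ (S : Set (Eu N)) (u f : Eu N → ℝ), GSol S u f →
    ∀ (x : Eu N) (r A M : ℝ), 0 < r → Metric.closedBall x r ⊆ S →
    (∀ y ∈ Metric.closedBall x r, |u y| ≤ M) → (∀ y ∈ Metric.closedBall x r, |f y| ≤ A) →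
    DifferentiableAt ℝ u x ∧ ‖fderiv ℝ u x‖ ≤ C * (M / r + r * A) := by
  obtain ⟨C, hC, hg⟩ := grad_lin N
  refine ⟨C, hC, fun S u f h x r A M hr hS hM hA => ?_⟩
  have := fun n : ℕ => h _ hS (isCompact_closedBall _ _) (1 / ((n:ℝ) + 1)) (by positivity)
  choose v hv using this
  have hsub : ∀ y ∈ Metric.ball x (r / 2), Metric.ball y (r / 2) ⊆ Metric.closedBall x r := by
    intro y hy z hz
    rw [Metric.mem_ball] at hy hz
    rw [Metric.mem_closedBall]
    linarith [dist_triangle z y x]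
  have hε : Tendsto (fun n : ℕ => 1 / ((n:ℝ) + 1)) atTop (𝓝 0) :=
    tendsto_one_div_add_atTop_nhds_zero_nat
  have hself : ∀ y ∈ Metric.ball x (r / 2), y ∈ Metric.closedBall x r := fun y hy =>
    hsub y hy (Metric.mem_ball_self (by linarith))
  -- Cauchy estimate
  have hcau : ∀ y ∈ Metric.ball x (r / 2), ∀ m n, ‖fderiv ℝ (v m) y - fderiv ℝ (v n) y‖ ≤
      C * (((1 / ((m:ℝ) + 1)) + (1 / ((n:ℝ) + 1))) * (1 / (r / 2) + r / 2)) := by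
    intro y hy m n
    have e : fderiv ℝ (fun z => v m z - v n z) y = fderiv ℝ (v m) y - fderiv ℝ (v n) y :=
      fderiv_fun_sub ((hv m y (hself y hy)).1.differentiableAt (by norm_num))
        ((hv n y (hself y hy)).1.differentiableAt (by norm_num))
    rw [← e]
    refine (hg y (fun z => v m z - v n z) (r / 2) ((1 / ((m:ℝ) + 1)) + (1 / ((n:ℝ) + 1)))
      ((1 / ((m:ℝ) + 1)) + (1 / ((n:ℝ) + 1))) (by linarith) ?_ ?_ ?_).trans (le_of_eq ?_)
    · intro z hz
      exact (hv m z (hsub y hy hz)).1.sub (hv n z (hsub y hy hz)).1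
    · intro z hz
      have h1 := abs_le.1 (hv m z (hsub y hy hz)).2.1
      have h2 := abs_le.1 (hv n z (hsub y hy hz)).2.1
      rw [abs_le]; constructor <;> linarith
    · intro z hz
      rw [lap_sub (hv m z (hsub y hy hz)).1 (hv n z (hsub y hy hz)).1]
      have h1 := abs_le.1 (hv m z (hsub y hy hz)).2.2
      have h2 := abs_le.1 (hv n z (hsub y hy hz)).2.2
      rw [abs_le]; constructor <;> linarith
    · ring
  have hUC : UniformCauchySeqOn (fun n => fderiv ℝ (v n)) atTop (Metric.ball x (r / 2)) := by
    rw [Metric.uniformCauchySeqOn_iff]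
    intro ε hε0
    have ht : Tendsto (fun n : ℕ => C * (((1 / ((n:ℝ) + 1)) + (1 / ((n:ℝ) + 1))) *
        (1 / (r / 2) + r / 2))) atTop (𝓝 (C * ((0 + 0) * (1 / (r / 2) + r / 2)))) :=
      ((hε.add hε).mul_const _).const_mul _
    rw [show C * ((0 + 0) * (1 / (r / 2) + r / 2)) = 0 by ring] at ht
    obtain ⟨n0, hn0⟩ := (ht.eventually (gt_mem_nhds hε0)).exists
    refine ⟨n0, fun m hm n hn y hy => ?_⟩
    rw [dist_eq_norm]
    refine ((hcau y hy m n).trans ?_).trans_lt hn0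
    have hm' : (n0:ℝ) ≤ m := by exact_mod_cast hm
    have hn' : (n0:ℝ) ≤ n := by exact_mod_cast hn
    gcongr
  have hlim : ∀ y ∈ Metric.ball x (r / 2), ∃ L, Tendsto (fun n => fderiv ℝ (v n) y) atTop (𝓝 L) :=
    fun y hy => cauchySeq_tendsto_of_complete (hUC.cauchySeq hy)
  choose! g hgl using hlim
  have hx0 : x ∈ Metric.ball x (r / 2) := Metric.mem_ball_self (by linarith)
  have hD : HasFDerivAt u (g x) x := by
    refine hasFDerivAt_of_tendstoUniformlyOn (f := v) Metric.isOpen_ball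
      (hUC.tendstoUniformlyOn_of_tendsto hgl) (fun n y hy => ?_) (fun y hy => ?_) hx0
    · exact ((hv n y (hself y hy)).1.differentiableAt (by norm_num)).hasFDerivAt
    · rw [tendsto_iff_dist_tendsto_zero]
      refine squeeze_zero (fun _ => dist_nonneg) (fun n => ?_) hε
      rw [Real.dist_eq]; exact (hv n y (hself y hy)).2.1
  refine ⟨hD.differentiableAt, ?_⟩
  rw [hD.fderiv]
  have ht : Tendsto (fun n : ℕ => C * ((M + 1 / ((n:ℝ) + 1)) / r + r * (A + 1 / ((n:ℝ) + 1)))) atTop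
      (𝓝 (C * ((M + 0) / r + r * (A + 0)))) :=
    (((hε.const_add M).div_const r).add ((hε.const_add A).const_mul r)).const_mul C
  rw [add_zero, add_zero] at ht
  refine le_of_tendsto_of_tendsto (hgl x hx0).norm ht (Eventually.of_forall fun n => ?_)
  refine hg x (v n) r _ _ hr (fun y hy => (hv n y (Metric.ball_subset_closedBall hy)).1)
    (fun y hy => ?_) (fun y hy => ?_)
  · have hy' := Metric.ball_subset_closedBall hy
    have h1 := abs_le.1 (hv n y hy').2.1
    have h2 := abs_le.1 (hM y hy')
    rw [abs_le]; constructor <;> linarith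
  · have hy' := Metric.ball_subset_closedBall hy
    have h1 := abs_le.1 (hv n y hy').2.2
    have h2 := abs_le.1 (hA y hy')
    rw [abs_le]; constructor <;> linarith

end gsol

end

section

open Set Filter MeasureTheory
open scoped Topology ContDiff

/-! ## Part F: Campanato iteration -/

section campanato

variable {N : ℕ}

/-- gradient of a generalized solution is Hölder continuous with exponent 1/2 -/
theorem gsol_grad_holder {S : Set (Eu N)} {u f : Eu N → ℝ} (h : GSol S u f) {x0 : Eu N}
    {r A M : ℝ} (hr : 0 < r) (hS : Metric.closedBall x0 (4 * r) ⊆ S)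
    (hM : ∀ y ∈ Metric.closedBall x0 (4 * r), |u y| ≤ M)
    (hA : ∀ y ∈ Metric.closedBall x0 (4 * r), |f y| ≤ A) :
    ∃ K, 0 ≤ K ∧ (∀ x ∈ Metric.closedBall x0 (3 * r), DifferentiableAt ℝ u x ∧ ‖fderiv ℝ u x‖ ≤ K) ∧
      ∀ x ∈ Metric.ball x0 r, ∀ y ∈ Metric.ball x0 r,
      ‖fderiv ℝ u x - fderiv ℝ u y‖ ≤ K * √‖x - y‖ := by
  obtain ⟨C, hC, hg⟩ := gsol_c1 N
  have hx0 : x0 ∈ Metric.closedBall x0 (4 * r) := Metric.mem_closedBall_self (by linarith)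
  have hM0 : 0 ≤ M := (abs_nonneg _).trans (hM x0 hx0)
  have hA0 : 0 ≤ A := (abs_nonneg _).trans (hA x0 hx0)
  have hG1 : ∀ x ∈ Metric.closedBall x0 (3 * r), DifferentiableAt ℝ u x ∧
      ‖fderiv ℝ u x‖ ≤ C * (M / r + r * A) := by
    intro x hx
    have hsub : Metric.closedBall x r ⊆ Metric.closedBall x0 (4 * r) := by
      intro z hz
      rw [Metric.mem_closedBall] at *
      linarith [dist_triangle z x x0]
    exact hg S u f h x r A M hr (hsub.trans hS) (fun y hy => hM y (hsub hy))
      (fun y hy => hA y (hsub hy))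
  set G := C * (M / r + r * A) with hG
  have hG0 : 0 ≤ G := by positivity
  refine ⟨G + C * (G + 2 * A) + 2 * G / r, by positivity, fun x hx => ⟨(hG1 x hx).1, ?_⟩,
    fun x hx y hy => ?_⟩
  · have h1 : 0 ≤ C * (G + 2 * A) + 2 * G / r := by positivity
    linarith [(hG1 x hx).2]
  have hlip : ∀ a ∈ Metric.closedBall x0 (3 * r), ∀ b ∈ Metric.closedBall x0 (3 * r),
      |u b - u a| ≤ G * ‖b - a‖ := fun a ha b hb =>
    Convex.norm_image_sub_le_of_norm_fderiv_le (fun z hz => (hG1 z hz).1) (fun z hz => (hG1 z hz).2)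
      (convex_closedBall _ _) ha hb
  rcases eq_or_ne x y with rfl | hne
  · simp
  have ht : 0 < ‖x - y‖ := norm_pos_iff.2 (sub_ne_zero.2 hne)
  rw [Metric.mem_ball] at hx hy
  set s := √‖x - y‖ with hs
  have hs0 : 0 < s := Real.sqrt_pos.2 ht
  have hss : s * s = ‖x - y‖ := Real.mul_self_sqrt ht.le
  have hxb : x ∈ Metric.closedBall x0 (3 * r) := by rw [Metric.mem_closedBall]; linarith
  have hyb : y ∈ Metric.closedBall x0 (3 * r) := by rw [Metric.mem_closedBall]; linarith
  by_cases hsr : s ≤ r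
  · -- difference quotient
    have hb1 : ∀ z ∈ Metric.closedBall y s, z ∈ Metric.closedBall x0 (3 * r) := by
      intro z hz
      rw [Metric.mem_closedBall] at *
      linarith [dist_triangle z y x0]
    have hb2 : ∀ z ∈ Metric.closedBall y s, z + (x - y) ∈ Metric.closedBall x0 (3 * r) := by
      intro z hz
      rw [Metric.mem_closedBall] at *
      have : dist (z + (x - y)) x = dist z y := by
        rw [dist_eq_norm, dist_eq_norm]; congr 1; abel
      linarith [dist_triangle (z + (x - y)) x x0]
    have h34 : Metric.closedBall x0 (3 * r) ⊆ Metric.closedBall x0 (4 * r) :=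
      Metric.closedBall_subset_closedBall (by linarith)
    have hd : GSol (Metric.closedBall y s) (fun z => u (z + (x - y)) - u z)
        (fun z => f (z + (x - y)) - f z) :=
      (h.translate (x - y) (fun z hz => hS (h34 (hb2 z hz)))).sub
        (h.mono fun z hz => hS (h34 (hb1 z hz)))
    obtain ⟨-, h3⟩ := hg _ _ _ hd y s (2 * A) (G * ‖x - y‖) hs0 subset_rfl
      (fun z hz => by
        have := hlip z (hb1 z hz) _ (hb2 z hz)
        rwa [add_sub_cancel_left] at this)
      (fun z hz => by
        have h1 := abs_le.1 (hA _ (h34 (hb1 z hz)))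
        have h2 := abs_le.1 (hA _ (h34 (hb2 z hz)))
        rw [abs_le]; constructor <;> linarith)
    have e : fderiv ℝ (fun z => u (z + (x - y)) - u z) y = fderiv ℝ u x - fderiv ℝ u y := by
      have hx1 : HasFDerivAt u (fderiv ℝ u x) (y + (x - y)) := by
        rw [add_sub_cancel]; exact (hG1 x hxb).1.hasFDerivAt
      have h1 : HasFDerivAt (fun z => u (z + (x - y))) (fderiv ℝ u x) y := by
        simpa [Function.comp_def] using hx1.comp y ((hasFDerivAt_id y).add_const (x - y))
      exact (h1.sub (hG1 y hyb).1.hasFDerivAt).fderiv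
    rw [e, ← hss] at h3
    refine h3.trans ?_
    have e2 : C * (G * (s * s) / s + s * (2 * A)) = C * (G + 2 * A) * s := by
      field_simp
    rw [e2]
    gcongr
    have : 0 ≤ 2 * G / r := by positivity
    linarith
  · push Not at hsr
    have h1 : ‖fderiv ℝ u x - fderiv ℝ u y‖ ≤ 2 * G :=
      (norm_sub_le _ _).trans (by linarith [(hG1 x hxb).2, (hG1 y hyb).2])
    refine h1.trans ?_
    have h2 : 2 * G ≤ 2 * G / r * s := by
      rw [div_mul_eq_mul_div, le_div_iff₀ hr]
      nlinarith
    have h3 : 0 ≤ (G + C * (G + 2 * A)) * s := by positivity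
    nlinarith

/-- quadratic polynomial -/
noncomputable def qp (c : ℝ) (L : Eu N →L[ℝ] ℝ) (Q : Eu N →L[ℝ] Eu N →L[ℝ] ℝ) (y : Eu N) : ℝ :=
  c + L y + 1 / 2 * Q y y

theorem qp_contDiff (c : ℝ) (L : Eu N →L[ℝ] ℝ) (Q : Eu N →L[ℝ] Eu N →L[ℝ] ℝ) (y : Eu N) :
    ContDiffAt ℝ 2 (qp c L Q) y := by
  unfold qp; fun_prop

theorem lap_qp (c : ℝ) (L : Eu N →L[ℝ] ℝ) (Q : Eu N →L[ℝ] Eu N →L[ℝ] ℝ) (y : Eu N) :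
    lap (qp c L Q) y = ∑ i, Q (eb i) (eb i) := by
  refine D2At.lap_eq (d1 := fun i => L (eb i) + 1 / 2 * (Q y (eb i) + Q (eb i) y))
    (qp_contDiff c L Q y) fun i => ?_
  refine ⟨fun s => L (eb i) + 1 / 2 * (Q y (eb i) + Q (eb i) y) + s * Q (eb i) (eb i),
    Eventually.of_forall fun s => ?_, by simp, ?_⟩
  · have e : (fun s : ℝ => qp c L Q (y + s • eb i)) = fun s => (c + L y + 1 / 2 * Q y y) +
        s * (L (eb i) + 1 / 2 * (Q y (eb i) + Q (eb i) y)) + s ^ 2 * (1 / 2 * Q (eb i) (eb i)) := by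
      funext s
      simp only [qp, map_add, map_smul, add_apply, smul_apply, smul_eq_mul]
      ring
    rw [e]
    exact ((((hasDerivAt_id s).mul_const _).const_add _).add
      (((hasDerivAt_id s).pow 2).mul_const _)).congr_deriv (by simp; ring)
  · exact (((hasDerivAt_id (0:ℝ)).mul_const _).const_add _).congr_deriv (by simp)

theorem qp_add (c c' : ℝ) (L L' : Eu N →L[ℝ] ℝ) (Q Q' : Eu N →L[ℝ] Eu N →L[ℝ] ℝ) (y : Eu N) :
    qp (c + c') (L + L') (Q + Q') y = qp c L Q y + qp c' L' Q' y := by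
  simp only [qp, add_apply]; ring

theorem qp_bound (c : ℝ) (L : Eu N →L[ℝ] ℝ) (Q : Eu N →L[ℝ] Eu N →L[ℝ] ℝ) (y : Eu N) :
    |qp c L Q y| ≤ |c| + ‖L‖ * ‖y‖ + ‖Q‖ * ‖y‖ ^ 2 := by
  have h1 := L.le_opNorm y
  have h2 := Q.le_opNorm₂ y y
  rw [Real.norm_eq_abs] at h1 h2
  have h3 := abs_add_three c (L y) (1 / 2 * Q y y)
  rw [abs_mul, abs_of_pos (by norm_num : (0:ℝ) < 1 / 2)] at h3
  unfold qp
  nlinarith [abs_nonneg (Q y y)]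

theorem camp_step (hN : 0 < N) : ∃ C : ℝ, 1 ≤ C ∧ ∀ (ρ : ℝ) (u f : Eu N → ℝ),
    GSol (Metric.ball 0 ρ) u f → ∀ (lam mu K H r E : ℝ), 0 < lam → lam < 1 / 4 → 0 < mu → 0 ≤ H →
    32 * C * lam ≤ mu → 2 * (1 + H) ≤ K * (lam ^ 2 * mu) → (1 + H) ≤ K → 0 < r → r ≤ ρ → 0 < E →
    (∀ y, ‖y‖ < r → |f y - f 0| ≤ H * E) →
    ∀ c L Q, (∑ i, Q (eb i) (eb i) = f 0) → (∀ ξ ζ, Q ξ ζ = Q ζ ξ) →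
    (∀ y, ‖y‖ < r → |u y - qp c L Q y| ≤ K * (r ^ 2 * E)) →
    ∃ c' L' Q', (∑ i, Q' (eb i) (eb i) = f 0) ∧ (∀ ξ ζ, Q' ξ ζ = Q' ζ ξ) ∧
      (∀ y, ‖y‖ ≤ lam * r → |u y - qp c' L' Q' y| ≤ K * ((lam * r) ^ 2 * (mu * E))) ∧
      dist c c' ≤ 8 * C * K * (r ^ 2 * E) ∧ dist L L' ≤ 8 * C * K * (r * E) ∧
      dist Q Q' ≤ 8 * C * K * E := by
  obtain ⟨C, hC1, hq⟩ := harm_quad N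
  refine ⟨C, hC1, fun ρ u f hu lam mu K H r E hlam hlam4 hmu hH h32 h2H hHK hr hrρ hE hf c L Q htr
    hsym hinv => ?_⟩
  have hs : 0 < r / 2 := by linarith
  have hsub : Metric.closedBall (0 : Eu N) (r / 2) ⊆ Metric.ball 0 ρ :=
    Metric.closedBall_subset_ball (by linarith)
  have hcb : ∀ y ∈ Metric.closedBall (0 : Eu N) (r / 2), ‖y‖ < r := fun y hy => by
    rw [mem_closedBall_zero_iff] at hy; linarith
  have hrE : 0 < r ^ 2 * E := by positivity
  have hcont : ContinuousOn (fun y => u y - qp c L Q y) (Metric.closedBall 0 (r / 2)) := by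
    intro y hy
    exact ((hu.continuousAt Metric.isOpen_ball (hsub hy)).sub
      (qp_contDiff c L Q y).continuousAt).continuousWithinAt
  obtain ⟨h, hh, hha⟩ := harm_dirichlet hN hs hcont hrE
  have hw : GSol (Metric.ball 0 ρ) (fun y => u y - qp c L Q y - h y) (fun y => f y - f 0) := by
    refine ((hu.sub (GSol.of_c2 fun y _ => qp_contDiff c L Q y)).sub
      (GSol.of_c2 fun y _ => hh.c2 y)).congr (fun _ _ => rfl) (fun y _ => ?_)
    rw [lap_qp, htr, hh.2]; ring
  have hwb : ∀ y, ‖y‖ ≤ r / 2 → |u y - qp c L Q y - h y| ≤ (1 + H) * (r ^ 2 * E) := by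
    intro y hy
    have h1 := gsol_max hN hw hs (ε := r ^ 2 * E) (θ := H * E) (by positivity) hsub
      (fun y hy => hf y (hcb y hy))
      (fun y hy => by
        have := hha y (by rw [← dist_eq_norm]; exact hy)
        rwa [abs_sub_comm] at this) y (by rwa [mem_closedBall_zero_iff])
    refine h1.trans ?_
    have h2 : (r / 2) ^ 2 - ‖y - 0‖ ^ 2 ≤ r ^ 2 := by nlinarith [sq_nonneg ‖y - 0‖]
    have h3 : 0 ≤ H * E := by positivity
    nlinarith
  have hhb : ∀ y, ‖y‖ < r / 2 → |h (0 + y)| ≤ 2 * K * (r ^ 2 * E) := by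
    intro y hy
    rw [zero_add]
    have h1 := hwb y hy.le
    have h2 := hinv y (by linarith)
    have h3 : |h y| ≤ |u y - qp c L Q y| + |u y - qp c L Q y - h y| := by
      have := abs_sub (u y - qp c L Q y) (u y - qp c L Q y - h y)
      rwa [sub_sub_cancel] at this
    nlinarith
  obtain ⟨c1, L1, Q1, hc1, hL1, hQ1, hs1, ht1, hap⟩ := hq 0 (r / 2) h _ hs hh hhb
  refine ⟨c + c1, L + L1, Q + Q1, ?_, ?_, ?_, ?_, ?_, ?_⟩
  · simp only [add_apply, Finset.sum_add_distrib, htr, ht1, add_zero]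
  · intro ξ ζ; simp only [add_apply, hsym ξ ζ, hs1 ξ ζ]
  · intro y hy
    have hy4 : ‖y‖ < r / 2 / 2 := by nlinarith
    have h1 := hwb y (by linarith)
    have h2 := hap y hy4
    rw [zero_add] at h2
    rw [qp_add]
    have h3 : |u y - (qp c L Q y + qp c1 L1 Q1 y)| ≤ |u y - qp c L Q y - h y| +
        |h y - (c1 + L1 y + 1 / 2 * Q1 y y)| := by
      refine le_of_eq_of_le ?_ (abs_add_le _ _)
      congr 1
      simp only [qp]; ring
    have h4 : (‖y‖ / (r / 2)) ^ 3 ≤ 8 * lam ^ 3 := by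
      have : ‖y‖ / (r / 2) ≤ 2 * lam := by rw [div_le_iff₀ hs]; linarith
      calc _ ≤ (2 * lam) ^ 3 := by gcongr
        _ = _ := by ring
    have hK0 : 0 ≤ K := by linarith
    have h5 : C * (2 * K * (r ^ 2 * E)) * (‖y‖ / (r / 2)) ^ 3 ≤
        C * (2 * K * (r ^ 2 * E)) * (8 * lam ^ 3) := by gcongr
    have h6 : C * (2 * K * (r ^ 2 * E)) * (8 * lam ^ 3) ≤ K * (r ^ 2 * E) * lam ^ 2 * (mu / 2) := by
      have : C * (2 * K * (r ^ 2 * E)) * (8 * lam ^ 3) =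
        K * (r ^ 2 * E) * lam ^ 2 * (16 * C * lam) := by ring
      rw [this]
      gcongr
      linarith
    have h7 : (1 + H) * (r ^ 2 * E) ≤ K * (lam ^ 2 * mu) / 2 * (r ^ 2 * E) := by
      gcongr; linarith
    calc _ ≤ _ := h3
      _ ≤ K * (lam ^ 2 * mu) / 2 * (r ^ 2 * E) + K * (r ^ 2 * E) * lam ^ 2 * (mu / 2) := by linarith
      _ = _ := by ring
  · have : 0 ≤ C * K * (r ^ 2 * E) := by
      have hK0 : 0 ≤ K := by linarith
      positivity
    rw [dist_eq_norm, sub_add_cancel_left, norm_neg]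
    refine hc1.trans ?_
    linarith
  · have hK0 : 0 ≤ K := by linarith
    rw [dist_eq_norm, sub_add_cancel_left, norm_neg]
    refine hL1.trans ?_
    have : C * (2 * K * (r ^ 2 * E)) / (r / 2) = 4 * (C * K * (r * E)) := by field_simp; ring
    rw [this]
    have : 0 ≤ C * K * (r * E) := by positivity
    linarith
  · have hK0 : 0 ≤ K := by linarith
    have e : dist Q (Q + Q1) = ‖Q1‖ := dist_self_add_right Q1 Q
    rw [e]
    refine hQ1.trans (le_of_eq ?_)
    field_simp; ring

theorem geo_lim {X : Type*} [MetricSpace X] [CompleteSpace X] {F : ℕ → X} {D t mu : ℝ}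
    (htm : t ≤ mu) (hmu : mu < 1) (hF : ∀ n, dist (F n) (F (n + 1)) ≤ D * t ^ n) :
    ∃ a, Tendsto F atTop (𝓝 a) ∧ ∀ n, dist (F n) a ≤ D * t ^ n / (1 - mu) := by
  have ht1 : t < 1 := by linarith
  obtain ⟨a, ha⟩ := cauchySeq_tendsto_of_complete (cauchySeq_of_le_geometric t D ht1 hF)
  refine ⟨a, ha, fun n => (dist_le_of_le_geometric_of_tendsto t D ht1 hF ha n).trans ?_⟩
  have : 0 ≤ D * t ^ n := dist_nonneg.trans (hF n)
  gcongr

end campanato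

end

section

open Set Filter MeasureTheory
open scoped Topology ContDiff

section campanato2

variable {N : ℕ}

theorem exists_lam {α C : ℝ} (hα : 0 < α) (hα1 : α < 1) (hC : 1 ≤ C) :
    ∃ lam : ℝ, 0 < lam ∧ lam < 1 / 4 ∧ 32 * C * lam ≤ lam ^ α := by
  have h0 : (0:ℝ) < 1 / (32 * C) := by positivity
  have h1 : 1 / (32 * C) ≤ 1 / 32 := by
    gcongr; linarith
  refine ⟨(1 / (32 * C)) ^ (1 / (1 - α)), by positivity, ?_, ?_⟩
  · have : (1 / (32 * C)) ^ (1 / (1 - α)) ≤ 1 / (32 * C) := by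
      refine Real.rpow_le_self_of_le_one h0.le (by linarith) ?_
      rw [le_div_iff₀ (by linarith)]; linarith
    linarith
  · set l := (1 / (32 * C)) ^ (1 / (1 - α)) with hl
    have hl0 : 0 < l := by positivity
    have h2 : l ^ (1 - α) = 1 / (32 * C) := by
      rw [hl, ← Real.rpow_mul h0.le, one_div_mul_cancel (by linarith), Real.rpow_one]
    have h3 : l = l ^ (1 - α) * l ^ α := by
      rw [← Real.rpow_add hl0]; simp
    have h4 : 32 * C * l = (32 * C * l ^ (1 - α)) * l ^ α := by
      conv_lhs => rw [h3]
      ring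
    rw [h4, h2, mul_one_div_cancel (by positivity), one_mul]

theorem exists_Q0 (hN : 0 < N) (F : ℝ) : ∃ Q : Eu N →L[ℝ] Eu N →L[ℝ] ℝ,
    (∑ i, Q (eb i) (eb i) = F) ∧ (∀ ξ ζ, Q ξ ζ = Q ζ ξ) ∧ ∀ y, |Q y y| ≤ |F| * ‖y‖ ^ 2 := by
  have hN1 : (1:ℝ) ≤ N := by exact_mod_cast hN
  have hq : ∀ ξ ζ : Eu N, ((F / N) • ∑ i : Fin N, (EuclideanSpace.proj i : Eu N →L[ℝ] ℝ).smulRight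
      (EuclideanSpace.proj i : Eu N →L[ℝ] ℝ)) ξ ζ = F / N * ∑ i, ξ i * ζ i := by
    intro ξ ζ
    simp
  refine ⟨(F / N) • ∑ i : Fin N, (EuclideanSpace.proj i : Eu N →L[ℝ] ℝ).smulRight
      (EuclideanSpace.proj i : Eu N →L[ℝ] ℝ), ?_, fun ξ ζ => ?_, fun y => ?_⟩
  · simp_rw [hq]
    simp
    field_simp
  · rw [hq, hq]; simp_rw [mul_comm]
  · rw [hq]
    have : ∑ i, y i * y i = ‖y‖ ^ 2 := by
      rw [EuclideanSpace.norm_sq_eq]; simp [sq]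
    rw [this, abs_mul, abs_of_nonneg (sq_nonneg ‖y‖), abs_div]
    gcongr
    refine div_le_self (abs_nonneg F) ?_
    rw [Nat.abs_cast]; exact hN1

theorem camp0 (hN : 0 < N) {α : ℝ} (hα : 0 < α) (hα1 : α < 1) {ρ H M F : ℝ} (hρ : 0 < ρ)
    (hρ1 : ρ ≤ 1) (hH : 0 ≤ H) (hM : 0 ≤ M) (hF : 0 ≤ F) :
    ∃ C : ℝ, 0 ≤ C ∧ ∀ u f : Eu N → ℝ, GSol (Metric.ball 0 ρ) u f → (∀ y, ‖y‖ < ρ → |u y| ≤ M) →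
      (∀ y, ‖y‖ < ρ → |f y - f 0| ≤ H * ‖y‖ ^ α) → |f 0| ≤ F →
      ∃ c L Q, (∑ i, Q (eb i) (eb i) = f 0) ∧ (∀ ξ ζ, Q ξ ζ = Q ζ ξ) ∧
        ∀ y, ‖y‖ < ρ → |u y - qp c L Q y| ≤ C * (‖y‖ ^ 2 * ‖y‖ ^ α) := by
  obtain ⟨C, hC1, hstep⟩ := camp_step hN
  obtain ⟨lam, hlam, hlam4, h32⟩ := exists_lam hα hα1 hC1
  obtain ⟨mu, hmu_def⟩ : ∃ mu, mu = lam ^ α := ⟨_, rfl⟩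
  have hmu : 0 < mu := by rw [hmu_def]; positivity
  have hmu1 : mu < 1 := by rw [hmu_def]; exact Real.rpow_lt_one hlam.le (by linarith) hα
  rw [← hmu_def] at h32
  have hρα : 0 < ρ ^ α := by positivity
  obtain ⟨K, hK1, hK2, hK3⟩ : ∃ K : ℝ, 2 * (1 + H) ≤ K * (lam ^ 2 * mu) ∧ 1 + H ≤ K ∧
      M + F ≤ K * (ρ ^ 2 * ρ ^ α) := by
    refine ⟨2 * (1 + H) / (lam ^ 2 * mu) + (1 + H) + (M + F) / (ρ ^ 2 * ρ ^ α), ?_, ?_, ?_⟩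
    · rw [add_assoc, add_mul, div_mul_cancel₀ _ (by positivity)]
      have : 0 ≤ (1 + H + (M + F) / (ρ ^ 2 * ρ ^ α)) * (lam ^ 2 * mu) := by positivity
      linarith
    · have h1 : 0 ≤ 2 * (1 + H) / (lam ^ 2 * mu) := by positivity
      have h2 : 0 ≤ (M + F) / (ρ ^ 2 * ρ ^ α) := by positivity
      linarith
    · rw [add_mul, div_mul_cancel₀ _ (by positivity)]
      have : 0 ≤ (2 * (1 + H) / (lam ^ 2 * mu) + (1 + H)) * (ρ ^ 2 * ρ ^ α) := by positivity
      linarith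
  have hK0 : 0 ≤ K := by linarith
  set B := 8 * C * K with hB
  have hB0 : 0 ≤ B := by positivity
  have hmu1' : 0 < 1 - mu := by linarith
  refine ⟨(K + 3 * (B / (1 - mu))) / (lam ^ 4 * mu ^ 2), by positivity, fun u f hu huM hfH hfF => ?_⟩
  set r : ℕ → ℝ := fun k => ρ * lam ^ k with hr_def
  set E : ℕ → ℝ := fun k => ρ ^ α * mu ^ k with hE_def
  have hr0 : ∀ k, 0 < r k := fun k => by positivity
  have hE0 : ∀ k, 0 < E k := fun k => by positivity
  have hrE : ∀ k, r k ^ α = E k := fun k => by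
    simp only [hr_def, hE_def]
    rw [Real.mul_rpow hρ.le (by positivity), hmu_def, ← Real.rpow_natCast, ← Real.rpow_natCast,
      ← Real.rpow_mul hlam.le, ← Real.rpow_mul hlam.le, mul_comm (k:ℝ)]
  have hrρ : ∀ k, r k ≤ ρ := fun k => by
    simp only [hr_def]
    exact mul_le_of_le_one_right hρ.le (pow_le_one₀ hlam.le (by linarith))
  have hrs : ∀ k, r (k + 1) = lam * r k := fun k => by simp only [hr_def]; ring
  have hEs : ∀ k, E (k + 1) = mu * E k := fun k => by simp only [hE_def]; ring
  let inv : ℕ → (ℝ × (Eu N →L[ℝ] ℝ) × (Eu N →L[ℝ] Eu N →L[ℝ] ℝ)) → Prop := fun k P =>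
    (∑ i, P.2.2 (eb i) (eb i) = f 0) ∧ (∀ ξ ζ, P.2.2 ξ ζ = P.2.2 ζ ξ) ∧
    (∀ y, ‖y‖ < r k → |u y - qp P.1 P.2.1 P.2.2 y| ≤ K * (r k ^ 2 * E k))
  have hex : ∀ k P, inv k P → ∃ P', inv (k + 1) P' ∧ dist P.1 P'.1 ≤ B * (r k ^ 2 * E k) ∧
      dist P.2.1 P'.2.1 ≤ B * (r k * E k) ∧ dist P.2.2 P'.2.2 ≤ B * E k := by
    rintro k ⟨c, L, Q⟩ ⟨h1, h2, h3⟩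
    obtain ⟨c', L', Q', a1, a2, a3, a4, a5, a6⟩ := hstep ρ u f hu lam mu K H (r k) (E k) hlam hlam4
      hmu hH h32 hK1 hK2 (hr0 k) (hrρ k) (hE0 k) (fun y hy => by
        refine (hfH y (hy.trans_le (hrρ k))).trans ?_
        rw [← hrE k]
        gcongr) c L Q h1 h2 h3
    refine ⟨⟨c', L', Q'⟩, ⟨a1, a2, fun y hy => ?_⟩, a4, a5, a6⟩
    rw [hrs] at hy
    have := a3 y hy.le
    rwa [hrs, hEs]
  obtain ⟨Q0, hq1, hq2, hq3⟩ := exists_Q0 hN (f 0)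
  have hinv0 : inv 0 (0, 0, Q0) := by
    refine ⟨hq1, hq2, fun y hy => ?_⟩
    have e0 : r 0 = ρ := by simp [hr_def]
    have e1 : E 0 = ρ ^ α := by simp [hE_def]
    rw [e0] at hy
    rw [e0, e1]
    refine le_trans ?_ hK3
    have h1 := huM y hy
    have h2 := hq3 y
    have h3 : ‖y‖ ^ 2 ≤ 1 := pow_le_one₀ (norm_nonneg _) (by linarith)
    have h4 : |Q0 y y| ≤ F := by nlinarith [abs_nonneg (f 0)]
    have h5 : |u y - qp 0 0 Q0 y| ≤ |u y| + |Q0 y y| := by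
      simp only [qp]
      rw [zero_apply]
      refine (abs_sub _ _).trans ?_
      have : |0 + 0 + 1 / 2 * Q0 y y| ≤ |Q0 y y| := by
        rw [zero_add, zero_add, abs_mul, abs_of_pos (by norm_num : (0:ℝ) < 1 / 2)]
        linarith [abs_nonneg (Q0 y y)]
      linarith
    linarith
  choose! nxt hn1 hn2 using hex
  let P : ℕ → (ℝ × (Eu N →L[ℝ] ℝ) × (Eu N →L[ℝ] Eu N →L[ℝ] ℝ)) := fun k =>
    Nat.rec (0, 0, Q0) (fun k p => nxt k p) k
  have hP : ∀ k, inv k (P k) := fun k => by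
    induction k with
    | zero => exact hinv0
    | succ k ih => exact hn1 k _ ih
  have hPs : ∀ k, P (k + 1) = nxt k (P k) := fun k => rfl
  have hPd := fun k => hn2 k (P k) (hP k)
  simp_rw [← hPs] at hPd
  obtain ⟨c, hcl, hc⟩ := geo_lim (F := fun k => (P k).1) (D := B * (ρ ^ 2 * ρ ^ α)) (t := lam ^ 2 * mu)
    (mu := mu) (mul_le_of_le_one_left hmu.le (pow_le_one₀ hlam.le (by linarith))) hmu1 (fun k =>
      (hPd k).1.trans (le_of_eq (by simp only [hr_def, hE_def, mul_pow]; ring)))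
  obtain ⟨L, hLl, hL⟩ := geo_lim (F := fun k => (P k).2.1) (D := B * (ρ * ρ ^ α)) (t := lam * mu)
    (mu := mu) (mul_le_of_le_one_left hmu.le (by linarith)) hmu1 (fun k =>
      (hPd k).2.1.trans (le_of_eq (by simp only [hr_def, hE_def, mul_pow]; ring)))
  obtain ⟨Q, hQl, hQ⟩ := geo_lim (F := fun k => (P k).2.2) (D := B * ρ ^ α) (t := mu)
    (mu := mu) le_rfl hmu1 (fun k =>
      (hPd k).2.2.trans (le_of_eq (by simp only [hE_def]; ring)))
  have hQe : ∀ ξ ζ, Tendsto (fun k => (P k).2.2 ξ ζ) atTop (𝓝 (Q ξ ζ)) := fun ξ ζ => by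
    have hcont : Continuous fun T : Eu N →L[ℝ] Eu N →L[ℝ] ℝ => T ξ ζ := by fun_prop
    exact (hcont.tendsto Q).comp hQl
  refine ⟨c, L, Q, ?_, fun ξ ζ => ?_, fun y hy => ?_⟩
  · have h1 : Tendsto (fun k => ∑ i, (P k).2.2 (eb i) (eb i)) atTop (𝓝 (∑ i, Q (eb i) (eb i))) :=
      tendsto_finsetSum _ fun i _ => hQe _ _
    simp_rw [(hP _).1] at h1
    exact (tendsto_nhds_unique h1 tendsto_const_nhds)
  · refine tendsto_nhds_unique (hQe ξ ζ) ?_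
    simp_rw [(hP _).2.1 ξ ζ]
    exact hQe ζ ξ
  · rcases eq_or_ne y 0 with rfl | hy0
    · have hc0 : u 0 - c = 0 := by
        have h1 : Tendsto (fun k => |u 0 - (P k).1|) atTop (𝓝 |u 0 - c|) :=
          (tendsto_const_nhds.sub hcl).abs
        have h2 : Tendsto (fun k => K * (r k ^ 2 * E k)) atTop (𝓝 0) := by
          have e : (fun k => K * (r k ^ 2 * E k)) = fun k => (K * (ρ ^ 2 * ρ ^ α)) * (lam ^ 2 * mu) ^ k := by
            funext k; simp only [hr_def, hE_def, mul_pow]; ring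
          rw [e]
          have := (tendsto_pow_atTop_nhds_zero_of_lt_one (r := lam ^ 2 * mu) (by positivity)
            (by nlinarith [pow_le_one₀ (n := 2) hlam.le (by linarith)])).const_mul (K * (ρ ^ 2 * ρ ^ α))
          rwa [mul_zero] at this
        have h3 := le_of_tendsto_of_tendsto h1 h2 (Eventually.of_forall fun k => by
          have := (hP k).2.2 0 (by simpa using hr0 k)
          simpa [qp] using this)
        exact abs_nonpos_iff.1 h3
      simp [qp, hc0]
    have hyn : 0 < ‖y‖ := norm_pos_iff.2 hy0
    obtain ⟨k, hk1, hk2⟩ : ∃ k, ‖y‖ < r k ∧ r k ≤ ‖y‖ / lam ^ 2 := by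
      obtain ⟨n, hn1, hn2⟩ := exists_nat_pow_near_of_lt_one (x := ‖y‖ / ρ) (y := lam) (by positivity)
        (by rw [div_le_one hρ]; exact hy.le) hlam (by linarith)
      rw [lt_div_iff₀ hρ] at hn1
      rw [div_le_iff₀ hρ] at hn2
      rcases n with _ | m
      · refine ⟨0, by simpa [hr_def] using hy, ?_⟩
        simp only [hr_def, pow_zero, mul_one]
        rw [le_div_iff₀ (by positivity)]
        rw [zero_add, pow_one] at hn1
        nlinarith
      · refine ⟨m, ?_, ?_⟩
        · refine hn2.trans_lt ?_
          simp only [hr_def]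
          have : 0 < ρ * lam ^ m := by positivity
          rw [pow_succ]; nlinarith
        · simp only [hr_def]
          rw [le_div_iff₀ (by positivity)]
          refine le_trans (le_of_eq ?_) hn1.le
          ring
    have h1 := (hP k).2.2 y hk1
    have h2 : |qp ((P k).1 - c) ((P k).2.1 - L) ((P k).2.2 - Q) y| ≤
        3 * (B / (1 - mu)) * (r k ^ 2 * E k) := by
      refine (qp_bound _ _ _ y).trans ?_
      have b1 : |(P k).1 - c| ≤ B / (1 - mu) * (r k ^ 2 * E k) := by
        refine (hc k).trans (le_of_eq ?_)
        simp only [hr_def, hE_def, mul_pow]; ring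
      have b2 : ‖(P k).2.1 - L‖ ≤ B / (1 - mu) * (r k * E k) := by
        have := hL k
        rw [dist_eq_norm] at this
        refine this.trans (le_of_eq ?_)
        simp only [hr_def, hE_def, mul_pow]; ring
      have b3 : ‖(P k).2.2 - Q‖ ≤ B / (1 - mu) * E k := by
        have e : dist (P k).2.2 Q = ‖(P k).2.2 - Q‖ := dist_eq_norm (P k).2.2 Q
        rw [← e]
        refine (hQ k).trans (le_of_eq ?_)
        simp only [hE_def]; ring
      have hrk := hr0 k
      have hEk := hE0 k
      calc _ ≤ B / (1 - mu) * (r k ^ 2 * E k) + B / (1 - mu) * (r k * E k) * r k +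
          B / (1 - mu) * E k * (r k) ^ 2 := by gcongr
        _ = _ := by ring
    have e1 : u y - qp c L Q y = (u y - qp (P k).1 (P k).2.1 (P k).2.2 y) +
        qp ((P k).1 - c) ((P k).2.1 - L) ((P k).2.2 - Q) y := by
      simp only [qp, sub_apply]; ring
    have h3 : |u y - qp c L Q y| ≤ (K + 3 * (B / (1 - mu))) * (r k ^ 2 * E k) := by
      rw [e1]
      refine (abs_add_le _ _).trans ?_
      linarith
    refine h3.trans ?_
    rw [div_mul_eq_mul_div, le_div_iff₀ (by positivity), mul_assoc]
    refine mul_le_mul_of_nonneg_left ?_ (by positivity)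
    have h4 : E k ≤ ‖y‖ ^ α / mu ^ 2 := by
      rw [← hrE, hmu_def, ← Real.rpow_natCast, ← Real.rpow_mul hlam.le, mul_comm α, Real.rpow_mul hlam.le,
        ← Real.div_rpow (norm_nonneg _) (by positivity), Real.rpow_natCast]
      exact Real.rpow_le_rpow (hr0 k).le hk2 hα.le
    calc r k ^ 2 * E k * (lam ^ 4 * mu ^ 2) ≤
        (‖y‖ / lam ^ 2) ^ 2 * (‖y‖ ^ α / mu ^ 2) * (lam ^ 4 * mu ^ 2) := by
          have := hr0 k
          have := hE0 k
          gcongr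
      _ = _ := by field_simp

end campanato2

end

section

open Set Filter MeasureTheory
open scoped Topology ContDiff

/-! ## Part G: Schauder regularity -/

section schauder

variable {N : ℕ}

theorem opNorm_le_of_cball {F : Type*} [NormedAddCommGroup F] [NormedSpace ℝ F] (T : Eu N →L[ℝ] F)
    {r E : ℝ} (hr : 0 < r) (hE : 0 ≤ E) (h : ∀ ζ, ‖ζ‖ ≤ r → ‖T ζ‖ ≤ E) : ‖T‖ ≤ E / r := by
  refine T.opNorm_le_bound (by positivity) fun ζ => ?_
  rcases eq_or_ne ζ 0 with rfl | hζ
  · simp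
  have hn : 0 < ‖ζ‖ := norm_pos_iff.2 hζ
  have h1 := h ((r / ‖ζ‖) • ζ) (by
    rw [norm_smul, Real.norm_of_nonneg (by positivity), div_mul_cancel₀ _ hn.ne'])
  rw [map_smul, norm_smul, Real.norm_of_nonneg (by positivity), div_mul_eq_mul_div,
    div_le_iff₀ hn] at h1
  rw [div_mul_eq_mul_div, le_div_iff₀ hr]
  linarith

theorem hasFDerivAt_of_bound {F : Type*} [NormedAddCommGroup F] [NormedSpace ℝ F] {g : Eu N → F}
    {T : Eu N →L[ℝ] F} {x : Eu N} {K β ρ : ℝ} (hβ : 0 < β) (hρ : 0 < ρ)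
    (h : ∀ y, ‖y‖ < ρ → ‖g (x + y) - g x - T y‖ ≤ K * ‖y‖ ^ β * ‖y‖) : HasFDerivAt g T x := by
  rw [hasFDerivAt_iff_isLittleO_nhds_zero, Asymptotics.isLittleO_iff]
  intro c hc
  have h1 : Tendsto (fun y : Eu N => K * ‖y‖ ^ β) (𝓝 0) (𝓝 (K * ‖(0 : Eu N)‖ ^ β)) := by
    refine Tendsto.const_mul K ?_
    exact ((continuous_norm.tendsto (0 : Eu N)).rpow_const (Or.inr hβ.le))
  rw [norm_zero, Real.zero_rpow hβ.ne', mul_zero] at h1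
  filter_upwards [h1.eventually (gt_mem_nhds hc), Metric.ball_mem_nhds 0 hρ] with y hy1 hy2
  rw [mem_ball_zero_iff] at hy2
  exact (h y hy2).trans (by gcongr)

theorem continuousAt_of_holder_bound {F : Type*} [NormedAddCommGroup F] {g : Eu N → F} {x : Eu N}
    {K β : ℝ} (hβ : 0 < β) (h : ∀ᶠ y in 𝓝 x, ‖g y - g x‖ ≤ K * ‖y - x‖ ^ β) : ContinuousAt g x := by
  rw [ContinuousAt, tendsto_iff_norm_sub_tendsto_zero]
  have h1 : Tendsto (fun y : Eu N => K * ‖y - x‖ ^ β) (𝓝 x) (𝓝 (K * ‖x - x‖ ^ β)) := by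
    refine Tendsto.const_mul _ ?_
    have : Continuous fun y : Eu N => ‖y - x‖ := by fun_prop
    exact ((this.tendsto x).rpow_const (Or.inr hβ.le))
  rw [sub_self, norm_zero, Real.zero_rpow hβ.ne', mul_zero] at h1
  exact squeeze_zero' (Eventually.of_forall fun y => norm_nonneg _) h h1

theorem norm_self_sub' {F : Type*} [NormedAddCommGroup F] (a : F) : ‖a - a‖ = 0 := by simp

section quad

variable {B : Set (Eu N)} {u : Eu N → ℝ} {c : Eu N → ℝ} {L : Eu N → Eu N →L[ℝ] ℝ}
  {Q : Eu N → Eu N →L[ℝ] Eu N →L[ℝ] ℝ} {ρ C α : ℝ}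

theorem quad_compare (hα : 0 < α) (hα1 : α < 1) (hC : 0 ≤ C)
    (hsym : ∀ x ∈ B, ∀ ξ ζ, Q x ξ ζ = Q x ζ ξ)
    (h : ∀ x ∈ B, ∀ y, ‖y‖ < ρ → |u (x + y) - qp (c x) (L x) (Q x) y| ≤ C * (‖y‖ ^ 2 * ‖y‖ ^ α))
    {x y : Eu N} (hx : x ∈ B) (hy : y ∈ B) (hxy : ‖y - x‖ < ρ / 2) :
    ‖L y - L x - Q x (y - x)‖ ≤ 9 * C * ‖y - x‖ ^ α * ‖y - x‖ ∧
      ‖Q y - Q x‖ ≤ 72 * C * ‖y - x‖ ^ α := by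
  rcases eq_or_ne y x with rfl | hne
  · have e : ‖Q y - Q y‖ = 0 := norm_self_sub' (Q y)
    rw [e]
    simp [Real.zero_rpow hα.ne']
  set r := ‖y - x‖ with hr
  have hr0 : 0 < r := norm_pos_iff.2 (sub_ne_zero.2 hne)
  set E := 9 * C * (r ^ 2 * r ^ α) with hE
  have hE0 : 0 ≤ E := by positivity
  have hrα : 0 < r ^ α := by positivity
  obtain ⟨D, hD⟩ : ∃ D : Eu N → ℝ, D = fun ζ => qp (c x) (L x) (Q x) (y - x + ζ) -
    qp (c y) (L y) (Q y) ζ := ⟨_, rfl⟩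
  have hDb : ∀ ζ, ‖ζ‖ ≤ r → |D ζ| ≤ E := by
    intro ζ hζ
    have hn : ‖y - x + ζ‖ ≤ 2 * r := (norm_add_le _ _).trans (by linarith)
    have h1 := h x hx (y - x + ζ) (by linarith)
    have h2 := h y hy ζ (by linarith)
    rw [show x + (y - x + ζ) = y + ζ by abel] at h1
    have h3 : ‖y - x + ζ‖ ^ 2 * ‖y - x + ζ‖ ^ α ≤ 8 * (r ^ 2 * r ^ α) := by
      have : ‖y - x + ζ‖ ^ α ≤ 2 * r ^ α := by
        calc _ ≤ (2 * r) ^ α := by gcongr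
          _ = 2 ^ α * r ^ α := Real.mul_rpow (by norm_num) hr0.le
          _ ≤ 2 ^ (1:ℝ) * r ^ α := by gcongr; norm_num
          _ = _ := by rw [Real.rpow_one]
      calc _ ≤ (2 * r) ^ 2 * (2 * r ^ α) := by gcongr
        _ = _ := by ring
    have h4 : ‖ζ‖ ^ 2 * ‖ζ‖ ^ α ≤ r ^ 2 * r ^ α := by gcongr
    have h5 := mul_le_mul_of_nonneg_left h3 hC
    have h6 := mul_le_mul_of_nonneg_left h4 hC
    rw [hD]
    simp only
    rw [abs_le] at h1 h2 ⊢
    constructor <;> linarith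
  have hDe : ∀ ζ, D ζ = D 0 + (L x + Q x (y - x) - L y) ζ + 1 / 2 * (Q x ζ ζ - Q y ζ ζ) := by
    intro ζ
    rw [hD]
    simp only [qp, map_add, add_apply, sub_apply, map_zero, zero_apply, hsym x hx ζ (y - x)]
    ring
  have hneg : ∀ ζ, D (-ζ) = D 0 - (L x + Q x (y - x) - L y) ζ + 1 / 2 * (Q x ζ ζ - Q y ζ ζ) := by
    intro ζ
    rw [hDe]
    simp only [map_neg, neg_apply]
    ring
  have hd1 : ‖L x + Q x (y - x) - L y‖ ≤ E / r := by
    refine opNorm_le_of_cball _ hr0 hE0 fun ζ hζ => ?_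
    have h1 := abs_le.1 (hDb ζ hζ)
    have h2 := abs_le.1 (hDb (-ζ) (by rwa [norm_neg]))
    have h3 := hDe ζ
    have h4 := hneg ζ
    rw [Real.norm_eq_abs, abs_le]
    constructor <;> linarith
  have hdiag : ∀ ζ, ‖ζ‖ ≤ r → |Q x ζ ζ - Q y ζ ζ| ≤ 4 * E := by
    intro ζ hζ
    have h1 := abs_le.1 (hDb ζ hζ)
    have h2 := abs_le.1 (hDb (-ζ) (by rwa [norm_neg]))
    have h0 := abs_le.1 (hDb 0 (by simpa using hr0.le))
    have h3 := hDe ζ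
    have h4 := hneg ζ
    rw [abs_le]
    constructor <;> linarith
  constructor
  · rw [show L y - L x - Q x (y - x) = -(L x + Q x (y - x) - L y) by abel, norm_neg]
    refine hd1.trans (le_of_eq ?_)
    rw [hE]; field_simp
  · have hr2 : 0 < r / 2 := by linarith
    have key : ‖Q y - Q x‖ ≤ (2 * E / (r / 2)) / (r / 2) := by
      refine opNorm_le_of_cball _ hr2 (by positivity) fun ξ hξ => ?_
      refine opNorm_le_of_cball _ hr2 (by positivity) fun ζ hζ => ?_
      have h1 := abs_le.1 (hdiag (ξ + ζ) ((norm_add_le _ _).trans (by linarith)))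
      have h2 := abs_le.1 (hdiag (ξ - ζ) ((norm_sub_le _ _).trans (by linarith)))
      simp only [map_add, map_sub, add_apply, sub_apply, hsym x hx ζ ξ, hsym y hy ζ ξ] at h1 h2
      rw [Real.norm_eq_abs, abs_le]
      simp only [sub_apply]
      constructor <;> linarith
    refine key.trans (le_of_eq ?_)
    rw [hE]; field_simp; ring

theorem quad_c2 (hB : IsOpen B) (hρ : 0 < ρ) (hα : 0 < α) (hα1 : α < 1) (hC : 0 ≤ C)
    (hsym : ∀ x ∈ B, ∀ ξ ζ, Q x ξ ζ = Q x ζ ξ)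
    (h : ∀ x ∈ B, ∀ y, ‖y‖ < ρ → |u (x + y) - qp (c x) (L x) (Q x) y| ≤ C * (‖y‖ ^ 2 * ‖y‖ ^ α))
    {x : Eu N} (hx : x ∈ B) : ContDiffAt ℝ 2 u x ∧ D2 u x = Q x := by
  have hu : ∀ x ∈ B, HasFDerivAt u (L x) x := by
    intro x hx
    refine hasFDerivAt_of_bound (K := C * ρ ^ α + ‖Q x‖) (β := 1) one_pos hρ fun y hy => ?_
    have h1 := h x hx y hy
    have h0 := h x hx 0 (by simpa using hρ)
    have hc0 : u x = c x := by
      simp [qp] at h0; linarith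
    have h2 := (Q x).le_opNorm₂ y y
    have h3 : ‖y‖ ^ α ≤ ρ ^ α := by gcongr
    have h4 : C * (‖y‖ ^ 2 * ‖y‖ ^ α) ≤ C * (‖y‖ ^ 2 * ρ ^ α) := by gcongr
    rw [Real.norm_eq_abs] at h2 ⊢
    rw [Real.rpow_one, hc0]
    have e : u (x + y) - c x - L x y = (u (x + y) - qp (c x) (L x) (Q x) y) + 1 / 2 * Q x y y := by
      simp only [qp]; ring
    rw [e]
    refine (abs_add_le _ _).trans ?_
    rw [abs_mul, abs_of_pos (by norm_num : (0:ℝ) < 1 / 2)]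
    nlinarith [abs_nonneg (Q x y y)]
  have hL : ∀ x ∈ B, HasFDerivAt L (Q x) x := by
    intro x hx
    obtain ⟨δ, hδ, hδB⟩ := Metric.isOpen_iff.1 hB x hx
    refine hasFDerivAt_of_bound (K := 9 * C) (β := α) (ρ := min δ (ρ / 2)) hα
      (lt_min hδ (by linarith)) fun y hy => ?_
    have h1 := (quad_compare hα hα1 hC hsym h hx (y := x + y)
      (hδB (by rw [Metric.mem_ball, dist_eq_norm, add_sub_cancel_left]
               exact hy.trans_le (min_le_left _ _)))
      (by rw [add_sub_cancel_left]; exact hy.trans_le (min_le_right _ _))).1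
    rwa [add_sub_cancel_left] at h1
  have hQ : ContinuousOn Q B := by
    intro x hx
    refine (continuousAt_of_holder_bound (g := Q) (K := 72 * C) hα ?_).continuousWithinAt
    filter_upwards [hB.mem_nhds hx, Metric.ball_mem_nhds x (half_pos hρ)] with y hy1 hy2
    rw [Metric.mem_ball, dist_eq_norm] at hy2
    exact (quad_compare hα hα1 hC hsym h hx hy1 hy2).2
  constructor
  · rw [show (2 : WithTop ℕ∞) = 1 + 1 by norm_num]
    refine (contDiffAt_succ_iff_hasFDerivAt (n := 1)).2 ⟨L, ⟨B, hB.mem_nhds hx, hu⟩, ?_⟩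
    rw [show ((1 : ℕ) : WithTop ℕ∞) = ((0 : ℕ) : WithTop ℕ∞) + 1 by norm_num]
    refine (contDiffAt_succ_iff_hasFDerivAt (n := 0)).2 ⟨Q, ⟨B, hB.mem_nhds hx, hL⟩, ?_⟩
    exact contDiffAt_zero.2 ⟨B, hB.mem_nhds hx, hQ⟩
  · have e : fderiv ℝ u =ᶠ[𝓝 x] L := by
      filter_upwards [hB.mem_nhds hx] with y hy using (hu y hy).fderiv
    exact (e.fderiv_eq).trans (hL x hx).fderiv

end quad

theorem schauder (hN : 0 < N) {α : ℝ} (hα : 0 < α) (hα1 : α < 1) {x0 : Eu N} {R H M : ℝ}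
    (hR : 0 < R) (hH : 0 ≤ H) {u f : Eu N → ℝ} (hu : GSol (Metric.ball x0 R) u f)
    (hM : ∀ y ∈ Metric.ball x0 R, |u y| ≤ M)
    (hf : ∀ x ∈ Metric.ball x0 R, ∀ y ∈ Metric.ball x0 R, |f y - f x| ≤ H * ‖y - x‖ ^ α) :
    (∀ x ∈ Metric.ball x0 (R / 2), ContDiffAt ℝ 2 u x ∧ lap u x = f x) ∧
    ∃ C δ : ℝ, 0 ≤ C ∧ 0 < δ ∧ ∀ x ∈ Metric.ball x0 (R / 2), ∀ y ∈ Metric.ball x0 (R / 2),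
      ‖y - x‖ < δ → ‖D2 u y - D2 u x‖ ≤ C * ‖y - x‖ ^ α := by
  have hx0 : x0 ∈ Metric.ball x0 R := Metric.mem_ball_self hR
  have hM0 : 0 ≤ M := (abs_nonneg _).trans (hM x0 hx0)
  set ρ := min 1 (R / 2) with hρd
  have hρ : 0 < ρ := lt_min one_pos (by linarith)
  have hF : ∀ x ∈ Metric.ball x0 R, |f x| ≤ |f x0| + H * R ^ α := by
    intro x hx
    have h1 := hf x0 hx0 x hx
    rw [Metric.mem_ball, dist_eq_norm] at hx
    have h2 : H * ‖x - x0‖ ^ α ≤ H * R ^ α := by gcongr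
    have h3 := abs_add_le (f x - f x0) (f x0)
    rw [sub_add_cancel] at h3
    linarith
  obtain ⟨C, hC0, hC⟩ := camp0 hN hα hα1 (M := M) hρ (min_le_left _ _) hH hM0
    (F := |f x0| + H * R ^ α) (by positivity)
  have key : ∀ x ∈ Metric.ball x0 (R / 2), ∃ c L Q, (∑ i, Q (eb i) (eb i) = f x) ∧
      (∀ ξ ζ, Q ξ ζ = Q ζ ξ) ∧
        ∀ y, ‖y‖ < ρ → |u (x + y) - qp c L Q y| ≤ C * (‖y‖ ^ 2 * ‖y‖ ^ α) := by
    intro x hx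
    rw [Metric.mem_ball] at hx
    have hmem : ∀ y : Eu N, ‖y‖ < ρ → y + x ∈ Metric.ball x0 R := by
      intro y hy
      rw [Metric.mem_ball]
      have h1 : dist (y + x) x = ‖y‖ := by rw [dist_eq_norm, add_sub_cancel_right]
      have h2 : ρ ≤ R / 2 := min_le_right _ _
      linarith [dist_triangle (y + x) x x0]
    have hx' : x ∈ Metric.ball x0 R := by simpa using hmem 0 (by simpa using hρ)
    have h1 : GSol (Metric.ball 0 ρ) (fun y => u (y + x)) (fun y => f (y + x)) :=
      hu.translate x fun y hy => hmem y (by rwa [mem_ball_zero_iff] at hy)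
    obtain ⟨c, L, Q, a1, a2, a3⟩ := hC _ _ h1 (fun y hy => hM _ (hmem y hy)) (fun y hy => by
      have := hf _ hx' _ (hmem y hy)
      rw [add_sub_cancel_right] at this
      simpa using this) (by simpa using hF x hx')
    refine ⟨c, L, Q, by simpa using a1, a2, fun y hy => ?_⟩
    rw [add_comm]; exact a3 y hy
  choose! c L Q h1 h2 h3 using key
  refine ⟨fun x hx => ?_, 72 * C, ρ / 2, by positivity, by linarith, fun x hx y hy hxy => ?_⟩
  · obtain ⟨b1, b2⟩ := quad_c2 Metric.isOpen_ball hρ hα hα1 hC0 h2 h3 hx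
    refine ⟨b1, ?_⟩
    rw [lap_eq b1, b2, h1 x hx]
  · rw [(quad_c2 Metric.isOpen_ball hρ hα hα1 hC0 h2 h3 hx).2,
      (quad_c2 Metric.isOpen_ball hρ hα hα1 hC0 h2 h3 hy).2]
    exact (quad_compare hα hα1 hC0 h2 h3 hx hy hxy).2

end schauder

end

section

open Set Filter MeasureTheory
open scoped Topology ContDiff

variable {N : ℕ}

/-- Maximum principle up to the boundary for generalised solutions on the unit ball. -/
theorem gsol_max_bdry (hN : 0 < N) {v f : Eu N → ℝ} {A B : ℝ} (hA : 0 ≤ A)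
    (hc : ContinuousOn v (Metric.closedBall 0 1))
    (h : GSol (Metric.ball 0 1) v f)
    (hf : ∀ y ∈ Metric.ball (0 : Eu N) 1, |f y| ≤ A)
    (hb : ∀ y ∈ Metric.sphere (0 : Eu N) 1, |v y| ≤ B) :
    ∀ y ∈ Metric.closedBall (0 : Eu N) 1, |v y| ≤ B + A * (1 - ‖y‖ ^ 2) := by
  intro x hx
  rw [mem_closedBall_zero_iff] at hx
  rcases hx.eq_or_lt with hx1 | hx1
  · rw [hx1]; have := hb x (by simpa using hx1); linarith
  refine le_of_forall_pos_le_add fun ε hε => ?_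
  have huc := (isCompact_closedBall (0 : Eu N) 1).uniformContinuousOn_of_continuous hc
  rw [Metric.uniformContinuousOn_iff] at huc
  obtain ⟨δ, hδ, huc⟩ := huc ε hε
  obtain ⟨s, hs1, hs2⟩ := exists_between (show max ‖x‖ (1 - δ) < 1 from max_lt hx1 (by linarith))
  have hsx : ‖x‖ < s := (le_max_left _ _).trans_lt hs1
  have hsd : 1 - δ < s := (le_max_right _ _).trans_lt hs1
  have hs0 : 0 < s := (norm_nonneg x).trans_lt hsx
  have key := gsol_max hN h (x0 := 0) (r := s) (ε := B + ε) (θ := A) hs0 hA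
    (Metric.closedBall_subset_ball hs2)
    (fun y hy => hf y (Metric.closedBall_subset_ball hs2 hy)) ?_ x (by simpa using hsx.le)
  · rw [sub_zero] at key
    have : s ^ 2 ≤ 1 := by nlinarith
    nlinarith
  · intro y hy
    rw [mem_sphere_zero_iff_norm] at hy
    have hy' : ‖(s⁻¹ • y)‖ = 1 := by
      rw [norm_smul, hy, norm_inv, Real.norm_of_nonneg hs0.le, inv_mul_cancel₀ hs0.ne']
    have h1 := huc y (by simpa [hy] using hs2.le) (s⁻¹ • y) (by simp [hy']) (by
      rw [dist_eq_norm]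
      have : y - s⁻¹ • y = (1 - s⁻¹) • y := by rw [sub_smul, one_smul]
      rw [this, norm_smul, hy, Real.norm_eq_abs, abs_sub_comm, abs_of_nonneg, sub_mul,
        inv_mul_cancel₀ hs0.ne']
      · linarith
      · rw [sub_nonneg]; exact (one_le_inv₀ hs0).2 hs2.le)
    have h2 := hb (s⁻¹ • y) (by simp [hy'])
    rw [Real.dist_eq] at h1
    rw [abs_le] at h2 ⊢
    rw [abs_lt] at h1
    constructor <;> linarith

/-- Radial retraction onto a closed ball. -/
noncomputable def clampB (s : ℝ) (x : Eu N) : Eu N := (s / max s ‖x‖) • x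

theorem clampB_cont {s : ℝ} (hs : 0 < s) : Continuous (clampB s : Eu N → Eu N) := by
  unfold clampB
  refine Continuous.smul (continuous_const.div (continuous_const.max continuous_norm) fun x => ?_)
    continuous_id
  exact (hs.trans_le (le_max_left _ _)).ne'

theorem clampB_norm {s : ℝ} (hs : 0 < s) (x : Eu N) : ‖clampB s x‖ ≤ s := by
  unfold clampB
  have h : 0 < max s ‖x‖ := hs.trans_le (le_max_left _ _)
  rw [norm_smul, Real.norm_of_nonneg (by positivity), div_mul_eq_mul_div, div_le_iff₀ h]
  exact mul_le_mul_of_nonneg_left (le_max_right _ _) hs.le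

theorem clampB_id {s : ℝ} (hs : 0 < s) {x : Eu N} (hx : ‖x‖ ≤ s) : clampB s x = x := by
  unfold clampB
  rw [max_eq_left hx, div_self hs.ne', one_smul]

/-- Linear Dirichlet problem on the unit ball with bounded continuous right-hand side. -/
theorem lin_solver (hN : 0 < N) {f g : Eu N → ℝ} {A : ℝ} (hA : 0 ≤ A)
    (hf : ContinuousOn f (Metric.ball 0 1))
    (hfA : ∀ y ∈ Metric.ball (0 : Eu N) 1, |f y| ≤ A)
    (hg : ContinuousOn g (Metric.closedBall 0 1)) :
    ∃ w : Eu N → ℝ, ContinuousOn w (Metric.closedBall 0 1) ∧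
      (∀ y ∈ Metric.sphere (0 : Eu N) 1, w y = g y) ∧ GSol (Metric.ball 0 1) w f := by
  set e : ℕ → ℝ := fun n => 1 / ((n : ℝ) + 2) with he
  have he0 : ∀ n, 0 < e n := fun n => by rw [he]; positivity
  have he1 : ∀ n, e n ≤ 1 / 2 := fun n => by
    simp only [he]; apply one_div_le_one_div_of_le <;> [norm_num; (have := n.cast_nonneg (α := ℝ); linarith)]
  have hemono : ∀ {m n : ℕ}, m ≤ n → e n ≤ e m := fun {m n} hmn => by
    simp only [he]; apply one_div_le_one_div_of_le (by positivity)
    have : (m : ℝ) ≤ n := by exact_mod_cast hmn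
    linarith
  have het : Tendsto e atTop (𝓝 0) := by
    have := (tendsto_one_div_add_atTop_nhds_zero_nat (𝕜 := ℝ)).comp (tendsto_add_atTop_nat 1)
    refine this.congr fun n => ?_
    simp only [he, Function.comp]; push_cast; ring
  have hcl : ∀ n, Continuous fun x : Eu N => f (clampB (1 - e n) x) := fun n => by
    have h0 : 0 < 1 - e n := by linarith [he1 n]
    refine hf.comp_continuous (clampB_cont h0) fun x => ?_
    rw [mem_ball_zero_iff]; exact (clampB_norm h0 x).trans_lt (by linarith [he0 n])
  choose p hp using fun n => poly_dense (fun x : Eu N => f (clampB (1 - e n) x))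
    (hcl n).continuousOn (he0 n)
  choose q hq using fun n => poly_dense g hg (he0 n)
  choose w hw1 hw2 using fun n => poly_dirichlet hN (p n) (q n)
  have hwc : ∀ n, ContDiff ℝ 2 (pev (w n)) := fun n => contDiff_infty.1 (pev_contDiff _) 2
  have hpA : ∀ n, ∀ x ∈ Metric.closedBall (0 : Eu N) 1, |pev (p n) x| ≤ A + 1 := by
    intro n x hx
    have h0 : 0 < 1 - e n := by linarith [he1 n]
    have h1 := hp n x hx
    have h2 := hfA (clampB (1 - e n) x) (by
      rw [mem_ball_zero_iff]; exact (clampB_norm h0 x).trans_lt (by linarith [he0 n]))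
    rw [abs_lt] at h1; rw [abs_le] at h2 ⊢
    constructor <;> linarith [he1 n]
  have hpf : ∀ m n, m ≤ n → ∀ x ∈ Metric.closedBall (0 : Eu N) (1 - e m),
      |pev (p n) x - f x| ≤ e m := by
    intro m n hmn x hx
    rw [mem_closedBall_zero_iff] at hx
    have h0 : 0 < 1 - e n := by linarith [he1 n]
    have h1 := hp n x (by rw [mem_closedBall_zero_iff]; linarith [he0 m])
    rw [clampB_id h0 (by linarith [hemono hmn])] at h1
    exact h1.le.trans (hemono hmn)
  have hsphere : ∀ m n k, m ≤ n → m ≤ k → ∀ x ∈ Metric.sphere (0 : Eu N) 1,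
      pev (w n) x - pev (w k) x ≤ 2 * e m := by
    intro m n k hn hk x hx
    have hx' : ‖x‖ = 1 := by simpa using hx
    rw [hw2 n x hx', hw2 k x hx']
    have h1 := hq n x (Metric.sphere_subset_closedBall hx)
    have h2 := hq k x (Metric.sphere_subset_closedBall hx)
    rw [abs_lt] at h1 h2
    linarith [hemono hn, hemono hk]
  have hdiff : ∀ m n k, m ≤ n → m ≤ k → ∀ x ∈ Metric.closedBall (0 : Eu N) 1,
      pev (w n) x - pev (w k) x ≤ (4 * A + 8) * e m := by
    intro m n k hn hk x hx
    have hl : ∀ y, lap (fun y => pev (w n) y - pev (w k) y) y = pev (p n) y - pev (p k) y := by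
      intro y
      rw [lap_sub (hwc n).contDiffAt (hwc k).contDiffAt, lap_pev, lap_pev]
      exact congrArg₂ (fun a b => pev a y - pev b y) (hw1 n) (hw1 k)
    have hcd := (hwc n).sub (hwc k)
    have b1 := cmax1 hN (v := fun y => pev (w n) y - pev (w k) y) (x0 := 0) (r := 1) (ε := 2 * e m)
      (θ := 2 * (A + 1)) one_pos (by linarith) hcd.continuous.continuousOn
      (fun y _ => hcd.contDiffAt) (fun y hy => by
        rw [hl]
        have h1 := abs_le.1 (hpA n y (Metric.ball_subset_closedBall hy))
        have h2 := abs_le.1 (hpA k y (Metric.ball_subset_closedBall hy))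
        linarith) (hsphere m n k hn hk)
    simp only [sub_zero] at b1
    have hs0 : 0 < 1 - e m := by linarith [he1 m]
    have b1' : ∀ y ∈ Metric.closedBall (0 : Eu N) 1, 1 - e m ≤ ‖y‖ →
        pev (w n) y - pev (w k) y ≤ 2 * e m + 4 * (A + 1) * e m := by
      intro y hy hy2
      have h1 := b1 y hy
      rw [mem_closedBall_zero_iff] at hy
      have h3 : 1 ^ 2 - ‖y‖ ^ 2 ≤ 2 * e m := by nlinarith [he0 m]
      nlinarith
    rcases le_total (1 - e m) ‖x‖ with hx1 | hx1
    · have := b1' x hx hx1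
      nlinarith [he0 m]
    · have b2 := cmax1 hN (v := fun y => pev (w n) y - pev (w k) y) (x0 := 0) (r := 1 - e m)
        (ε := 2 * e m + 4 * (A + 1) * e m)
        (θ := 2 * e m) hs0 (by linarith [he0 m]) hcd.continuous.continuousOn
        (fun y _ => hcd.contDiffAt) (fun y hy => by
          rw [hl]
          have h1 := abs_le.1 (hpf m n hn y (Metric.ball_subset_closedBall hy))
          have h2 := abs_le.1 (hpf m k hk y (Metric.ball_subset_closedBall hy))
          linarith) (fun y hy => b1' y (by
            rw [mem_sphere_zero_iff_norm] at hy; rw [mem_closedBall_zero_iff, hy]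
            linarith [he0 m]) (by rw [mem_sphere_zero_iff_norm] at hy; rw [hy]))
        x (by simpa using hx1)
      rw [sub_zero] at b2
      have h3 : (1 - e m) ^ 2 - ‖x‖ ^ 2 ≤ 1 := by nlinarith [he0 m, sq_nonneg ‖x‖]
      nlinarith [he0 m]
  have hE : Tendsto (fun n => (4 * A + 8) * e n) atTop (𝓝 0) := by simpa using het.const_mul (4 * A + 8)
  have hdiff' : ∀ m n k, m ≤ n → m ≤ k → ∀ x ∈ Metric.closedBall (0 : Eu N) 1,
      |pev (w n) x - pev (w k) x| ≤ (4 * A + 8) * e m := fun m n k hn hk x hx => by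
    rw [abs_le]
    constructor
    · linarith [hdiff m k n hk hn x hx]
    · exact hdiff m n k hn hk x hx
  have hlim : ∀ x, ∃ l, x ∈ Metric.closedBall (0 : Eu N) 1 →
      Tendsto (fun n => pev (w n) x) atTop (𝓝 l) := by
    intro x
    by_cases hx : x ∈ Metric.closedBall (0 : Eu N) 1
    · have : CauchySeq (fun n => pev (w n) x) :=
        cauchySeq_of_le_tendsto_0 _ (fun n k m hn hk => by
          rw [Real.dist_eq]; exact hdiff' m n k hn hk x hx) hE
      obtain ⟨l, hl⟩ := cauchySeq_tendsto_of_complete this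
      exact ⟨l, fun _ => hl⟩
    · exact ⟨0, fun h => absurd h hx⟩
  choose W hW using hlim
  have hbd : ∀ m, ∀ x ∈ Metric.closedBall (0 : Eu N) 1, |pev (w m) x - W x| ≤ (4 * A + 8) * e m := by
    intro m x hx
    refine le_of_tendsto ((tendsto_const_nhds.sub (hW x hx)).abs) ?_
    filter_upwards [eventually_ge_atTop m] with k hk
    exact hdiff' m m k le_rfl hk x hx
  refine ⟨W, ?_, ?_, ?_⟩
  · have hu : TendstoUniformlyOn (fun n x => pev (w n) x) W atTop (Metric.closedBall (0 : Eu N) 1) := by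
      rw [Metric.tendstoUniformlyOn_iff]
      intro ε hε
      filter_upwards [hE.eventually (gt_mem_nhds hε)] with n hn x hx
      rw [dist_comm, Real.dist_eq]
      exact (hbd n x hx).trans_lt hn
    exact hu.continuousOn (Eventually.of_forall fun n => (hwc n).continuous.continuousOn).frequently
  · intro y hy
    have hy' : ‖y‖ = 1 := by simpa using hy
    have h1 := hW y (Metric.sphere_subset_closedBall hy)
    refine tendsto_nhds_unique h1 ?_
    rw [tendsto_iff_dist_tendsto_zero]
    refine squeeze_zero (fun _ => dist_nonneg) (fun n => ?_) het
    rw [Real.dist_eq, hw2 n y hy']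
    exact (hq n y (Metric.sphere_subset_closedBall hy)).le
  · intro K hK hKc ε hε
    have hs : ∃ s < 1, ∀ x ∈ K, ‖x‖ ≤ s := by
      rcases K.eq_empty_or_nonempty with rfl | hne
      · exact ⟨0, one_pos, by simp⟩
      · obtain ⟨z, hz, hm⟩ := hKc.exists_isMaxOn hne continuous_norm.continuousOn
        exact ⟨‖z‖, by simpa using hK hz, fun x hx => hm hx⟩
    obtain ⟨s, hs1, hs⟩ := hs
    obtain ⟨n, hn1, hn2, hn3⟩ := ((het.eventually (gt_mem_nhds (sub_pos.2 hs1))).and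
      ((het.eventually (gt_mem_nhds hε)).and (hE.eventually (gt_mem_nhds hε)))).exists
    refine ⟨pev (w n), fun y hy => ⟨(hwc n).contDiffAt, ?_, ?_⟩⟩
    · exact (hbd n y (Metric.ball_subset_closedBall (hK hy))).trans hn3.le
    · rw [lap_pev]
      have h1 := hpf n n le_rfl y (by rw [mem_closedBall_zero_iff]; linarith [hs y hy])
      have h2 : pev (PLap (w n)) y = pev (p n) y := congrArg (fun a => pev a y) (hw1 n)
      rw [h2]; exact h1.trans hn2.le

end

section

open Set Filter MeasureTheory
open scoped Topology ContDiff

variable {N : ℕ}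

/-- Admissible bounded nonlinearities. -/
structure NL (S : Set (Eu N)) (H : Eu N → ℝ → ℝ → ℝ) (A L Hc α : ℝ) : Prop where
  A0 : 0 ≤ A
  L0 : 0 ≤ L
  H0 : 0 ≤ Hc
  bdd : ∀ x ∈ S, ∀ s q, 0 ≤ q → |H x s q| ≤ A
  lip : ∀ x ∈ S, ∀ s q t p, 0 ≤ q → 0 ≤ p → |H x s q - H x t p| ≤ L * (|s - t| + |q - p|)
  hol : ∀ x ∈ S, ∀ y ∈ S, ∀ s q, 0 ≤ q → |H x s q - H y s q| ≤ Hc * ‖x - y‖ ^ α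

theorem NL.full {S : Set (Eu N)} {H : Eu N → ℝ → ℝ → ℝ} {A L Hc α : ℝ} (h : NL S H A L Hc α)
    {x y : Eu N} (hx : x ∈ S) (hy : y ∈ S) {s q t p : ℝ} (hq : 0 ≤ q) (hp : 0 ≤ p) :
    |H x s q - H y t p| ≤ Hc * ‖x - y‖ ^ α + L * (|s - t| + |q - p|) := by
  have h1 := h.hol x hx y hy s q hq
  have h2 := h.lip y hy s q t p hq hp
  calc |H x s q - H y t p| = |(H x s q - H y s q) + (H y s q - H y t p)| := by ring_nf
    _ ≤ _ := (abs_add_le _ _).trans (add_le_add h1 h2)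

/-- Interior regularity of generalised solutions in a compactly contained ball. -/
theorem gsol_diff {u f : Eu N → ℝ} {S : Set (Eu N)} (hS : IsOpen S) (h : GSol S u f) {A M : ℝ}
    (hM : ∀ y ∈ S, |u y| ≤ M) (hA : ∀ y ∈ S, |f y| ≤ A)
    {x : Eu N} (hx : x ∈ S) :
    ∃ r K, 0 < r ∧ r ≤ 1 / 2 ∧ 0 ≤ K ∧ Metric.ball x r ⊆ S ∧
      (∀ y ∈ Metric.ball x r, DifferentiableAt ℝ u y ∧ ‖fderiv ℝ u y‖ ≤ K) ∧
      ∀ y ∈ Metric.ball x r, ∀ z ∈ Metric.ball x r,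
        ‖fderiv ℝ u y - fderiv ℝ u z‖ ≤ K * √‖y - z‖ := by
  obtain ⟨R, hR, hRS⟩ := Metric.isOpen_iff.1 hS x hx
  have hr : 0 < min (R / 8) (1 / 2) := by positivity
  have hsub : Metric.closedBall x (4 * min (R / 8) (1 / 2)) ⊆ S :=
    (Metric.closedBall_subset_ball (by linarith [min_le_left (R / 8) (1 / 2)])).trans hRS
  obtain ⟨K, hK, h1, h2⟩ := gsol_grad_holder h hr hsub (fun y hy => hM y (hsub hy))
    (fun y hy => hA y (hsub hy))
  refine ⟨_, K, hr, min_le_right _ _, hK,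
    (Metric.ball_subset_closedBall.trans
      (Metric.closedBall_subset_closedBall (by linarith))).trans hsub,
    fun y hy => h1 y ?_, h2⟩
  exact Metric.closedBall_subset_closedBall (by linarith) (Metric.ball_subset_closedBall hy)

theorem gsol_fderiv_cont {u f : Eu N → ℝ} {S : Set (Eu N)} (hS : IsOpen S) (h : GSol S u f)
    {A M : ℝ} (hM : ∀ y ∈ S, |u y| ≤ M) (hA : ∀ y ∈ S, |f y| ≤ A) :
    ContinuousOn (fderiv ℝ u) S := by
  intro x hx
  obtain ⟨r, K, hr, -, -, -, -, h2⟩ := gsol_diff hS h hM hA hx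
  refine ContinuousAt.continuousWithinAt ?_
  refine continuousAt_of_holder_bound (K := K) (β := 1 / 2) (by norm_num) ?_
  filter_upwards [Metric.ball_mem_nhds x hr] with y hy
  rw [← Real.sqrt_eq_rpow]
  exact h2 y hy x (Metric.mem_ball_self hr)

theorem nl_fix (hN : 0 < N) : ∃ ε0 : ℝ, 0 < ε0 ∧ ∀ (H : Eu N → ℝ → ℝ → ℝ) (A L Hc α : ℝ), 0 < α →
    NL (Metric.ball 0 1) H A L Hc α → L ≤ ε0 →
    ∀ g : Eu N → ℝ, ContinuousOn g (Metric.closedBall 0 1) →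
    ∃ w : Eu N → ℝ, ContinuousOn w (Metric.closedBall 0 1) ∧
      (∀ y ∈ Metric.sphere (0 : Eu N) 1, w y = g y) ∧
      GSol (Metric.ball 0 1) w (fun x => H x (w x) ‖fderiv ℝ w x‖) := by
  obtain ⟨C, hC, hg1⟩ := gsol_c1 N
  refine ⟨1 / (2 * (1 + 7 * C)), by positivity, fun H A L Hc α hα hH hL g hg => ?_⟩
  classical
  let B := Metric.ball (0 : Eu N) 1
  let E := BoundedContinuousFunction B ℝ
  let ext : E → Eu N → ℝ := fun F x => if h : x ∈ B then F ⟨x, h⟩ else 0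
  have hext : ∀ (F : E) (x : B), ext F x = F x := fun F x => by
    simp only [ext]; rw [dif_pos x.2]
  have hextc : ∀ F : E, ContinuousOn (ext F) B := fun F => by
    rw [continuousOn_iff_continuous_domRestrict]
    refine F.continuous.congr fun x => ?_
    rw [Set.domRestrict_apply, hext]
  have hextb : ∀ F : E, ∀ y ∈ B, |ext F y| ≤ ‖F‖ := fun F y hy => by
    rw [hext F ⟨y, hy⟩]; exact F.norm_coe_le_norm _
  choose W hWc hWs hWg using fun F : E => lin_solver hN (norm_nonneg F) (hextc F) (hextb F) hg
  have hWb : ∀ F : E, ∃ M, ∀ y ∈ B, |W F y| ≤ M := fun F => by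
    obtain ⟨M, hM⟩ := (isCompact_closedBall (0 : Eu N) 1).exists_bound_of_continuousOn (hWc F)
    exact ⟨M, fun y hy => hM y (Metric.ball_subset_closedBall hy)⟩
  have hWfc : ∀ F : E, ContinuousOn (fderiv ℝ (W F)) B := fun F => by
    obtain ⟨M, hM⟩ := hWb F
    exact gsol_fderiv_cont Metric.isOpen_ball (hWg F) hM (hextb F)
  have hWd : ∀ F : E, ∀ x ∈ B, DifferentiableAt ℝ (W F) x := fun F x hx => by
    obtain ⟨M, hM⟩ := hWb F
    obtain ⟨r, K, hr, -, -, -, h1, -⟩ := gsol_diff Metric.isOpen_ball (hWg F) hM (hextb F) hx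
    exact (h1 x (Metric.mem_ball_self hr)).1
  have hTc : ∀ F : E, Continuous fun x : B => H x (W F x) ‖fderiv ℝ (W F) x‖ := fun F => by
    rw [continuous_iff_continuousAt]
    intro x
    rw [ContinuousAt, tendsto_iff_dist_tendsto_zero]
    have c1 : Continuous fun y : B => W F y :=
      continuousOn_iff_continuous_domRestrict.1 ((hWc F).mono Metric.ball_subset_closedBall)
    have c2 : Continuous fun y : B => ‖fderiv ℝ (W F) y‖ :=
      (continuousOn_iff_continuous_domRestrict.1 (hWfc F)).norm
    have c0 : Continuous fun y : B => ‖(y : Eu N) - x‖ ^ α := by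
      refine Continuous.rpow_const ?_ fun _ => Or.inr hα.le
      fun_prop
    refine squeeze_zero (fun _ => dist_nonneg) (fun y => ?_) (?_ : Tendsto (fun y : B =>
      Hc * ‖(y : Eu N) - x‖ ^ α + L * (|W F y - W F x| + |‖fderiv ℝ (W F) y‖ - ‖fderiv ℝ (W F) x‖|))
      (𝓝 x) (𝓝 0))
    · rw [Real.dist_eq]
      exact hH.full y.2 x.2 (norm_nonneg _) (norm_nonneg _)
    · have : Continuous (fun y : B => Hc * ‖(y : Eu N) - x‖ ^ α +
          L * (|W F y - W F x| + |‖fderiv ℝ (W F) y‖ - ‖fderiv ℝ (W F) x‖|)) :=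
        (continuous_const.mul c0).add (continuous_const.mul
          ((c1.sub continuous_const).abs.add (c2.sub continuous_const).abs))
      have h := this.tendsto x
      simpa [Real.zero_rpow hα.ne'] using h
  let T : E → E := fun F => BoundedContinuousFunction.ofNormedAddCommGroup
    (fun x : B => H x (W F x) ‖fderiv ℝ (W F) x‖) (hTc F) A
    (fun x => hH.bdd x x.2 _ _ (norm_nonneg _))
  have hT : ContractingWith (1 / 2) T := by
    refine ⟨by rw [← NNReal.coe_lt_coe]; norm_num, LipschitzWith.of_dist_le_mul fun F G => ?_⟩
    rw [BoundedContinuousFunction.dist_le (by positivity)]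
    intro x
    set D := dist F G with hD
    have hD0 : 0 ≤ D := dist_nonneg
    have hv := (hWg F).sub (hWg G)
    have hfb : ∀ y ∈ B, |ext F y - ext G y| ≤ D := fun y hy => by
      rw [hext F ⟨y, hy⟩, hext G ⟨y, hy⟩, ← Real.dist_eq]
      exact BoundedContinuousFunction.dist_coe_le_dist _
    have hvb := gsol_max_bdry hN hD0 ((hWc F).sub (hWc G)) hv hfb (B := 0) (fun y hy => by
      simp only [Pi.sub_apply, hWs F y hy, hWs G y hy, sub_self, abs_zero, le_refl])
    have hx1 : ‖(x : Eu N)‖ < 1 := mem_ball_zero_iff.1 x.2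
    set d := 1 - ‖(x : Eu N)‖ with hd
    have hd0 : 0 < d := by linarith
    have hd1 : d ≤ 1 := by linarith [norm_nonneg (x : Eu N)]
    have hsub : Metric.closedBall (x : Eu N) (d / 2) ⊆ B := fun y hy => by
      rw [mem_closedBall_iff_norm] at hy
      simp only [B, mem_ball_zero_iff]
      have := norm_le_norm_add_norm_sub' y x
      linarith
    obtain ⟨-, hgr⟩ := hg1 B _ _ hv x (d / 2) D (3 * D * d) (by linarith) hsub (fun y hy => by
      have h1 := hvb y (Metric.ball_subset_closedBall (hsub hy))
      have hy1 : ‖y‖ < 1 := mem_ball_zero_iff.1 (hsub hy)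
      rw [mem_closedBall_iff_norm] at hy
      have := norm_sub_norm_le (x : Eu N) y
      rw [norm_sub_rev] at this
      have h3 : 1 - ‖y‖ ≤ 3 * d / 2 := by linarith
      have h4 : 1 - ‖y‖ ^ 2 ≤ 3 * d := by nlinarith [norm_nonneg y]
      have h5 : D * (1 - ‖y‖ ^ 2) ≤ D * (3 * d) := mul_le_mul_of_nonneg_left h4 hD0
      simp only [Pi.sub_apply] at h1
      linarith) (fun y hy => hfb y (hsub hy))
    have hgr' : ‖fderiv ℝ (W F) x - fderiv ℝ (W G) x‖ ≤ 7 * C * D := by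
      rw [← fderiv_fun_sub (hWd F x x.2) (hWd G x x.2)]
      refine hgr.trans ?_
      have : 3 * D * d / (d / 2) = 6 * D := by field_simp; ring
      rw [this]
      nlinarith [mul_nonneg hC hD0]
    have hvx : |W F x - W G x| ≤ D := by
      have h1 := hvb x (Metric.ball_subset_closedBall x.2)
      simp only [Pi.sub_apply] at h1
      nlinarith [sq_nonneg ‖(x : Eu N)‖]
    have h1 := hH.lip x x.2 (W F x) ‖fderiv ℝ (W F) x‖ (W G x) ‖fderiv ℝ (W G) x‖
      (norm_nonneg _) (norm_nonneg _)
    have h2 := abs_norm_sub_norm_le (fderiv ℝ (W F) x) (fderiv ℝ (W G) x)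
    rw [Real.dist_eq]
    refine h1.trans ?_
    have h3 : |W F x - W G x| + |‖fderiv ℝ (W F) x‖ - ‖fderiv ℝ (W G) x‖| ≤ (1 + 7 * C) * D := by
      linarith
    have h4 : L * ((1 + 7 * C) * D) ≤ 1 / (2 * (1 + 7 * C)) * ((1 + 7 * C) * D) :=
      mul_le_mul_of_nonneg_right hL (by positivity)
    have h5 : 1 / (2 * (1 + 7 * C)) * ((1 + 7 * C) * D) = 1 / 2 * D := by
      field_simp
    have h6 := mul_le_mul_of_nonneg_left h3 hH.L0
    push_cast
    linarith
  let F := ContractingWith.fixedPoint T hT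
  have hF : T F = F := hT.fixedPoint_isFixedPt
  refine ⟨W F, hWc F, hWs F, (hWg F).congr (fun _ _ => rfl) fun y hy => ?_⟩
  rw [hext F ⟨y, hy⟩]
  conv_lhs => rw [← hF]
  rfl

/-- Local Hölder continuity of the second derivative near a point. -/
def LH (α : ℝ) (w : Eu N → ℝ) (x : Eu N) : Prop :=
  ∃ ρ C, 0 < ρ ∧ 0 ≤ C ∧ ∀ y ∈ Metric.ball x ρ, ∀ z ∈ Metric.ball x ρ,
    ‖D2 w y - D2 w z‖ ≤ C * ‖y - z‖ ^ α

theorem schauder' (hN : 0 < N) {α R H M : ℝ} (hα : 0 < α) (hα1 : α < 1) (hR : 0 < R) (hH : 0 ≤ H)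
    {x0 : Eu N} {u f : Eu N → ℝ}
    (hu : GSol (Metric.ball x0 R) u f) (hM : ∀ y ∈ Metric.ball x0 R, |u y| ≤ M)
    (hf : ∀ x ∈ Metric.ball x0 R, ∀ y ∈ Metric.ball x0 R, |f x - f y| ≤ H * ‖x - y‖ ^ α) :
    (∀ x ∈ Metric.ball x0 (R / 2), ContDiffAt ℝ 2 u x ∧ lap u x = f x) ∧ LH α u x0 := by
  obtain ⟨h1, C, δ, hC, hδ, h2⟩ := schauder hN hα hα1 hR hH hu hM (fun x hx y hy => hf y hy x hx)
  refine ⟨h1, min (R / 2) (δ / 2), C, by positivity, hC, fun y hy z hz => ?_⟩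
  refine h2 z (Metric.ball_subset_ball (min_le_left _ _) hz) y
    (Metric.ball_subset_ball (min_le_left _ _) hy) ?_
  have hy' := Metric.ball_subset_ball (min_le_right _ _) hy
  have hz' := Metric.ball_subset_ball (min_le_right _ _) hz
  rw [mem_ball_iff_norm] at hy' hz'
  calc ‖y - z‖ = ‖(y - x0) - (z - x0)‖ := by congr 1; abel
    _ ≤ _ := norm_sub_le _ _
    _ < δ := by linarith

theorem nl_reg (hN : 0 < N) {H : Eu N → ℝ → ℝ → ℝ} {A L Hc α M : ℝ} (hα : 0 < α) (hα1 : α < 1)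
    {S : Set (Eu N)} (hS : IsOpen S) (hH : NL S H A L Hc α) {w : Eu N → ℝ}
    (hM : ∀ y ∈ S, |w y| ≤ M)
    (hw : GSol S w (fun x => H x (w x) ‖fderiv ℝ w x‖)) :
    ∀ x ∈ S, ContDiffAt ℝ 2 w x ∧ lap w x = H x (w x) ‖fderiv ℝ w x‖ ∧ LH α w x := by
  intro x hx
  obtain ⟨r, K, hr, hr1, hK, hrS, hd, hh⟩ := gsol_diff hS hw hM
    (fun y hy => hH.bdd y hy _ _ (norm_nonneg _)) hx
  have hlip : ∀ y ∈ Metric.ball x r, ∀ z ∈ Metric.ball x r, |w y - w z| ≤ K * ‖y - z‖ :=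
    fun y hy z hz => (convex_ball x r).norm_image_sub_le_of_norm_fderiv_le (𝕜 := ℝ)
      (fun t ht => (hd t ht).1) (fun t ht => (hd t ht).2) hz hy
  have hle1 : ∀ y ∈ Metric.ball x r, ∀ z ∈ Metric.ball x r, ‖y - z‖ ≤ 1 := by
    intro y hy z hz
    rw [mem_ball_iff_norm] at hy hz
    calc ‖y - z‖ = ‖(y - x) - (z - x)‖ := by congr 1; abel
      _ ≤ _ := norm_sub_le _ _
      _ ≤ 1 := by linarith
  have hpow : ∀ {t β γ : ℝ}, 0 ≤ t → t ≤ 1 → 0 < β → β ≤ γ → t ^ γ ≤ t ^ β := by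
    intro t β γ h0 h1 hβ hγ
    exact Real.rpow_le_rpow_of_exponent_ge_of_imp h0 h1 hγ (fun _ h => absurd h (hβ.trans_le hγ).ne')
  set β := min α (1 / 2) with hβ
  have hβ0 : 0 < β := lt_min hα (by norm_num)
  have hβ1 : β < 1 := (min_le_right _ _).trans_lt (by norm_num)
  have s1 := schauder' hN (α := β) (R := r) (H := Hc + L * (K + K)) hβ0 hβ1 hr
    (by have := hH.H0; have := hH.L0; positivity) (hw.mono hrS) (fun y hy => hM y (hrS hy))
    (fun y hy z hz => by
      have hf := hH.full (hrS hy) (hrS hz) (s := w y) (t := w z) (norm_nonneg (fderiv ℝ w y))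
        (norm_nonneg (fderiv ℝ w z))
      have h1 := hlip y hy z hz
      have h2 := (abs_norm_sub_norm_le _ _).trans (hh y hy z hz)
      have h0 := hle1 y hy z hz
      have p1 : ‖y - z‖ ^ α ≤ ‖y - z‖ ^ β := hpow (norm_nonneg _) h0 hβ0 (min_le_left _ _)
      have p2 : √‖y - z‖ ≤ ‖y - z‖ ^ β := by
        rw [Real.sqrt_eq_rpow]; exact hpow (norm_nonneg _) h0 hβ0 (min_le_right _ _)
      have p3 : ‖y - z‖ ≤ ‖y - z‖ ^ β := by
        conv_lhs => rw [← Real.rpow_one ‖y - z‖]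
        exact hpow (norm_nonneg _) h0 hβ0 hβ1.le
      have q1 := mul_le_mul_of_nonneg_left p1 hH.H0
      have q2 := mul_le_mul_of_nonneg_left p2 hK
      have q3 := mul_le_mul_of_nonneg_left p3 hK
      have q4 := mul_le_mul_of_nonneg_left (add_le_add (h1.trans q3) (h2.trans q2)) hH.L0
      calc _ ≤ _ := hf
        _ ≤ _ := add_le_add q1 q4
        _ = _ := by ring)
  obtain ⟨hc2, ρ0, C0, hρ0, hC0, hD⟩ := s1
  have hD2b : ∀ y ∈ Metric.ball x (min ρ0 (r / 2)), ‖D2 w y‖ ≤ C0 + ‖D2 w x‖ := by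
    intro y hy
    have hy0 := Metric.ball_subset_ball (min_le_left _ _) hy
    have hy1 : y ∈ Metric.ball x r := Metric.ball_subset_ball (by linarith)
      (Metric.ball_subset_ball (min_le_right _ _) hy)
    have h1 := hD y hy0 x (Metric.mem_ball_self hρ0)
    have h0 := hle1 y hy1 x (Metric.mem_ball_self hr)
    have h2 : ‖y - x‖ ^ β ≤ 1 := Real.rpow_le_one (norm_nonneg _) h0 hβ0.le
    have h3 := norm_le_norm_add_norm_sub' (D2 w y) (D2 w x)
    nlinarith
  set K2 := C0 + ‖D2 w x‖ with hK2
  have hK20 : 0 ≤ K2 := by have := norm_nonneg (D2 w x); linarith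
  have hr2 : 0 < min ρ0 (r / 2) := by positivity
  have hsub2 : Metric.ball x (min ρ0 (r / 2)) ⊆ Metric.ball x r :=
    Metric.ball_subset_ball ((min_le_right _ _).trans (by linarith))
  have hlip2 : ∀ y ∈ Metric.ball x (min ρ0 (r / 2)), ∀ z ∈ Metric.ball x (min ρ0 (r / 2)),
      ‖fderiv ℝ w y - fderiv ℝ w z‖ ≤ K2 * ‖y - z‖ :=
    fun y hy z hz => (convex_ball x _).norm_image_sub_le_of_norm_fderiv_le (𝕜 := ℝ)
      (fun t ht => (hc2 t (Metric.ball_subset_ball (min_le_right _ _) ht)).1.fderiv_diff)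
      (fun t ht => hD2b t ht) hz hy
  have s2 := schauder' hN (α := α) (R := min ρ0 (r / 2)) (H := Hc + L * (K + K2)) hα hα1 hr2
    (by have := hH.H0; have := hH.L0; positivity) (hw.mono (hsub2.trans hrS))
    (fun y hy => hM y (hrS (hsub2 hy)))
    (fun y hy z hz => by
      have hf := hH.full (hrS (hsub2 hy)) (hrS (hsub2 hz)) (s := w y) (t := w z)
        (norm_nonneg (fderiv ℝ w y)) (norm_nonneg (fderiv ℝ w z))
      have h1 := hlip y (hsub2 hy) z (hsub2 hz)
      have h2 := (abs_norm_sub_norm_le _ _).trans (hlip2 y hy z hz)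
      have h0 := hle1 y (hsub2 hy) z (hsub2 hz)
      have p3 : ‖y - z‖ ≤ ‖y - z‖ ^ α := by
        conv_lhs => rw [← Real.rpow_one ‖y - z‖]
        exact hpow (norm_nonneg _) h0 hα hα1.le
      have q2 := mul_le_mul_of_nonneg_left p3 hK20
      have q3 := mul_le_mul_of_nonneg_left p3 hK
      have q4 := mul_le_mul_of_nonneg_left (add_le_add (h1.trans q3) (h2.trans q2)) hH.L0
      calc _ ≤ _ := hf
        _ ≤ _ := add_le_add_right q4 _
        _ = _ := by ring)
  obtain ⟨a1, a2⟩ := hc2 x (Metric.mem_ball_self (by linarith))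
  exact ⟨a1, a2, s2.2⟩

end

section

open Set Filter MeasureTheory
open scoped Topology ContDiff

variable {N : ℕ}

/-- Local solvability of the nonlinear Dirichlet problem on small balls. -/
theorem nl_solve (hN : 0 < N) : ∃ ε0 : ℝ, 0 < ε0 ∧ ∀ (H : Eu N → ℝ → ℝ → ℝ)
    (A L Hc α r : ℝ) (x0 : Eu N), 0 < α → α < 1 → 0 < r → r ≤ 1 →
    NL (Metric.ball x0 r) H A L Hc α → r * L ≤ ε0 →
    ∀ g : Eu N → ℝ, ContinuousOn g (Metric.closedBall x0 r) →
    ∃ w : Eu N → ℝ, ContinuousOn w (Metric.closedBall x0 r) ∧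
      (∀ y ∈ Metric.sphere x0 r, w y = g y) ∧
      ∀ x ∈ Metric.ball x0 r, ContDiffAt ℝ 2 w x ∧ lap w x = H x (w x) ‖fderiv ℝ w x‖ ∧
        LH α w x := by
  obtain ⟨ε0, hε0, hfix⟩ := nl_fix (N := N) hN
  refine ⟨ε0, hε0, fun H A L Hc α r x0 hα hα1 hr hr1 hH hL g hg => ?_⟩
  have hmem : ∀ y : Eu N, y ∈ Metric.ball (0 : Eu N) 1 → x0 + r • y ∈ Metric.ball x0 r := by
    intro y hy
    rw [mem_ball_zero_iff] at hy
    rw [mem_ball_iff_norm, add_sub_cancel_left, norm_smul, Real.norm_of_nonneg hr.le]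
    nlinarith
  have hmemc : ∀ y : Eu N, y ∈ Metric.closedBall (0 : Eu N) 1 →
      x0 + r • y ∈ Metric.closedBall x0 r := by
    intro y hy
    rw [mem_closedBall_zero_iff] at hy
    rw [mem_closedBall_iff_norm, add_sub_cancel_left, norm_smul, Real.norm_of_nonneg hr.le]
    nlinarith
  have hr2 : 0 ≤ r ^ 2 := sq_nonneg r
  have hNL : NL (Metric.ball (0 : Eu N) 1) (fun y s q => r ^ 2 * H (x0 + r • y) s (q / r))
      (r ^ 2 * A) (r * L) (r ^ 2 * (Hc * r ^ α)) α := by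
    refine ⟨mul_nonneg hr2 hH.A0, mul_nonneg hr.le hH.L0,
      mul_nonneg hr2 (mul_nonneg hH.H0 (by positivity)), ?_, ?_, ?_⟩
    · intro x hx s q hq
      rw [abs_mul, abs_of_nonneg hr2]
      exact mul_le_mul_of_nonneg_left (hH.bdd _ (hmem x hx) _ _ (by positivity)) hr2
    · intro x hx s q t p hq hp
      rw [← mul_sub, abs_mul, abs_of_nonneg hr2]
      have h1 := hH.lip _ (hmem x hx) s (q / r) t (p / r) (by positivity) (by positivity)
      have h2 := mul_le_mul_of_nonneg_left h1 hr2
      refine h2.trans ?_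
      have h3 : |q / r - p / r| = |q - p| / r := by
        rw [← sub_div, abs_div, abs_of_pos hr]
      rw [h3]
      have h4 : r ^ 2 * (L * (|s - t| + |q - p| / r)) = r * L * (r * |s - t| + |q - p|) := by
        field_simp
      rw [h4]
      refine mul_le_mul_of_nonneg_left ?_ (mul_nonneg hr.le hH.L0)
      have := abs_nonneg (s - t)
      nlinarith
    · intro x hx y hy s q hq
      rw [← mul_sub, abs_mul, abs_of_nonneg hr2, mul_assoc]
      refine mul_le_mul_of_nonneg_left ?_ hr2
      refine (hH.hol _ (hmem x hx) _ (hmem y hy) s (q / r) (by positivity)).trans (le_of_eq ?_)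
      rw [add_sub_add_left_eq_sub, ← smul_sub, norm_smul, Real.norm_of_nonneg hr.le,
        Real.mul_rpow hr.le (norm_nonneg _), mul_assoc]
  obtain ⟨w, hwc, hws, hwg⟩ := hfix _ _ _ _ α hα hNL hL (fun y => g (x0 + r • y))
    (hg.comp (by fun_prop) hmemc)
  have hinv : ∀ x : Eu N, x0 + r • (-(r⁻¹ • x0) + r⁻¹ • x) = x := by
    intro x
    rw [smul_add, smul_neg, smul_smul, smul_smul, mul_inv_cancel₀ hr.ne', one_smul, one_smul]
    abel
  have hn : ∀ x : Eu N, ‖-(r⁻¹ • x0) + r⁻¹ • x‖ = ‖x - x0‖ / r := by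
    intro x
    have : -(r⁻¹ • x0) + r⁻¹ • x = r⁻¹ • (x - x0) := by rw [smul_sub]; abel
    rw [this, norm_smul, norm_inv, Real.norm_of_nonneg hr.le, inv_mul_eq_div]
  have hb : ∀ x ∈ Metric.ball x0 r, -(r⁻¹ • x0) + r⁻¹ • x ∈ Metric.ball (0 : Eu N) 1 := by
    intro x hx
    rw [mem_ball_iff_norm] at hx
    rw [mem_ball_zero_iff, hn, div_lt_one hr]; exact hx
  have hcb : ∀ x ∈ Metric.closedBall x0 r,
      -(r⁻¹ • x0) + r⁻¹ • x ∈ Metric.closedBall (0 : Eu N) 1 := by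
    intro x hx
    rw [mem_closedBall_iff_norm] at hx
    rw [mem_closedBall_zero_iff, hn, div_le_one hr]; exact hx
  have hfd : ∀ x, fderiv ℝ (fun x => w (-(r⁻¹ • x0) + r⁻¹ • x)) x =
      r⁻¹ • fderiv ℝ w (-(r⁻¹ • x0) + r⁻¹ • x) := by
    intro x
    have h := fderiv_comp_smul (𝕜 := ℝ) (f := fun y => w (-(r⁻¹ • x0) + y)) (c := r⁻¹) (x := x)
    rw [fderiv_comp_add_left] at h
    exact h
  have hc : ContinuousOn (fun x => w (-(r⁻¹ • x0) + r⁻¹ • x)) (Metric.closedBall x0 r) :=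
    hwc.comp (by fun_prop) hcb
  refine ⟨fun x => w (-(r⁻¹ • x0) + r⁻¹ • x), hc, ?_, ?_⟩
  · intro y hy
    rw [mem_sphere_iff_norm] at hy
    have := hws (-(r⁻¹ • x0) + r⁻¹ • y) (by rw [mem_sphere_zero_iff_norm, hn, hy, div_self hr.ne'])
    rw [hinv] at this
    exact this
  · obtain ⟨M, hM⟩ := (isCompact_closedBall x0 r).exists_bound_of_continuousOn hc
    refine nl_reg hN hα hα1 Metric.isOpen_ball hH (M := M)
      (fun y hy => hM y (Metric.ball_subset_closedBall hy)) ?_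
    refine (hwg.scale (T := Metric.ball x0 r) (-(r⁻¹ • x0)) r⁻¹ hb).congr (fun _ _ => rfl) ?_
    intro y hy
    simp only [hinv, hfd]
    rw [norm_smul, norm_inv, Real.norm_of_nonneg hr.le, inv_mul_eq_div, ← mul_assoc]
    field_simp

end

section

open Set Filter MeasureTheory
open scoped Topology ContDiff

variable {N : ℕ}

/-- Continuous viscosity subsolutions. -/
def ViscSub (H : Eu N → ℝ → ℝ → ℝ) (S : Set (Eu N)) (v : Eu N → ℝ) : Prop :=
  ∀ x ∈ S, ∀ φ : Eu N → ℝ, ContDiffAt ℝ 2 φ x → IsLocalMax (fun y => v y - φ y) x →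
    H x (v x) ‖fderiv ℝ φ x‖ ≤ lap φ x

theorem vsub_of_c2_at {H : Eu N → ℝ → ℝ → ℝ} {v : Eu N → ℝ} {x : Eu N}
    (h2 : ContDiffAt ℝ 2 v x) (hl : H x (v x) ‖fderiv ℝ v x‖ ≤ lap v x) (φ : Eu N → ℝ)
    (hφ : ContDiffAt ℝ 2 φ x) (hm : IsLocalMax (fun y => v y - φ y) x) :
    H x (v x) ‖fderiv ℝ φ x‖ ≤ lap φ x := by
  have hm' : IsLocalMax (fun y => v y - φ y) x := hm
  obtain ⟨h1, h3⟩ := localMax_lap (h2.sub hφ) hm'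
  rw [lap_sub h2 hφ] at h3
  rw [fderiv_fun_sub (h2.differentiableAt two_ne_zero) (hφ.differentiableAt two_ne_zero),
    sub_eq_zero] at h1
  rw [← h1]; linarith

/-- Strict monotonicity of the nonlinearity. -/
def SMono (H : Eu N → ℝ → ℝ → ℝ) (S : Set (Eu N)) : Prop :=
  ∀ x ∈ S, ∀ s t q : ℝ, 0 ≤ q → s < t → H x s q < H x t q

theorem SMono.le {H : Eu N → ℝ → ℝ → ℝ} {S : Set (Eu N)} (h : SMono H S) {x : Eu N} (hx : x ∈ S)
    {s t q : ℝ} (hq : 0 ≤ q) (hst : s ≤ t) : H x s q ≤ H x t q := by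
  rcases hst.eq_or_lt with rfl | h1
  · exact le_rfl
  · exact (h x hx s t q hq h1).le

theorem comparison {H : Eu N → ℝ → ℝ → ℝ} {x0 : Eu N} {r m : ℝ} (hr : 0 < r)
    (hH : SMono H (Metric.ball x0 r)) {v w : Eu N → ℝ}
    (hv : ContinuousOn v (Metric.closedBall x0 r)) (hvs : ViscSub H (Metric.ball x0 r) v)
    (hw : ContinuousOn w (Metric.closedBall x0 r))
    (hw2 : ∀ x ∈ Metric.ball x0 r, ContDiffAt ℝ 2 w x)
    (hwl : ∀ x ∈ Metric.ball x0 r, lap w x ≤ H x (max (w x) m) ‖fderiv ℝ w x‖)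
    (hvm : ∀ x ∈ Metric.ball x0 r, m < v x)
    (hb : ∀ x ∈ Metric.sphere x0 r, v x ≤ w x) :
    ∀ x ∈ Metric.closedBall x0 r, v x ≤ w x := by
  intro z hz
  by_contra hlt
  push Not at hlt
  have hzb : z ∈ Metric.ball x0 r := by
    rw [Metric.mem_closedBall] at hz
    rw [Metric.mem_ball]
    refine lt_of_le_of_ne hz fun h => ?_
    exact absurd (hb z h) (not_le.2 hlt)
  obtain ⟨x, hx, h1, h2⟩ := exists_interior_max (U := Metric.ball x0 r) Metric.isBounded_ball
    Metric.isOpen_ball (v := fun y => v y - w y) (κ := 0)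
    (by rw [closure_ball x0 hr.ne']; exact hv.sub hw)
    (by rw [frontier_ball x0 hr.ne']; intro y hy; linarith [hb y hy]) hzb (by linarith)
  have h3 := hvs x hx w (hw2 x hx) h2
  have h4 := hwl x hx
  have h5 := hH x hx (max (w x) m) (v x) ‖fderiv ℝ w x‖ (norm_nonneg _)
    (max_lt (by linarith) (hvm x hx))
  linarith

theorem NL.mono {S T : Set (Eu N)} {H : Eu N → ℝ → ℝ → ℝ} {A L Hc α : ℝ} (h : NL S H A L Hc α)
    (hT : T ⊆ S) : NL T H A L Hc α :=
  ⟨h.A0, h.L0, h.H0, fun x hx => h.bdd x (hT hx), fun x hx => h.lip x (hT hx),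
    fun x hx y hy => h.hol x (hT hx) y (hT hy)⟩

/-- A ball on which the truncated problem is solvable. -/
def GoodBall (H : Eu N → ℝ → ℝ → ℝ) (w0 : Eu N → ℝ) (Ω : Set (Eu N)) (α : ℝ) (x : Eu N)
    (r : ℝ) : Prop :=
  0 < r ∧ Metric.closedBall x r ⊆ Ω ∧ ∃ m A : ℝ, (∀ y ∈ Metric.closedBall x r, m < w0 y) ∧
    (∀ y ∈ Metric.ball x r, ∀ s q, 0 ≤ q → |H y (max s m) q| ≤ A) ∧
    ∀ r', 0 < r' → r' ≤ r → ∀ g : Eu N → ℝ, ContinuousOn g (Metric.closedBall x r') →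
    ∃ w : Eu N → ℝ, ContinuousOn w (Metric.closedBall x r') ∧
      (∀ y ∈ Metric.sphere x r', w y = g y) ∧
      ∀ y ∈ Metric.ball x r', ContDiffAt ℝ 2 w y ∧
        lap w y = H y (max (w y) m) ‖fderiv ℝ w y‖ ∧ LH α w y

/-- Classical supersolutions above `w0`. -/
def Super (H : Eu N → ℝ → ℝ → ℝ) (w0 : Eu N → ℝ) (Ω : Set (Eu N)) (Z : Eu N → ℝ) : Prop :=
  ∀ x ∈ Ω, ContDiffAt ℝ 2 Z x ∧ lap Z x ≤ H x (Z x) ‖fderiv ℝ Z x‖ ∧ w0 x ≤ Z x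

/-- Admissible iterates. -/
structure GoodFn (H : Eu N → ℝ → ℝ → ℝ) (w0 : Eu N → ℝ) (Ω : Set (Eu N)) (v : Eu N → ℝ) : Prop where
  cont : ContinuousOn v Ω
  sub : ViscSub H Ω v
  lower : ∀ x ∈ Ω, w0 x ≤ v x
  upper : ∀ Z, Super H w0 Ω Z → ∀ x ∈ Ω, v x ≤ Z x

theorem lift {H : Eu N → ℝ → ℝ → ℝ} {w0 : Eu N → ℝ} {Ω : Set (Eu N)} {α : ℝ}
    (hΩ : IsOpen Ω) (hH : SMono H Ω)
    {v : Eu N → ℝ} (hv : GoodFn H w0 Ω v) {x0 : Eu N} {r : ℝ} (hB : GoodBall H w0 Ω α x0 r) :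
    ∃ V : Eu N → ℝ, GoodFn H w0 Ω V ∧ (∀ x ∈ Ω, v x ≤ V x) ∧
      ∀ x ∈ Metric.ball x0 r, ContDiffAt ℝ 2 V x ∧ lap V x = H x (V x) ‖fderiv ℝ V x‖ := by
  classical
  obtain ⟨hr, hsub, m, A, hm, hA, hsol⟩ := hB
  have hbs : Metric.ball x0 r ⊆ Ω := Metric.ball_subset_closedBall.trans hsub
  obtain ⟨w, hwc, hws, hw⟩ := hsol r hr le_rfl v (hv.cont.mono hsub)
  have hHb : SMono H (Metric.ball x0 r) := fun x hx => hH x (hbs hx)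
  have hvw : ∀ x ∈ Metric.closedBall x0 r, v x ≤ w x :=
    comparison (m := m) hr hHb (hv.cont.mono hsub) (fun x hx => hv.sub x (hbs hx)) hwc
      (fun x hx => (hw x hx).1) (fun x hx => (hw x hx).2.1.le)
      (fun x hx => (hm x (Metric.ball_subset_closedBall hx)).trans_le (hv.lower x (hbs hx)))
      (fun x hx => (hws x hx).ge)
  have hwm : ∀ x ∈ Metric.closedBall x0 r, m < w x := fun x hx =>
    (hm x hx).trans_le ((hv.lower x (hsub hx)).trans (hvw x hx))
  have hwl : ∀ x ∈ Metric.ball x0 r, lap w x = H x (w x) ‖fderiv ℝ w x‖ := fun x hx => by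
    rw [(hw x hx).2.1, max_eq_left (hwm x (Metric.ball_subset_closedBall hx)).le]
  let V : Eu N → ℝ := (Metric.ball x0 r).piecewise w v
  have hVin : ∀ x ∈ Metric.ball x0 r, V x = w x := fun x hx => Set.piecewise_eq_of_mem _ _ _ hx
  have hVout : ∀ x, x ∉ Metric.ball x0 r → V x = v x := fun x hx =>
    Set.piecewise_eq_of_notMem _ _ _ hx
  have hVev : ∀ x ∈ Metric.ball x0 r, V =ᶠ[𝓝 x] w := fun x hx => by
    filter_upwards [Metric.isOpen_ball.mem_nhds hx] with y hy using hVin y hy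
  have hvV : ∀ x, v x ≤ V x := fun x => by
    by_cases hx : x ∈ Metric.ball x0 r
    · rw [hVin x hx]; exact hvw x (Metric.ball_subset_closedBall hx)
    · rw [hVout x hx]
  have hVc2 : ∀ x ∈ Metric.ball x0 r, ContDiffAt ℝ 2 V x ∧ lap V x = H x (V x) ‖fderiv ℝ V x‖ := by
    intro x hx
    refine ⟨(hw x hx).1.congr_of_eventuallyEq (hVev x hx), ?_⟩
    rw [lap_congr (hVev x hx), (hVev x hx).fderiv_eq, hVin x hx, hwl x hx]
  refine ⟨V, ⟨?_, ?_, ?_, ?_⟩, fun x _ => hvV x, hVc2⟩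
  · refine ContinuousOn.piecewise ?_ ?_ ?_
    · rw [frontier_ball x0 hr.ne']; exact fun y hy => hws y hy.2
    · rw [closure_ball x0 hr.ne']; exact hwc.mono inter_subset_right
    · exact hv.cont.mono inter_subset_left
  · intro x hx φ hφ hmax
    by_cases hxb : x ∈ Metric.ball x0 r
    · exact vsub_of_c2_at (hVc2 x hxb).1 (hVc2 x hxb).2.ge φ hφ hmax
    · rw [hVout x hxb]
      refine hv.sub x hx φ hφ ?_
      have h1 : ∀ᶠ y in 𝓝 x, V y - φ y ≤ V x - φ x := hmax
      show ∀ᶠ y in 𝓝 x, v y - φ y ≤ v x - φ x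
      filter_upwards [h1] with y hy
      rw [hVout x hxb] at hy
      linarith [hvV y]
  · exact fun x hx => (hv.lower x hx).trans (hvV x)
  · intro Z hZ x hx
    by_cases hxb : x ∈ Metric.ball x0 r
    · rw [hVin x hxb]
      refine comparison (m := m) hr hHb hwc (fun y hy φ hφ h => vsub_of_c2_at (hw y hy).1 (hwl y hy).ge φ hφ h)
        (fun y hy => (hZ y (hsub hy)).1.continuousAt.continuousWithinAt)
        (fun y hy => (hZ y (hbs hy)).1) (fun y hy => (hZ y (hbs hy)).2.1.trans
          (hHb.le hy (norm_nonneg _) (le_max_left _ _)))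
        (fun y hy => hwm y (Metric.ball_subset_closedBall hy))
        (fun y hy => ?_) x (Metric.ball_subset_closedBall hxb)
      rw [hws y hy]
      exact hv.upper Z hZ y (hsub (Metric.sphere_subset_closedBall hy))
    · rw [hVout x hxb]; exact hv.upper Z hZ x hx

theorem perron (hN : 0 < N) {H : Eu N → ℝ → ℝ → ℝ} {w0 : Eu N → ℝ} {Ω : Set (Eu N)} {α : ℝ}
    (hΩ : IsOpen Ω) (hne : Ω.Nonempty) (hH : SMono H Ω)
    (hw0 : ∀ x ∈ Ω, ContDiffAt ℝ 2 w0 x ∧ H x (w0 x) ‖fderiv ℝ w0 x‖ ≤ lap w0 x)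
    {Z0 : Eu N → ℝ} (hZ0 : Super H w0 Ω Z0)
    (hball : ∀ x ∈ Ω, ∃ r, GoodBall H w0 Ω α x r) :
    ∃ u : Eu N → ℝ, (∀ x ∈ Ω, ContDiffAt ℝ 2 u x ∧ lap u x = H x (u x) ‖fderiv ℝ u x‖ ∧ LH α u x) ∧
      (∀ x ∈ Ω, w0 x ≤ u x) ∧ ∀ Z, Super H w0 Ω Z → ∀ x ∈ Ω, u x ≤ Z x := by
  -- the cover
  have hr' : ∀ x, ∃ r, x ∈ Ω → GoodBall H w0 Ω α x r := fun x => by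
    by_cases hx : x ∈ Ω
    · obtain ⟨r, h⟩ := hball x hx
      exact ⟨r, fun _ => h⟩
    · exact ⟨0, fun h => absurd h hx⟩
  choose r hr using hr'
  obtain ⟨t, htΩ, htc, htcov⟩ := TopologicalSpace.countable_cover_nhdsWithin
    (f := fun x => Metric.ball x (r x / 2)) (s := Ω)
    (fun x hx => mem_nhdsWithin_of_mem_nhds (Metric.ball_mem_nhds x (half_pos (hr x hx).1)))
  have htne : t.Nonempty := by
    obtain ⟨x, hx⟩ := hne
    obtain ⟨y, hy, -⟩ := mem_iUnion₂.1 (htcov hx)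
    exact ⟨y, hy⟩
  obtain ⟨p, hp⟩ := htc.exists_eq_range htne
  have hpΩ : ∀ j, p j ∈ Ω := fun j => htΩ (hp ▸ mem_range_self j)
  have hpB : ∀ j, GoodBall H w0 Ω α (p j) (r (p j)) := fun j => hr _ (hpΩ j)
  -- the start
  have hstart : GoodFn H w0 Ω w0 :=
    ⟨fun x hx => (hw0 x hx).1.continuousAt.continuousWithinAt,
      fun x hx φ hφ h => vsub_of_c2_at (hw0 x hx).1 (hw0 x hx).2 φ hφ h,
      fun _ _ => le_rfl, fun Z hZ x hx => (hZ x hx).2.2⟩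
  choose Lf hL1 hL2 hL3 using fun (v : {v // GoodFn H w0 Ω v}) (j : ℕ) =>
    lift hΩ hH v.2 (hpB j)
  let S : ℕ → {v // GoodFn H w0 Ω v} := fun k => Nat.rec ⟨w0, hstart⟩
    (fun k v => ⟨Lf v (Nat.unpair k).1, hL1 v (Nat.unpair k).1⟩) k
  have hSstep : ∀ k, (S (k + 1)).1 = Lf (S k) (Nat.unpair k).1 := fun k => rfl
  set V : ℕ → Eu N → ℝ := fun k => (S k).1 with hV
  have hVgood : ∀ k, GoodFn H w0 Ω (V k) := fun k => (S k).2
  have hVmono : ∀ x ∈ Ω, Monotone (fun k => V k x) := fun x hx => monotone_nat_of_le_succ fun k => by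
    simp only [hV]; rw [hSstep]; exact hL2 (S k) _ x hx
  have hVsol : ∀ k, ∀ x ∈ Metric.ball (p (Nat.unpair k).1) (r (p (Nat.unpair k).1)),
      ContDiffAt ℝ 2 (V (k + 1)) x ∧
      lap (V (k + 1)) x = H x (V (k + 1) x) ‖fderiv ℝ (V (k + 1)) x‖ := fun k => by
    simp only [hV]; rw [hSstep]; exact hL3 (S k) _
  have hfreq : ∀ j n : ℕ, ∃ k ≥ n, (Nat.unpair k).1 = j := fun j n =>
    ⟨Nat.pair j n, Nat.right_le_pair j n, by rw [Nat.unpair_pair]⟩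
  have hVZ : ∀ k, ∀ x ∈ Ω, V k x ≤ Z0 x := fun k => (hVgood k).upper Z0 hZ0
  set u : Eu N → ℝ := fun x => ⨆ k, V k x with hu
  have hbdd : ∀ x ∈ Ω, BddAbove (range fun k => V k x) := fun x hx =>
    ⟨Z0 x, by rintro _ ⟨k, rfl⟩; exact hVZ k x hx⟩
  have hut : ∀ x ∈ Ω, Tendsto (fun k => V k x) atTop (𝓝 (u x)) := fun x hx =>
    tendsto_atTop_ciSup (hVmono x hx) (hbdd x hx)
  have hVu : ∀ k, ∀ x ∈ Ω, V k x ≤ u x := fun k x hx => le_ciSup (hbdd x hx) k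
  have hw0u : ∀ x ∈ Ω, w0 x ≤ u x := fun x hx => ((hVgood 0).lower x hx).trans (hVu 0 x hx)
  refine ⟨u, fun x hx => ?_, hw0u, fun Z hZ x hx => ciSup_le fun k => (hVgood k).upper Z hZ x hx⟩
  obtain ⟨y, hy, hxy⟩ := mem_iUnion₂.1 (htcov hx)
  rw [hp] at hy
  obtain ⟨j, rfl⟩ := hy
  obtain ⟨hρ, hsub, m, A, hm, hA, hsol⟩ := hpB j
  set x0 := p j with hx0
  set ρ := r x0 with hρdef
  have hbs : Metric.ball x0 ρ ⊆ Ω := Metric.ball_subset_closedBall.trans hsub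
  have hcs : Metric.closedBall x0 (ρ / 2) ⊆ Metric.ball x0 ρ :=
    Metric.closedBall_subset_ball (by linarith)
  have hcc : Metric.closedBall x0 (ρ / 2) ⊆ Ω := hcs.trans hbs
  have hHb : SMono H (Metric.ball x0 (ρ / 2)) := fun z hz =>
    hH z (hcc (Metric.ball_subset_closedBall hz))
  -- uniform bound
  obtain ⟨M1, hM1⟩ := (isCompact_closedBall x0 ρ).exists_bound_of_continuousOn
    (f := w0) (fun y hy => (hw0 y (hsub hy)).1.continuousAt.continuousWithinAt)
  obtain ⟨M2, hM2⟩ := (isCompact_closedBall x0 ρ).exists_bound_of_continuousOn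
    (f := Z0) (fun y hy => (hZ0 y (hsub hy)).1.continuousAt.continuousWithinAt)
  have hVb : ∀ k, ∀ y ∈ Metric.closedBall x0 ρ, |V k y| ≤ max M1 M2 := by
    intro k y hy
    have h1 := abs_le.1 (hM1 y hy)
    have h2 := abs_le.1 (hM2 y hy)
    rw [abs_le]
    constructor
    · linarith [(hVgood k).lower y (hsub hy), le_max_left M1 M2]
    · linarith [hVZ k y (hsub hy), le_max_right M1 M2]
  have hVm : ∀ k, ∀ y ∈ Metric.closedBall x0 ρ, m < V k y := fun k y hy =>
    (hm y hy).trans_le ((hVgood k).lower y (hsub hy))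
  obtain ⟨C, hC, hgr⟩ := gsol_c1 N
  set K := C * (max M1 M2 / (ρ / 4) + ρ / 4 * A) with hK
  have hVlip : ∀ k, (Nat.unpair k).1 = j → ∀ y ∈ Metric.closedBall x0 (ρ / 2),
      ∀ z ∈ Metric.closedBall x0 (ρ / 2), |V (k + 1) y - V (k + 1) z| ≤ K * ‖y - z‖ := by
    intro k hk
    have hs := hVsol k
    rw [hk] at hs
    have hG : GSol (Metric.ball x0 ρ) (V (k + 1)) (lap (V (k + 1))) := GSol.of_c2 fun y hy => (hs y hy).1
    have hbd : ∀ y ∈ Metric.closedBall x0 (ρ / 2), DifferentiableAt ℝ (V (k + 1)) y ∧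
        ‖fderiv ℝ (V (k + 1)) y‖ ≤ K := by
      intro y hy
      have hsub4 : Metric.closedBall y (ρ / 4) ⊆ Metric.ball x0 ρ := by
        refine (Metric.closedBall_subset_closedBall' (ε₂ := 3 * ρ / 4) ?_).trans
          (Metric.closedBall_subset_ball (by linarith))
        rw [Metric.mem_closedBall] at hy; linarith
      refine hgr _ _ _ hG y (ρ / 4) A (max M1 M2) (by linarith) hsub4
        (fun z hz => hVb (k + 1) z (Metric.ball_subset_closedBall (hsub4 hz))) (fun z hz => ?_)
      rw [(hs z (hsub4 hz)).2]
      have := hA z (hsub4 hz) (V (k + 1) z) _ (norm_nonneg (fderiv ℝ (V (k + 1)) z))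
      rwa [max_eq_left (hVm (k + 1) z (Metric.ball_subset_closedBall (hsub4 hz))).le] at this
    exact fun y hy z hz => (convex_closedBall x0 (ρ / 2)).norm_image_sub_le_of_norm_fderiv_le
      (𝕜 := ℝ) (fun t ht => (hbd t ht).1) (fun t ht => (hbd t ht).2) hz hy
  have hulip : ∀ y ∈ Metric.closedBall x0 (ρ / 2), ∀ z ∈ Metric.closedBall x0 (ρ / 2),
      |u y - u z| ≤ K * ‖y - z‖ := by
    intro y hy z hz
    have ht := ((hut y (hcc hy)).sub (hut z (hcc hz))).abs
    refine le_of_tendsto_of_frequently ht ?_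
    rw [frequently_atTop]
    intro n
    obtain ⟨k, hkn, hkj⟩ := hfreq j n
    exact ⟨k + 1, by omega, hVlip k hkj y hy z hz⟩
  have huc : ContinuousOn u (Metric.closedBall x0 (ρ / 2)) := by
    have : LipschitzOnWith (Real.toNNReal K) u (Metric.closedBall x0 (ρ / 2)) := by
      refine LipschitzOnWith.of_dist_le_mul fun y hy z hz => ?_
      rw [Real.dist_eq, dist_eq_norm]
      exact (hulip y hy z hz).trans
        (mul_le_mul_of_nonneg_right (Real.le_coe_toNNReal K) (norm_nonneg _))
    exact this.continuousOn
  have hunif : TendstoUniformlyOn V u atTop (Metric.closedBall x0 (ρ / 2)) :=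
    Monotone.tendstoUniformlyOn_of_forall_tendsto (isCompact_closedBall _ _)
      (fun k => (hVgood k).cont.mono hcc) (fun y hy => hVmono y (hcc hy)) huc
      (fun y hy => hut y (hcc hy))
  obtain ⟨w, hwc, hws, hw⟩ := hsol (ρ / 2) (by linarith) (by linarith) u huc
  have huw : ∀ y ∈ Metric.closedBall x0 (ρ / 2), u y ≤ w y := by
    intro y hy
    refine ciSup_le fun k => ?_
    refine comparison (m := m) (half_pos hρ) hHb ((hVgood k).cont.mono hcc)
      (fun z hz => (hVgood k).sub z (hcc (Metric.ball_subset_closedBall hz))) hwc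
      (fun z hz => (hw z hz).1) (fun z hz => (hw z hz).2.1.le)
      (fun z hz => hVm k z (Metric.ball_subset_closedBall (hcs (Metric.ball_subset_closedBall hz))))
      (fun z hz => ?_) y hy
    rw [hws z hz]; exact hVu k z (hcc (Metric.sphere_subset_closedBall hz))
  have hwm : ∀ y ∈ Metric.closedBall x0 (ρ / 2), m < w y := fun y hy =>
    (hm y (Metric.ball_subset_closedBall (hcs hy))).trans_le ((hw0u y (hcc hy)).trans (huw y hy))
  have hwl : ∀ y ∈ Metric.ball x0 (ρ / 2), lap w y = H y (w y) ‖fderiv ℝ w y‖ := fun y hy => by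
    rw [(hw y hy).2.1, max_eq_left (hwm y (Metric.ball_subset_closedBall hy)).le]
  have hwu : ∀ y ∈ Metric.closedBall x0 (ρ / 2), w y ≤ u y := by
    intro y hy
    refine le_of_forall_pos_le_add fun ε hε => ?_
    obtain ⟨n, hn⟩ := eventually_atTop.1 (Metric.tendstoUniformlyOn_iff.1 hunif ε hε)
    obtain ⟨k, hkn, hkj⟩ := hfreq j n
    have hs := hVsol k
    rw [hkj] at hs
    have hcomp := comparison (m := m) (w := fun z => V (k + 1) z + ε) (half_pos hρ) hHb hwc
      (fun z hz φ hφ h => vsub_of_c2_at (hw z hz).1 (hwl z hz).ge φ hφ h)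
      (((hVgood (k + 1)).cont.mono hcc).add continuousOn_const)
      (fun z hz => (hs z (hcs (Metric.ball_subset_closedBall hz))).1.add contDiffAt_const)
      (fun z hz => by
        have hz' := hs z (hcs (Metric.ball_subset_closedBall hz))
        rw [lap_add hz'.1 contDiffAt_const, lap_const, add_zero, fderiv_add_const, hz'.2]
        exact hHb.le hz (norm_nonneg _) (le_max_of_le_left (by linarith)))
      (fun z hz => hwm z (Metric.ball_subset_closedBall hz))
      (fun z hz => by
        rw [hws z hz]
        have := hn (k + 1) (by omega) z (Metric.sphere_subset_closedBall hz)
        rw [Real.dist_eq] at this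
        linarith [(abs_lt.1 this).2]) y hy
    exact hcomp.trans (by linarith [hVu (k + 1) y (hcc hy)])
  have hev : u =ᶠ[𝓝 x] w := by
    filter_upwards [Metric.isOpen_ball.mem_nhds hxy] with y hy
    exact le_antisymm (huw y (Metric.ball_subset_closedBall hy))
      (hwu y (Metric.ball_subset_closedBall hy))
  refine ⟨(hw x hxy).1.congr_of_eventuallyEq hev, ?_, ?_⟩
  · rw [lap_congr hev, hev.fderiv_eq, hev.self_of_nhds, hwl x hxy]
  · obtain ⟨ρ1, C1, hρ1, hC1, hD⟩ := (hw x hxy).2.2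
    obtain ⟨ρ2, hρ2, hball2⟩ := Metric.eventually_nhds_iff_ball.1 hev.eventually_nhds
    have hD2 : ∀ y ∈ Metric.ball x ρ2, D2 u y = D2 w y := fun y hy => by
      have : u =ᶠ[𝓝 y] w := hball2 y hy
      exact this.fderiv.fderiv_eq
    refine ⟨min ρ1 ρ2, C1, lt_min hρ1 hρ2, hC1, fun y hy z hz => ?_⟩
    rw [hD2 y (Metric.ball_subset_ball (min_le_right _ _) hy),
      hD2 z (Metric.ball_subset_ball (min_le_right _ _) hz)]
    exact hD y (Metric.ball_subset_ball (min_le_left _ _) hy) z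
      (Metric.ball_subset_ball (min_le_left _ _) hz)

end

section

open Set Filter MeasureTheory
open scoped Topology ContDiff

variable {N : ℕ}

/-- The truncated nonlinearity. -/
noncomputable def Hf (a b g : Eu N → ℝ) (x : Eu N) (s q : ℝ) : ℝ :=
  b x * (min q (g x)⁻¹) ^ 2 - a x * Real.exp (-s)

theorem abs_sq_sub_le {p q R : ℝ} (hp : 0 ≤ p) (hq : 0 ≤ q) (hpR : p ≤ R) (hqR : q ≤ R) :
    |q ^ 2 - p ^ 2| ≤ 2 * R * |q - p| := by
  rw [show q ^ 2 - p ^ 2 = (q + p) * (q - p) by ring, abs_mul, abs_of_nonneg (by linarith)]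
  exact mul_le_mul_of_nonneg_right (by linarith) (abs_nonneg _)

theorem abs_min_sub_min_le_abs' (p q c : ℝ) : |min p c - min q c| ≤ |p - q| := by
  have := abs_min_sub_min_le_max p c q c
  simpa using this

theorem exp_max_lip (m s t : ℝ) :
    |Real.exp (-max s m) - Real.exp (-max t m)| ≤ Real.exp (-m) * |s - t| := by
  have key : ∀ s t : ℝ, Real.exp (-max s m) - Real.exp (-max t m) ≤ Real.exp (-m) * |s - t| := by
    intro s t
    have h1 : Real.exp (-max s m) - Real.exp (-max t m) =
        Real.exp (-max s m) * (1 - Real.exp (-(max t m - max s m))) := by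
      rw [mul_sub, ← Real.exp_add]; ring_nf
    have h2 : 1 - Real.exp (-(max t m - max s m)) ≤ max t m - max s m := by
      linarith [Real.add_one_le_exp (-(max t m - max s m))]
    have h3 : max t m - max s m ≤ |s - t| := by
      have := abs_max_sub_max_le_abs t s m
      rw [abs_sub_comm s t]; exact (le_abs_self _).trans this
    have h4 : Real.exp (-max s m) ≤ Real.exp (-m) :=
      Real.exp_le_exp.2 (by linarith [le_max_right s m])
    rw [h1]
    calc _ ≤ Real.exp (-max s m) * |s - t| :=
          mul_le_mul_of_nonneg_left (h2.trans h3) (Real.exp_pos _).le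
      _ ≤ _ := mul_le_mul_of_nonneg_right h4 (abs_nonneg _)
  rw [abs_le]
  refine ⟨?_, key s t⟩
  have := key t s
  rw [abs_sub_comm] at this
  linarith

/-- Standing assumptions on the data. -/
structure Data (Ω : Set (Eu N)) (a b : Eu N → ℝ) (a0 A B Ca Cb α : ℝ) : Prop where
  a0p : 0 < a0
  B1 : 1 ≤ B
  Ca0 : 0 ≤ Ca
  Cb0 : 0 ≤ Cb
  al0 : 0 < α
  al1 : α < 1
  alo : ∀ x ∈ Ω, a0 ≤ a x
  ahi : ∀ x ∈ Ω, a x ≤ A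
  blo : ∀ x ∈ Ω, -1 ≤ b x
  bhi : ∀ x ∈ Ω, b x ≤ B
  ahol : ∀ x ∈ Ω, ∀ y ∈ Ω, |a x - a y| ≤ Ca * ‖x - y‖ ^ α
  bhol : ∀ x ∈ Ω, ∀ y ∈ Ω, |b x - b y| ≤ Cb * ‖x - y‖ ^ α

theorem Hf_goodBall (hN : 0 < N) {Ω : Set (Eu N)} (hΩ : IsOpen Ω) {a b g : Eu N → ℝ}
    {a0 A B Ca Cb α : ℝ} (hd : Data Ω a b a0 A B Ca Cb α)
    (hg : ∀ x ∈ Ω, 0 < g x) (hgl : ∀ x y, |g x - g y| ≤ ‖x - y‖)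
    {w0 : Eu N → ℝ} (hw0 : ∀ x ∈ Ω, ContDiffAt ℝ 2 w0 x) :
    ∀ x ∈ Ω, ∃ r, GoodBall (Hf a b g) w0 Ω α x r := by
  intro x hx
  obtain ⟨ε0, hε0, hsolve⟩ := nl_solve (N := N) hN
  have hA : 0 < A := hd.a0p.trans_le ((hd.alo x hx).trans (hd.ahi x hx))
  have hB := hd.B1
  obtain ⟨m, hm⟩ : ∃ m, m = w0 x - 1 := ⟨_, rfl⟩
  have hev : ∀ᶠ y in 𝓝 x, m < w0 y ∧ y ∈ Ω :=
    ((hw0 x hx).continuousAt.eventually (lt_mem_nhds (by linarith))).and (hΩ.mem_nhds hx)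
  obtain ⟨r1, hr1, hball⟩ := Metric.eventually_nhds_iff_ball.1 hev
  obtain ⟨G, hG⟩ : ∃ G, G = g x / 2 := ⟨_, rfl⟩
  have hG0 : 0 < G := by have := hg x hx; linarith
  obtain ⟨R, hR⟩ : ∃ R, R = G⁻¹ := ⟨_, rfl⟩
  have hR0 : 0 < R := by rw [hR]; positivity
  obtain ⟨L, hL⟩ : ∃ L, L = 2 * B * R + A * Real.exp (-m) := ⟨_, rfl⟩
  have hL0 : 0 < L := by rw [hL]; have := Real.exp_pos (-m); positivity
  obtain ⟨r, hr⟩ : ∃ r, r = min (min (r1 / 2) (1 / 2)) (min G (ε0 / L)) := ⟨_, rfl⟩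
  have hr0 : 0 < r := by rw [hr]; positivity
  have hrr1 : r < r1 := by
    have : r ≤ r1 / 2 := by rw [hr]; exact (min_le_left _ _).trans (min_le_left _ _)
    linarith
  have hrh : r ≤ 1 / 2 := by rw [hr]; exact (min_le_left _ _).trans (min_le_right _ _)
  have hrG : r ≤ G := by rw [hr]; exact (min_le_right _ _).trans (min_le_left _ _)
  have hrL : r * L ≤ ε0 := by
    have : r ≤ ε0 / L := by rw [hr]; exact (min_le_right _ _).trans (min_le_right _ _)
    rwa [le_div_iff₀ hL0] at this
  have hcb : ∀ y ∈ Metric.closedBall x r, m < w0 y ∧ y ∈ Ω := fun y hy =>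
    hball y (Metric.closedBall_subset_ball hrr1 hy)
  have hbΩ : ∀ y ∈ Metric.ball x r, y ∈ Ω := fun y hy => (hcb y (Metric.ball_subset_closedBall hy)).2
  have hgy : ∀ y ∈ Metric.ball x r, G ≤ g y := fun y hy => by
    have h1 := (abs_le.1 (hgl y x)).1
    rw [mem_ball_iff_norm] at hy
    linarith
  have hRy : ∀ y ∈ Metric.ball x r, (g y)⁻¹ ≤ R := fun y hy => by
    rw [hR]; exact inv_anti₀ hG0 (hgy y hy)
  have hRy0 : ∀ y ∈ Metric.ball x r, 0 ≤ (g y)⁻¹ := fun y hy =>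
    inv_nonneg.2 (hG0.le.trans (hgy y hy))
  have hRl : ∀ y ∈ Metric.ball x r, ∀ z ∈ Metric.ball x r,
      |(g y)⁻¹ - (g z)⁻¹| ≤ R ^ 2 * ‖y - z‖ := by
    intro y hy z hz
    have h1 := hG0.trans_le (hgy y hy)
    have h2 := hG0.trans_le (hgy z hz)
    have : (g y)⁻¹ - (g z)⁻¹ = (g y)⁻¹ * (g z)⁻¹ * (g z - g y) := by field_simp
    rw [this, abs_mul, abs_of_nonneg (by positivity), abs_sub_comm, sq]
    exact mul_le_mul (mul_le_mul (hRy y hy) (hRy z hz) (hRy0 z hz) hR0.le) (hgl y z)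
      (abs_nonneg _) (by positivity)
  have hbabs : ∀ y ∈ Metric.ball x r, |b y| ≤ B := fun y hy =>
    abs_le.2 ⟨by linarith [hd.blo y (hbΩ y hy)], hd.bhi y (hbΩ y hy)⟩
  have haabs : ∀ y ∈ Metric.ball x r, |a y| ≤ A := fun y hy =>
    abs_le.2 ⟨by linarith [hd.alo y (hbΩ y hy), hd.a0p], hd.ahi y (hbΩ y hy)⟩
  have hmin0 : ∀ y ∈ Metric.ball x r, ∀ q, 0 ≤ q → 0 ≤ min q (g y)⁻¹ := fun y hy q hq =>
    le_min hq (hRy0 y hy)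
  have hminR : ∀ y ∈ Metric.ball x r, ∀ q, min q (g y)⁻¹ ≤ R := fun y hy q =>
    (min_le_right _ _).trans (hRy y hy)
  have hsq : ∀ y ∈ Metric.ball x r, ∀ q, 0 ≤ q → |(min q (g y)⁻¹) ^ 2| ≤ R ^ 2 := fun y hy q hq => by
    rw [abs_of_nonneg (sq_nonneg _)]
    exact pow_le_pow_left₀ (hmin0 y hy q hq) (hminR y hy q) 2
  have hexp : ∀ s, |Real.exp (-max s m)| ≤ Real.exp (-m) := fun s => by
    rw [abs_of_pos (Real.exp_pos _)]
    exact Real.exp_le_exp.2 (by linarith [le_max_right s m])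
  have he0 := Real.exp_pos (-m)
  have hNL : NL (Metric.ball x r) (fun y s q => Hf a b g y (max s m) q)
      (B * R ^ 2 + A * Real.exp (-m)) L
      (Cb * R ^ 2 + B * (2 * R * R ^ 2) + Ca * Real.exp (-m)) α := by
    refine ⟨by positivity, hL0.le, by have := hd.Ca0; have := hd.Cb0; positivity, ?_, ?_, ?_⟩
    · intro y hy s q hq
      unfold Hf
      refine (abs_sub _ _).trans ?_
      rw [abs_mul, abs_mul]
      exact add_le_add (mul_le_mul (hbabs y hy) (hsq y hy q hq) (abs_nonneg _) (by linarith))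
        (mul_le_mul (haabs y hy) (hexp s) (abs_nonneg _) hA.le)
    · intro y hy s q t p hq hp
      unfold Hf
      have e : b y * min q (g y)⁻¹ ^ 2 - a y * Real.exp (-max s m) -
          (b y * min p (g y)⁻¹ ^ 2 - a y * Real.exp (-max t m)) =
          b y * (min q (g y)⁻¹ ^ 2 - min p (g y)⁻¹ ^ 2) -
          a y * (Real.exp (-max s m) - Real.exp (-max t m)) := by ring
      rw [e]
      refine (abs_sub _ _).trans ?_
      rw [abs_mul, abs_mul]
      have h1 := (abs_sq_sub_le (hmin0 y hy p hp) (hmin0 y hy q hq) (hminR y hy p) (hminR y hy q)).trans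
        (mul_le_mul_of_nonneg_left (abs_min_sub_min_le_abs' q p (g y)⁻¹) (by positivity))
      have h2 := exp_max_lip m s t
      have h3 := mul_le_mul (hbabs y hy) h1 (abs_nonneg _) (by linarith)
      have h4 := mul_le_mul (haabs y hy) h2 (abs_nonneg _) hA.le
      refine (add_le_add h3 h4).trans ?_
      rw [hL]
      have p1 := mul_nonneg (by positivity : 0 ≤ 2 * B * R) (abs_nonneg (s - t))
      have p2 := mul_nonneg (by positivity : 0 ≤ A * Real.exp (-m)) (abs_nonneg (q - p))
      nlinarith
    · intro y hy z hz s q hq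
      unfold Hf
      have e : b y * min q (g y)⁻¹ ^ 2 - a y * Real.exp (-max s m) -
          (b z * min q (g z)⁻¹ ^ 2 - a z * Real.exp (-max s m)) =
          (b y - b z) * min q (g y)⁻¹ ^ 2 + b z * (min q (g y)⁻¹ ^ 2 - min q (g z)⁻¹ ^ 2) -
          (a y - a z) * Real.exp (-max s m) := by ring
      rw [e]
      refine (abs_sub _ _).trans ((add_le_add (abs_add_le _ _) le_rfl).trans ?_)
      rw [abs_mul, abs_mul, abs_mul]
      have hle1 : ‖y - z‖ ≤ 1 := by
        rw [mem_ball_iff_norm] at hy hz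
        calc ‖y - z‖ = ‖(y - x) - (z - x)‖ := by congr 1; abel
          _ ≤ _ := norm_sub_le _ _
          _ ≤ 1 := by linarith
      have hpw : ‖y - z‖ ≤ ‖y - z‖ ^ α := by
        conv_lhs => rw [← Real.rpow_one ‖y - z‖]
        exact Real.rpow_le_rpow_of_exponent_ge_of_imp (norm_nonneg _) hle1 hd.al1.le
          (fun _ h => absurd h one_ne_zero)
      have h0 : |min q (g y)⁻¹ - min q (g z)⁻¹| ≤ R ^ 2 * ‖y - z‖ ^ α := by
        have := abs_min_sub_min_le_abs' (g y)⁻¹ (g z)⁻¹ q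
        rw [min_comm, min_comm _ q] at this
        exact this.trans ((hRl y hy z hz).trans (mul_le_mul_of_nonneg_left hpw (by positivity)))
      have h1 := (abs_sq_sub_le (hmin0 z hz q hq) (hmin0 y hy q hq) (hminR z hz q) (hminR y hy q)).trans
        (mul_le_mul_of_nonneg_left h0 (by positivity))
      have h2 := mul_le_mul (hd.bhol y (hbΩ y hy) z (hbΩ z hz)) (hsq y hy q hq) (abs_nonneg _)
        (mul_nonneg hd.Cb0 (by positivity))
      have h3 := mul_le_mul (hbabs z hz) h1 (abs_nonneg _) (by linarith)
      have h4 := mul_le_mul (hd.ahol y (hbΩ y hy) z (hbΩ z hz)) (hexp s) (abs_nonneg _)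
        (mul_nonneg hd.Ca0 (by positivity))
      refine (add_le_add (add_le_add h2 h3) h4).trans (le_of_eq ?_)
      ring
  refine ⟨r, hr0, fun y hy => (hcb y hy).2, m, _, fun y hy => (hcb y hy).1, hNL.bdd, ?_⟩
  intro r' hr' hr'r g' hg'
  refine hsolve _ _ L _ α r' x hd.al0 hd.al1 hr' (by linarith)
    (hNL.mono (Metric.ball_subset_ball hr'r)) ?_ g' hg'
  exact (mul_le_mul_of_nonneg_right hr'r hL0.le).trans hrL

/-- Barrier functions: positive supersolutions of the Poisson equation. -/
structure Barrier (Ω : Set (Eu N)) (A : ℝ) (W : Eu N → ℝ) : Prop where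
  cont : ContinuousOn W (closure Ω)
  c2 : ∀ x ∈ Ω, ContDiffAt ℝ 2 W x
  pos : ∀ x ∈ Ω, 0 < W x
  bd : ∀ x ∈ frontier Ω, 0 ≤ W x
  lapl : ∀ x ∈ Ω, lap W x ≤ -A

theorem lap_continuous {φ : Eu N → ℝ} (hφ : ContDiff ℝ ∞ φ) : Continuous (lap φ) := by
  unfold lap
  refine continuous_finsetSum _ fun i _ => ?_
  exact ((contDiff_dir hφ _).continuous_fderiv (by simp)).clm_apply continuous_const

theorem lap_log {u : Eu N → ℝ} {x : Eu N} (hu : ContDiffAt ℝ 2 u x) (hx : 0 < u x) :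
    lap (fun y => Real.log (u y)) x = lap u x / u x - ‖fderiv ℝ u x‖ ^ 2 / u x ^ 2 := by
  rw [lap_comp (γ := Real.log) (γ' := fun t => t⁻¹) (γ'' := -(u x ^ 2)⁻¹) hu
    (Real.contDiffAt_log.2 hx.ne') ?_ (hasDerivAt_inv hx.ne')]
  · field_simp; ring
  · filter_upwards [lt_mem_nhds hx] with t ht using Real.hasDerivAt_log ht.ne'

theorem fderiv_log_norm {u : Eu N → ℝ} {x : Eu N} (hu : ContDiffAt ℝ 2 u x) (hx : 0 < u x) :
    ‖fderiv ℝ (fun y => Real.log (u y)) x‖ = ‖fderiv ℝ u x‖ / u x := by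
  rw [fderiv.log (hu.differentiableAt two_ne_zero) hx.ne', norm_smul, norm_inv,
    Real.norm_of_nonneg hx.le, inv_mul_eq_div]

/-- The subsolution. -/
theorem exists_sub (hN : 0 < N) {Ω : Set (Eu N)} (hΩ : IsOpen Ω) (hΩb : Bornology.IsBounded Ω)
    {a0 A B : ℝ} (ha0 : 0 < a0) (haA : a0 ≤ A) (hB : 1 ≤ B) :
    ∃ w0 : Eu N → ℝ, (∀ x ∈ Ω, ContDiffAt ℝ 2 w0 x ∧
      B * ‖fderiv ℝ w0 x‖ ^ 2 - a0 * Real.exp (-w0 x) ≤ lap w0 x) ∧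
      ∀ W, Barrier Ω A W → ∀ x ∈ Ω, w0 x ≤ Real.log (W x) := by
  obtain ⟨φ, hsupp, hφ, hrange⟩ := hΩ.exists_contDiff_support_eq (n := ⊤)
  have hφ2 : ContDiff ℝ 2 φ := contDiff_infty.1 hφ 2
  have hφ0 : ∀ x, 0 ≤ φ x := fun x => (hrange (mem_range_self x)).1
  have hφ1 : ∀ x, φ x ≤ 1 := fun x => (hrange (mem_range_self x)).2
  have hφp : ∀ x ∈ Ω, 0 < φ x := fun x hx =>
    lt_of_le_of_ne (hφ0 x) (Ne.symm (by rw [← hsupp] at hx; exact hx))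
  have hφz : ∀ x ∈ frontier Ω, φ x = 0 := fun x hx => by
    rw [hΩ.frontier_eq] at hx
    by_contra h
    exact hx.2 (by rw [← hsupp]; exact h)
  have hK : IsCompact (closure Ω) := hΩb.isCompact_closure
  obtain ⟨M, hM⟩ := hK.exists_bound_of_continuousOn (f := fun x =>
    (4 * B + 2) * ‖fderiv ℝ φ x‖ ^ 2 + 2 * φ x * |lap φ x|) (by
      refine Continuous.continuousOn ?_
      have h1 : Continuous (fderiv ℝ φ) := hφ2.continuous_fderiv two_ne_zero
      have h2 := lap_continuous hφ
      have h3 := hφ2.continuous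
      fun_prop)
  have hM' : ∀ x ∈ Ω, (4 * B + 2) * ‖fderiv ℝ φ x‖ ^ 2 + 2 * φ x * |lap φ x| ≤ |M| := fun x hx =>
    (le_abs_self _).trans ((hM x (subset_closure hx)).trans (le_abs_self _))
  obtain ⟨ε, hε⟩ : ∃ ε, ε = a0 / (|M| + 1) := ⟨_, rfl⟩
  have hMp : 0 < |M| + 1 := by positivity
  have hε0 : 0 < ε := by rw [hε]; positivity
  have hεM : ε * (|M| + 1) = a0 := by rw [hε]; field_simp
  have hsqc : ∀ x, ContDiffAt ℝ 2 (fun y => ε * φ y ^ 2) x := fun x =>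
    (contDiff_const.mul (hφ2.pow 2)).contDiffAt
  have hsql : ∀ x, lap (fun y => ε * φ y ^ 2) x =
      ε * (2 * ‖fderiv ℝ φ x‖ ^ 2 + 2 * φ x * lap φ x) := by
    intro x
    have h1 : ∀ t : ℝ, HasDerivAt (fun t => ε * t ^ 2) (ε * (2 * t)) t := fun t =>
      ((hasDerivAt_pow 2 t).const_mul ε).congr_deriv (by norm_num)
    have h2 : HasDerivAt (fun t : ℝ => ε * (2 * t)) (ε * 2) (φ x) :=
      (((hasDerivAt_id (φ x)).const_mul (2:ℝ)).const_mul ε).congr_deriv (by norm_num)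
    rw [lap_comp (γ := fun t => ε * t ^ 2) (γ' := fun t => ε * (2 * t)) (γ'' := ε * 2)
      hφ2.contDiffAt (by fun_prop) (Eventually.of_forall h1) h2]
    ring
  have hsqf : ∀ x, ‖fderiv ℝ (fun y => ε * φ y ^ 2) x‖ = ε * (2 * φ x) * ‖fderiv ℝ φ x‖ := by
    intro x
    have h1 : HasDerivAt (fun t : ℝ => ε * t ^ 2) (ε * (2 * φ x)) (φ x) :=
      ((hasDerivAt_pow 2 (φ x)).const_mul ε).congr_deriv (by norm_num)
    have h2 := h1.comp_hasFDerivAt x (hφ2.contDiffAt.differentiableAt two_ne_zero).hasFDerivAt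
    have h3 : fderiv ℝ (fun y => ε * φ y ^ 2) x = (ε * (2 * φ x)) • fderiv ℝ φ x := h2.fderiv
    rw [h3, norm_smul, Real.norm_of_nonneg (by have := hφ0 x; positivity)]
  refine ⟨fun y => Real.log (ε * φ y ^ 2), fun x hx => ?_, fun W hW x hx => ?_⟩
  · have hp := hφp x hx
    have hp2 : 0 < ε * φ x ^ 2 := by positivity
    refine ⟨(hsqc x).log hp2.ne', ?_⟩
    rw [lap_log (hsqc x) hp2, fderiv_log_norm (hsqc x) hp2, hsql, hsqf, Real.exp_neg,
      Real.exp_log hp2]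
    have key := hM' x hx
    set G := ‖fderiv ℝ φ x‖
    have h1 : -(φ x * |lap φ x|) ≤ φ x * lap φ x := by
      rw [← mul_neg]; exact mul_le_mul_of_nonneg_left (neg_abs_le _) hp.le
    rw [← sub_nonneg]
    have e : ε * (2 * G ^ 2 + 2 * φ x * lap φ x) / (ε * φ x ^ 2) -
        (ε * (2 * φ x) * G) ^ 2 / (ε * φ x ^ 2) ^ 2 -
        (B * (ε * (2 * φ x) * G / (ε * φ x ^ 2)) ^ 2 - a0 * (ε * φ x ^ 2)⁻¹) =
        ((|M| + 1) - ((4 * B + 2) * G ^ 2 - 2 * φ x * lap φ x)) / φ x ^ 2 := by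
      rw [← hεM]; field_simp; ring
    rw [e]
    apply div_nonneg _ (by positivity)
    linarith
  · have hp := hφp x hx
    refine Real.log_le_log (by positivity) ?_
    have := weak_max (v := fun y => ε * φ y ^ 2 - W y) hN hΩb hΩ (κ := 0)
      ((continuous_const.mul (hφ2.continuous.pow 2)).continuousOn.sub hW.cont)
      (fun y hy => (hsqc y).sub (hW.c2 y hy)) (fun y hy => ?_) (fun y hy => ?_) x hx
    · linarith
    · rw [lap_sub (hsqc y) (hW.c2 y hy), hsql]
      have h1 := hW.lapl y hy
      have key := hM' y hy
      have h2 : -(φ y * |lap φ y|) ≤ φ y * lap φ y := by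
        rw [← mul_neg]; exact mul_le_mul_of_nonneg_left (neg_abs_le _) (hφ0 y)
      have h3 : 0 ≤ (4 * B + 2) * ‖fderiv ℝ φ y‖ ^ 2 := by positivity
      have h5 : 0 ≤ ‖fderiv ℝ φ y‖ ^ 2 := by positivity
      have h4 : -(|M| + 1) ≤ 2 * ‖fderiv ℝ φ y‖ ^ 2 + 2 * φ y * lap φ y := by linarith
      have := mul_le_mul_of_nonneg_left h4 hε0.le
      rw [mul_neg, hεM] at this
      linarith
    · rw [hφz y hy]
      have := hW.bd y hy
      simpa using this

end

section

open Set Filter MeasureTheory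
open scoped Topology ContDiff

variable {N : ℕ}

/-- The class of functions for which we have local gradient bounds. -/
def GClass (Ω : Set (Eu N)) (w0 : Eu N → ℝ) (c0 A B : ℝ) (u : Eu N → ℝ) : Prop :=
  ∀ x ∈ Ω, ContDiffAt ℝ 2 u x ∧ w0 x ≤ u x ∧ u x ≤ c0 ∧
    |lap u x| ≤ A * Real.exp (-w0 x) + B * ‖fderiv ℝ u x‖ ^ 2

theorem gclass_grad {Ω : Set (Eu N)} (hΩ : IsOpen Ω) {w0 : Eu N → ℝ} {c0 A B : ℝ}
    (hw0 : ∀ x ∈ Ω, ContinuousAt w0 x) (hA : 0 ≤ A) (hB : 1 ≤ B) :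
    ∀ x ∈ Ω, ∃ r K, 0 < r ∧ 0 ≤ K ∧ ∀ u, GClass Ω w0 c0 A B u →
      ∀ y ∈ Metric.ball x r, ‖fderiv ℝ u y‖ ≤ K := by
  intro x hx
  have hev : ∀ᶠ y in 𝓝 x, w0 x - 1 < w0 y ∧ y ∈ Ω :=
    ((hw0 x hx).eventually (lt_mem_nhds (by linarith))).and (hΩ.mem_nhds hx)
  obtain ⟨r1, hr1, hball⟩ := Metric.eventually_nhds_iff_ball.1 hev
  obtain ⟨K, hK, h⟩ := grad_est N (r := r1 / 2) (A := A * Real.exp (1 - w0 x)) (B := B)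
    (M := max |c0| |w0 x - 1|) (by positivity) (by positivity) hB (by positivity)
  refine ⟨r1 / 2, K, by positivity, hK, fun u hu y hy => h y u ?_ ?_ ?_⟩
  all_goals
    intro z hz
    have hzx : z ∈ Metric.ball x r1 := by
      rw [Metric.mem_ball] at *
      linarith [dist_triangle z y x]
    obtain ⟨h1, h2⟩ := hball z hzx
    obtain ⟨k1, k2, k3, k4⟩ := hu z h2
  · exact k1
  · rw [abs_le]
    have e1 := le_max_left |c0| |w0 x - 1|
    have e2 := le_max_right |c0| |w0 x - 1|
    have e3 := neg_abs_le (w0 x - 1)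
    have e4 := le_abs_self c0
    constructor <;> linarith
  · refine k4.trans ?_
    have : Real.exp (-w0 z) ≤ Real.exp (1 - w0 x) := Real.exp_le_exp.2 (by linarith)
    have := mul_le_mul_of_nonneg_left this hA
    linarith

theorem exists_g {Ω : Set (Eu N)} (hΩ : IsOpen Ω) {w0 : Eu N → ℝ} {c0 A B : ℝ}
    (hw0 : ∀ x ∈ Ω, ContinuousAt w0 x) (hA : 0 ≤ A) (hB : 1 ≤ B) :
    ∃ g : Eu N → ℝ, (∀ x y, |g x - g y| ≤ ‖x - y‖) ∧ (∀ x ∈ Ω, 0 < g x) ∧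
      ∀ u, GClass Ω w0 c0 A B u → ∀ x ∈ Ω, ‖fderiv ℝ u x‖ ≤ (g x)⁻¹ := by
  let S : Eu N → Set ℝ := fun x => insert 1 {t | ∃ y ∈ Ω, ∃ u, GClass Ω w0 c0 A B u ∧
    t = ‖x - y‖ + 1 / (1 + ‖fderiv ℝ u y‖)}
  have hSne : ∀ x, (S x).Nonempty := fun x => ⟨1, mem_insert _ _⟩
  have hSb : ∀ x, BddBelow (S x) := fun x => ⟨0, by
    rintro t (rfl | ⟨y, _, u, _, rfl⟩)
    · exact zero_le_one
    · positivity⟩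
  have key : ∀ x y, sInf (S x) - sInf (S y) ≤ ‖x - y‖ := by
    intro x y
    have : sInf (S x) - ‖x - y‖ ≤ sInf (S y) := by
      refine le_csInf (hSne y) ?_
      rintro t (rfl | ⟨z, hz, u, hu, rfl⟩)
      · have := csInf_le (hSb x) (mem_insert _ _ : (1:ℝ) ∈ S x)
        linarith [norm_nonneg (x - y)]
      · have := csInf_le (hSb x) (mem_insert_of_mem _ ⟨z, hz, u, hu, rfl⟩ :
          ‖x - z‖ + 1 / (1 + ‖fderiv ℝ u z‖) ∈ S x)
        have h2 : ‖x - z‖ ≤ ‖x - y‖ + ‖y - z‖ := by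
          have := norm_add_le (x - y) (y - z)
          rwa [sub_add_sub_cancel] at this
        linarith
    linarith
  have hpos : ∀ x ∈ Ω, 0 < sInf (S x) := by
    intro x hx
    obtain ⟨r, K, hr, hK, h⟩ := gclass_grad (c0 := c0) hΩ hw0 hA hB x hx
    refine lt_of_lt_of_le (b := min 1 (min r (1 / (1 + K)))) (by positivity) ?_
    refine le_csInf (hSne x) ?_
    rintro t (rfl | ⟨z, hz, u, hu, rfl⟩)
    · exact min_le_left _ _
    · refine (min_le_right _ _).trans ?_
      by_cases hzr : z ∈ Metric.ball x r
      · refine (min_le_right _ _).trans ?_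
        have h1 := h u hu z hzr
        have : 1 / (1 + K) ≤ 1 / (1 + ‖fderiv ℝ u z‖) :=
          one_div_le_one_div_of_le (by positivity) (by linarith)
        linarith [norm_nonneg (x - z)]
      · refine (min_le_left _ _).trans ?_
        rw [mem_ball_iff_norm, not_lt, norm_sub_rev] at hzr
        have : 0 ≤ 1 / (1 + ‖fderiv ℝ u z‖) := by positivity
        linarith
  refine ⟨fun x => sInf (S x), fun x y => ?_, hpos, fun u hu x hx => ?_⟩
  · rw [abs_le]
    refine ⟨?_, key x y⟩
    have := key y x
    rw [norm_sub_rev] at this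
    linarith
  · have h1 := csInf_le (hSb x) (mem_insert_of_mem _ ⟨x, hx, u, hu, rfl⟩ :
      ‖x - x‖ + 1 / (1 + ‖fderiv ℝ u x‖) ∈ S x)
    rw [sub_self, norm_zero, zero_add] at h1
    have h2 := inv_anti₀ (hpos x hx) h1
    rw [one_div, inv_inv] at h2
    linarith

theorem solve_log (hN : 0 < N) {Ω : Set (Eu N)} (hΩ : IsOpen Ω) (hne : Ω.Nonempty)
    (hΩb : Bornology.IsBounded Ω) {a b : Eu N → ℝ}
    {a0 A B Ca Cb α : ℝ} (hd : Data Ω a b a0 A B Ca Cb α) :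
    ∃ u : Eu N → ℝ, (∀ x ∈ Ω, ContDiffAt ℝ 2 u x ∧
      lap u x = b x * ‖fderiv ℝ u x‖ ^ 2 - a x * Real.exp (-u x) ∧ LH α u x) ∧
      ∀ W, Barrier Ω A W → ∀ x ∈ Ω, Real.exp (u x) ≤ W x := by
  obtain ⟨x1, hx1⟩ := hne
  have haA : a0 ≤ A := (hd.alo x1 hx1).trans (hd.ahi x1 hx1)
  have hA : 0 < A := hd.a0p.trans_le haA
  obtain ⟨w0, hw0, hw0W⟩ := exists_sub hN hΩ hΩb hd.a0p haA hd.B1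
  -- global barrier
  obtain ⟨D, hD⟩ := hΩb.subset_closedBall 0
  have hnD : ∀ x ∈ closure Ω, ‖x‖ ≤ |D| := fun x hx => by
    have := closure_minimal hD Metric.isClosed_closedBall hx
    rw [mem_closedBall_zero_iff] at this
    exact this.trans (le_abs_self D)
  have hC2 : ∀ x : Eu N, ContDiffAt ℝ 2 (fun z : Eu N => ‖z - 0‖ ^ 2) x := fun x =>
    ((contDiff_id.sub contDiff_const).norm_sq ℝ).contDiffAt
  have hW0 : Barrier Ω A (fun x => (-A) * ‖x - 0‖ ^ 2 + A * (D ^ 2 + 1)) := by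
    have hp : ∀ x ∈ closure Ω, 0 < (-A) * ‖x - 0‖ ^ 2 + A * (D ^ 2 + 1) := fun x hx => by
      have h1 := hnD x hx
      have h2 : ‖x‖ ^ 2 ≤ D ^ 2 := by
        rw [← sq_abs D]; exact pow_le_pow_left₀ (norm_nonneg _) h1 2
      rw [sub_zero]
      have := mul_le_mul_of_nonneg_left h2 hA.le
      linarith
    refine ⟨by fun_prop, fun x _ => (contDiffAt_const.mul (hC2 x)).add contDiffAt_const,
      fun x hx => hp x (subset_closure hx), fun x hx => (hp x (frontier_subset_closure hx)).le,
      fun x _ => ?_⟩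
    rw [lap_add (contDiffAt_const.mul (hC2 x)) contDiffAt_const, lap_const_mul _ (hC2 x),
      lap_normSq, lap_const]
    have : (1:ℝ) ≤ N := by exact_mod_cast hN
    nlinarith
  obtain ⟨c0, hc0⟩ : ∃ c0, c0 = Real.log (A * (D ^ 2 + 1)) := ⟨_, rfl⟩
  obtain ⟨g, hgl, hgp, hgu⟩ := exists_g (c0 := c0) hΩ
    (fun x hx => (hw0 x hx).1.continuousAt) hA.le hd.B1
  have hginv : ∀ x ∈ Ω, 0 ≤ (g x)⁻¹ := fun x hx => (inv_pos.2 (hgp x hx)).le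
  have hmin : ∀ x ∈ Ω, ∀ q : ℝ, 0 ≤ q → (min q (g x)⁻¹) ^ 2 ≤ q ^ 2 := fun x hx q hq =>
    pow_le_pow_left₀ (le_min hq (hginv x hx)) (min_le_left _ _) 2
  have hbar : ∀ W, Barrier Ω A W → Super (Hf a b g) w0 Ω (fun y => Real.log (W y)) := by
    intro W hW x hx
    have hp := hW.pos x hx
    refine ⟨(hW.c2 x hx).log hp.ne', ?_, hw0W W hW x hx⟩
    have hl := lap_log (hW.c2 x hx) hp
    have hf := fderiv_log_norm (hW.c2 x hx) hp
    rw [hl, ← div_pow, ← hf]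
    unfold Hf
    rw [Real.exp_neg, Real.exp_log hp]
    have h1 := hmin x hx ‖fderiv ℝ (fun y => Real.log (W y)) x‖ (norm_nonneg _)
    have h2 : lap W x / W x ≤ -(a x * (W x)⁻¹) := by
      rw [div_eq_mul_inv, ← neg_mul]
      refine mul_le_mul_of_nonneg_right ?_ (inv_pos.2 hp).le
      linarith [hW.lapl x hx, hd.ahi x hx]
    have h3 := mul_le_mul_of_nonneg_right (hd.blo x hx)
      (sq_nonneg (min ‖fderiv ℝ (fun y => Real.log (W y)) x‖ (g x)⁻¹))
    linarith
  have hmono : SMono (Hf a b g) Ω := by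
    intro x hx s t q _ hst
    unfold Hf
    have h1 : Real.exp (-t) < Real.exp (-s) := Real.exp_lt_exp.2 (by linarith)
    have := mul_lt_mul_of_pos_left h1 (hd.a0p.trans_le (hd.alo x hx))
    linarith
  have hBp : 0 < B := lt_of_lt_of_le one_pos hd.B1
  obtain ⟨u, hu, huw, huZ⟩ := perron (α := α) hN hΩ ⟨x1, hx1⟩ hmono (w0 := w0) (fun x hx => by
    refine ⟨(hw0 x hx).1, le_trans ?_ (hw0 x hx).2⟩
    unfold Hf
    have h1 := hmin x hx ‖fderiv ℝ w0 x‖ (norm_nonneg _)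
    have h2 := mul_le_mul_of_nonneg_right (hd.bhi x hx) (sq_nonneg (min ‖fderiv ℝ w0 x‖ (g x)⁻¹))
    have h3 := mul_le_mul_of_nonneg_left h1 hBp.le
    have h4 := mul_le_mul_of_nonneg_right (hd.alo x hx) (Real.exp_pos (-w0 x)).le
    linarith) (hbar _ hW0) (Hf_goodBall hN hΩ hd hgp hgl (fun x hx => (hw0 x hx).1))
  have huc : ∀ x ∈ Ω, u x ≤ c0 := fun x hx => by
    refine (huZ _ (hbar _ hW0) x hx).trans ?_
    rw [hc0]
    refine Real.log_le_log (hW0.pos x hx) ?_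
    have := mul_nonneg hA.le (sq_nonneg ‖x - 0‖)
    linarith
  have huG : GClass Ω w0 c0 A B u := by
    intro x hx
    refine ⟨(hu x hx).1, huw x hx, huc x hx, ?_⟩
    rw [(hu x hx).2.1]
    unfold Hf
    have h1 := hmin x hx ‖fderiv ℝ u x‖ (norm_nonneg _)
    have hb : |b x| ≤ B := abs_le.2 ⟨by linarith [hd.blo x hx, hd.B1], hd.bhi x hx⟩
    have ha : |a x| ≤ A := abs_le.2 ⟨by linarith [hd.alo x hx, hd.a0p], hd.ahi x hx⟩
    refine (abs_sub _ _).trans ?_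
    rw [abs_mul, abs_mul, abs_of_nonneg (sq_nonneg (min ‖fderiv ℝ u x‖ (g x)⁻¹)),
      abs_of_pos (Real.exp_pos _), add_comm]
    have he : Real.exp (-u x) ≤ Real.exp (-w0 x) := Real.exp_le_exp.2 (by linarith [huw x hx])
    exact add_le_add (mul_le_mul ha he (Real.exp_pos _).le hA.le)
      (mul_le_mul hb h1 (sq_nonneg _) hBp.le)
  refine ⟨u, fun x hx => ⟨(hu x hx).1, ?_, (hu x hx).2.2⟩, fun W hW x hx => ?_⟩
  · rw [(hu x hx).2.1]
    unfold Hf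
    rw [min_eq_left (hgu u huG x hx)]
  · have := huZ _ (hbar W hW) x hx
    rw [← Real.exp_log (hW.pos x hx)]
    exact Real.exp_le_exp.2 this

end

section

open Set Filter MeasureTheory
open scoped Topology ContDiff

variable {N : ℕ}

theorem fderiv_normSq (y x : Eu N) : ‖fderiv ℝ (fun z => ‖z - y‖ ^ 2) x‖ = 2 * ‖x - y‖ := by
  have h : HasFDerivAt (fun z => ‖z - y‖ ^ 2) ((2:ℝ) • (innerSL ℝ) (x - y)) x := by
    refine ((hasFDerivAt_id (𝕜 := ℝ) x).sub_const y).norm_sq.congr_fderiv ?_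
    ext v; simp
  rw [h.fderiv, norm_smul, innerSL_apply_norm]; norm_num

theorem barrier_of_ball {Ω : Set (Eu N)} (hΩb : Bornology.IsBounded Ω) {A : ℝ}
    (hA : 0 < A) {y0 : Eu N} {R : ℝ} (hR : 0 < R) (hz : ∀ z ∈ Ω, R < ‖z - y0‖) :
    ∃ W, Barrier Ω A W ∧ Continuous W ∧ ∀ x, ‖x - y0‖ = R → W x = 0 := by
  obtain ⟨D, hD⟩ := hΩb.subset_closedBall y0
  have hzD : ∀ z ∈ Ω, ‖z - y0‖ ^ 2 ≤ D ^ 2 := fun z h => by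
    have h1 := hD h
    rw [mem_closedBall_iff_norm] at h1
    exact pow_le_pow_left₀ (norm_nonneg _) h1 2
  have hcl : ∀ z ∈ closure Ω, R ≤ ‖z - y0‖ := fun z h => by
    have hc : IsClosed {z : Eu N | R ≤ ‖z - y0‖} := isClosed_le continuous_const (by fun_prop)
    exact closure_minimal (fun z hz' => (hz z hz').le) hc h
  obtain ⟨l, hl⟩ : ∃ l : ℝ, l = (N + 1) / (2 * R ^ 2) := ⟨_, rfl⟩
  have hl0 : 0 < l := by rw [hl]; positivity
  have hlR : 2 * (l * R ^ 2) = N + 1 := by rw [hl]; field_simp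
  obtain ⟨K, hK⟩ : ∃ K : ℝ, K = A * Real.exp (l * D ^ 2) / (2 * l) := ⟨_, rfl⟩
  have hK0 : 0 < K := by rw [hK]; have := Real.exp_pos (l * D ^ 2); positivity
  have hKl : 2 * (K * l) * Real.exp (-(l * D ^ 2)) = A := by
    rw [hK, Real.exp_neg]; have := (Real.exp_pos (l * D ^ 2)).ne'; field_simp
  have hC2 : ∀ x : Eu N, ContDiffAt ℝ 2 (fun z : Eu N => ‖z - y0‖ ^ 2) x := fun x =>
    ((contDiff_id.sub contDiff_const).norm_sq ℝ).contDiffAt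
  have hγ : ContDiff ℝ 2 (fun s : ℝ => K * (Real.exp (-(l * R ^ 2)) - Real.exp (-(l * s)))) := by
    fun_prop
  have hd1 : ∀ s : ℝ, HasDerivAt (fun s : ℝ => K * (Real.exp (-(l * R ^ 2)) - Real.exp (-(l * s))))
      (K * l * Real.exp (-(l * s))) s := fun s => by
    have h1 : HasDerivAt (fun s : ℝ => -(l * s)) (-l) s :=
      ((hasDerivAt_id s).const_mul l).neg.congr_deriv (by ring)
    exact ((h1.exp.const_sub (Real.exp (-(l * R ^ 2)))).const_mul K).congr_deriv (by ring)
  have hd2 : ∀ s : ℝ, HasDerivAt (fun s : ℝ => K * l * Real.exp (-(l * s)))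
      (-(K * l * l * Real.exp (-(l * s)))) s := fun s => by
    have h1 : HasDerivAt (fun s : ℝ => -(l * s)) (-l) s :=
      ((hasDerivAt_id s).const_mul l).neg.congr_deriv (by ring)
    exact (h1.exp.const_mul (K * l)).congr_deriv (by ring)
  have hcont : Continuous (fun z : Eu N => K * (Real.exp (-(l * R ^ 2)) -
      Real.exp (-(l * ‖z - y0‖ ^ 2)))) := by fun_prop
  refine ⟨fun z => K * (Real.exp (-(l * R ^ 2)) - Real.exp (-(l * ‖z - y0‖ ^ 2))),
    ⟨hcont.continuousOn, fun x _ => ?_, fun x hx => ?_, fun x hx => ?_, fun x hx => ?_⟩,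
    hcont, fun x hx => ?_⟩
  · exact hγ.contDiffAt.comp x (hC2 x)
  · refine mul_pos hK0 (sub_pos.2 (Real.exp_lt_exp.2 ?_))
    have := mul_lt_mul_of_pos_left (pow_lt_pow_left₀ (hz x hx) hR.le two_ne_zero) hl0
    linarith
  · refine mul_nonneg hK0.le (sub_nonneg.2 (Real.exp_le_exp.2 ?_))
    have := mul_le_mul_of_nonneg_left
      (pow_le_pow_left₀ hR.le (hcl x (frontier_subset_closure hx)) 2) hl0.le
    linarith
  · rw [lap_comp (γ := fun s : ℝ => K * (Real.exp (-(l * R ^ 2)) - Real.exp (-(l * s))))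
      (hC2 x) hγ.contDiffAt (Eventually.of_forall hd1) (hd2 _), fderiv_normSq, lap_normSq]
    have h1 := mul_le_mul_of_nonneg_left (pow_le_pow_left₀ hR.le (hz x hx).le 2) hl0.le
    have h2 : Real.exp (-(l * D ^ 2)) ≤ Real.exp (-(l * ‖x - y0‖ ^ 2)) :=
      Real.exp_le_exp.2 (by have := mul_le_mul_of_nonneg_left (hzD x hx) hl0.le; linarith)
    have h3 := mul_le_mul_of_nonneg_left h2 (by positivity : 0 ≤ 2 * (K * l))
    rw [hKl] at h3
    have h4 : 2 * (K * l) * Real.exp (-(l * ‖x - y0‖ ^ 2)) * 1 ≤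
        2 * (K * l) * Real.exp (-(l * ‖x - y0‖ ^ 2)) * (2 * (l * ‖x - y0‖ ^ 2) - N) :=
      mul_le_mul_of_nonneg_left (by linarith)
        (mul_nonneg (by positivity) (Real.exp_pos _).le)
    linarith
  · simp [hx]

theorem quad_bound {F : Type*} [NormedAddCommGroup F] [NormedSpace ℝ F] {ψ : F → ℝ}
    (hψ : ContDiff ℝ 2 ψ) (p : F) : ∃ M δ : ℝ, 0 ≤ M ∧ 0 < δ ∧ ∀ q, ‖q - p‖ < δ →
      fderiv ℝ ψ p (q - p) - M * ‖q - p‖ ^ 2 ≤ ψ q - ψ p := by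
  have h1 : ContDiffAt ℝ 1 (fderiv ℝ ψ) p :=
    (hψ.fderiv_right (m := 1) (by norm_num)).contDiffAt
  obtain ⟨K, t, ht, hK⟩ := h1.exists_lipschitzOnWith
  obtain ⟨δ, hδ, hb⟩ := Metric.mem_nhds_iff.1 ht
  refine ⟨K, δ, K.2, hδ, fun q hq => ?_⟩
  have hsub : Metric.closedBall p ‖q - p‖ ⊆ t :=
    (Metric.closedBall_subset_ball hq).trans hb
  have h2 := Convex.norm_image_sub_le_of_norm_fderiv_le' (𝕜 := ℝ) (f := ψ) (φ := fderiv ℝ ψ p)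
    (C := K * ‖q - p‖) (s := Metric.closedBall p ‖q - p‖) (x := p) (y := q)
    (fun x _ => hψ.contDiffAt.differentiableAt two_ne_zero) (fun x hx => by
      have := hK.norm_sub_le (hsub hx) (hb (Metric.mem_ball_self hδ))
      refine this.trans (mul_le_mul_of_nonneg_left ?_ K.2)
      rwa [mem_closedBall_iff_norm] at hx) (convex_closedBall _ _)
    (Metric.mem_closedBall_self (norm_nonneg _)) (by rw [mem_closedBall_iff_norm])
  rw [Real.norm_eq_abs] at h2
  have := (abs_le.1 h2).1
  nlinarith

theorem exterior_ball {α : NNReal} {Ω : Set (Eu N)} (hΩ : IsOpen Ω)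
    (hbd : IsC2HolderBoundary α Ω) {x : Eu N} (hx : x ∈ frontier Ω) :
    ∃ y0 R, 0 < R ∧ ‖x - y0‖ = R ∧ ∀ z ∈ Ω, R < ‖z - y0‖ := by
  obtain ⟨U, hU, hxU, T, ψ, hψ, -, hset⟩ := hbd x hx
  have hmem : ∀ y ∈ U, (y ∈ Ω ↔ ψ (T y).fst < (T y).snd) := fun y hy => by
    have : y ∈ Ω ∩ U ↔ y ∈ {y | ψ (WithLp.equiv 2 _ (T y)).1 < (WithLp.equiv 2 _ (T y)).2} ∩ U := by
      rw [hset]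
    simp only [mem_inter_iff, hy, and_true, mem_ofPred_eq] at this
    exact this
  have hTc : Continuous T := T.continuous
  have hfc : Continuous fun y => (T y).fst := by fun_prop
  have hsc : Continuous fun y => (T y).snd := by fun_prop
  have hpt : ψ (T x).fst = (T x).snd := by
    rw [hΩ.frontier_eq] at hx
    apply le_antisymm
    · by_contra h
      push Not at h
      have hev : ∀ᶠ y in 𝓝 x, (T y).snd < ψ (T y).fst ∧ y ∈ U :=
        ((hsc.continuousAt.prodMk (hψ.continuous.comp hfc).continuousAt).eventually
          ((isOpen_lt continuous_fst continuous_snd).mem_nhds h)).and (hU.mem_nhds hxU)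
      obtain ⟨y, hy1, hy2⟩ := mem_closure_iff_nhds.1 hx.1 _ hev
      have := (hmem y hy1.2).1 hy2
      exact lt_asymm this hy1.1
    · by_contra h
      push Not at h
      exact hx.2 ((hmem x hxU).2 h)
  obtain ⟨M, δ, hM, hδ, hq⟩ := quad_bound hψ (T x).fst
  obtain ⟨r, hr, hrU⟩ := Metric.mem_nhds_iff.1 (hU.mem_nhds hxU)
  obtain ⟨v, hv⟩ : ∃ v, v = (InnerProductSpace.toDual ℝ _).symm (fderiv ℝ ψ (T x).fst) := ⟨_, rfl⟩
  have hvin : ∀ h, fderiv ℝ ψ (T x).fst h = inner ℝ v h := fun h => by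
    rw [hv, InnerProductSpace.toDual_symm_apply]
  obtain ⟨S, hS⟩ : ∃ S, S = Real.sqrt (1 + ‖v‖ ^ 2) := ⟨_, rfl⟩
  have hS0 : 0 < S := by rw [hS]; positivity
  have hS2 : S ^ 2 = 1 + ‖v‖ ^ 2 := by rw [hS]; exact Real.sq_sqrt (by positivity)
  obtain ⟨ρ, hρ⟩ : ∃ ρ, ρ = min (1 / (2 * (M + 1))) (min r δ / (4 * S)) := ⟨_, rfl⟩
  have hρ0 : 0 < ρ := by rw [hρ]; positivity
  have hρM : 2 * ρ * M ≤ 1 := by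
    have h1 : ρ ≤ 1 / (2 * (M + 1)) := by rw [hρ]; exact min_le_left _ _
    rw [le_div_iff₀ (by positivity)] at h1
    nlinarith
  have hρS : 4 * (ρ * S) ≤ min r δ := by
    have h1 : ρ ≤ min r δ / (4 * S) := by rw [hρ]; exact min_le_right _ _
    rw [le_div_iff₀ (by positivity)] at h1
    linarith
  obtain ⟨e, he⟩ : ∃ e : WithLp 2 (EuclideanSpace ℝ (Fin (N - 1)) × ℝ),
    e = WithLp.toLp 2 (ρ • v, -ρ) := ⟨_, rfl⟩
  have he1 : e.fst = ρ • v := by rw [he]; rfl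
  have he2 : e.snd = -ρ := by rw [he]; rfl
  have hdist : ∀ z, ‖z - T.symm (T x + e)‖ ^ 2 =
      ‖((T z).fst - (T x).fst) - ρ • v‖ ^ 2 + ((T z).snd - (T x).snd + ρ) ^ 2 := by
    intro z
    have h1 : ‖z - T.symm (T x + e)‖ = ‖T z - (T x + e)‖ := by
      rw [← dist_eq_norm, ← dist_eq_norm, ← T.dist_map, T.apply_symm_apply]
    rw [h1, WithLp.prod_norm_sq_eq_of_L2]
    rw [WithLp.sub_fst, WithLp.sub_snd, WithLp.add_fst, WithLp.add_snd, he1, he2,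
      Real.norm_eq_abs, sq_abs]
    congr 2
    · rw [sub_add_eq_sub_sub]
    · ring
  have hR : ‖x - T.symm (T x + e)‖ = ρ * S := by
    rw [← sq_eq_sq₀ (norm_nonneg _) (by positivity), hdist, mul_pow, hS2]
    simp only [sub_self, zero_sub, norm_neg, norm_smul, Real.norm_eq_abs, mul_pow, sq_abs]
    ring
  refine ⟨T.symm (T x + e), ρ * S, by positivity, hR, fun z hz => ?_⟩
  by_contra hcon
  push Not at hcon
  have hzx : ‖z - x‖ < min r δ := by
    have : ‖z - x‖ ≤ ‖z - T.symm (T x + e)‖ + ‖x - T.symm (T x + e)‖ := by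
      have := norm_sub_le (z - T.symm (T x + e)) (x - T.symm (T x + e))
      rwa [sub_sub_sub_cancel_right] at this
    have h2 : 0 < ρ * S := by positivity
    linarith
  have hzU : z ∈ U := hrU (by rw [mem_ball_iff_norm]; exact hzx.trans_le (min_le_left _ _))
  have hT := (hmem z hzU).1 hz
  have hfst : ‖(T z).fst - (T x).fst‖ < δ := by
    have h1 : ‖T z - T x‖ = ‖z - x‖ := by rw [← dist_eq_norm, ← dist_eq_norm, T.dist_map]
    have h2 := WithLp.prod_norm_sq_eq_of_L2 (T z - T x)
    rw [WithLp.sub_fst] at h2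
    have h3 : ‖(T z).fst - (T x).fst‖ ≤ ‖T z - T x‖ := by
      refine (sq_le_sq₀ (norm_nonneg _) (norm_nonneg _)).1 ?_
      rw [h2]; have := sq_nonneg ‖(T z - T x).snd‖; linarith
    rw [h1] at h3
    exact h3.trans_lt (hzx.trans_le (min_le_right _ _))
  have hqq := hq _ hfst
  rw [hvin, hpt] at hqq
  have hsq : ‖z - T.symm (T x + e)‖ ^ 2 ≤ (ρ * S) ^ 2 := pow_le_pow_left₀ (norm_nonneg _) hcon 2
  rw [hdist, norm_sub_sq_real, inner_smul_right, norm_smul, mul_pow, mul_pow, hS2,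
    Real.norm_eq_abs, sq_abs, real_inner_comm] at hsq
  set h := (T z).fst - (T x).fst
  set k := (T z).snd - (T x).snd with hk
  set I := inner ℝ v h
  have hk1 : I - M * ‖h‖ ^ 2 < k := by linarith
  have h1 : ρ * (I - M * ‖h‖ ^ 2) < ρ * k := mul_lt_mul_of_pos_left hk1 hρ0
  have h2 := mul_le_mul_of_nonneg_right hρM (sq_nonneg ‖h‖)
  nlinarith [sq_nonneg k]

end

section

open Set Filter MeasureTheory
open scoped Topology ContDiff

variable {N : ℕ}

/-- Local Hölder continuity at a point. -/
def LHf {F : Type*} [NormedAddCommGroup F] (α : ℝ) (f : Eu N → F) (x : Eu N) : Prop :=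
  ∃ C, 0 ≤ C ∧ ∀ᶠ p in 𝓝 (x, x), ‖f p.1 - f p.2‖ ≤ C * ‖p.1 - p.2‖ ^ α

section
variable {F G E : Type*} [NormedAddCommGroup F] [NormedSpace ℝ F] [NormedAddCommGroup G]
  [NormedSpace ℝ G] [NormedAddCommGroup E] [NormedSpace ℝ E] {α : ℝ} {x : Eu N}

theorem LHf.continuousAt {f : Eu N → F} (hα : 0 < α) (h : LHf α f x) : ContinuousAt f x := by
  obtain ⟨C, _, h⟩ := h
  refine continuousAt_of_holder_bound (K := C) hα ?_
  have hc : Tendsto (fun y : Eu N => (y, x)) (𝓝 x) (𝓝 (x, x)) :=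
    (Continuous.prodMk_left x).tendsto x
  exact hc.eventually h

theorem LHf.add {f g : Eu N → F} (hf : LHf α f x) (hg : LHf α g x) :
    LHf α (fun y => f y + g y) x := by
  obtain ⟨C, hC, h⟩ := hf
  obtain ⟨D, hD, k⟩ := hg
  refine ⟨C + D, by positivity, ?_⟩
  filter_upwards [h, k] with p h1 h2
  rw [add_sub_add_comm, add_mul]
  exact (norm_add_le _ _).trans (add_le_add h1 h2)

theorem LHf.congr {f g : Eu N → F} (hf : LHf α f x) (h : f =ᶠ[𝓝 x] g) : LHf α g x := by
  obtain ⟨C, hC, k⟩ := hf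
  refine ⟨C, hC, ?_⟩
  rw [nhds_prod_eq] at *
  filter_upwards [k, h.prod_mk h] with p h1 h2
  rw [← h2.1, ← h2.2]
  exact h1

theorem LHf.bilin (B : F →L[ℝ] G →L[ℝ] E) {f : Eu N → F} {g : Eu N → G} (hα : 0 < α)
    (hf : LHf α f x) (hg : LHf α g x) : LHf α (fun y => B (f y) (g y)) x := by
  have hfc := hf.continuousAt hα
  have hgc := hg.continuousAt hα
  obtain ⟨C, hC, h⟩ := hf
  obtain ⟨D, hD, k⟩ := hg
  refine ⟨‖B‖ * C * (‖g x‖ + 1) + ‖B‖ * (‖f x‖ + 1) * D, by positivity, ?_⟩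
  have hf1 : ∀ᶠ p : Eu N × Eu N in 𝓝 (x, x), ‖f p.2‖ ≤ ‖f x‖ + 1 := by
    have : ∀ᶠ y in 𝓝 x, ‖f y‖ ≤ ‖f x‖ + 1 :=
      (hfc.norm.eventually (gt_mem_nhds (lt_add_one _))).mono fun _ h => h.le
    exact (continuous_snd.tendsto (x, x)).eventually this
  have hg1 : ∀ᶠ p : Eu N × Eu N in 𝓝 (x, x), ‖g p.1‖ ≤ ‖g x‖ + 1 := by
    have : ∀ᶠ y in 𝓝 x, ‖g y‖ ≤ ‖g x‖ + 1 :=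
      (hgc.norm.eventually (gt_mem_nhds (lt_add_one _))).mono fun _ h => h.le
    exact (continuous_fst.tendsto (x, x)).eventually this
  filter_upwards [h, k, hf1, hg1] with p h1 h2 h3 h4
  have e : B (f p.1) (g p.1) - B (f p.2) (g p.2) =
      B (f p.1 - f p.2) (g p.1) + B (f p.2) (g p.1 - g p.2) := by
    simp only [map_sub, sub_apply]; abel
  have hp : 0 ≤ ‖p.1 - p.2‖ ^ α := by positivity
  rw [e]
  calc _ ≤ ‖B (f p.1 - f p.2) (g p.1)‖ + ‖B (f p.2) (g p.1 - g p.2)‖ := norm_add_le _ _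
    _ ≤ ‖B‖ * ‖f p.1 - f p.2‖ * ‖g p.1‖ + ‖B‖ * ‖f p.2‖ * ‖g p.1 - g p.2‖ :=
      add_le_add (B.le_opNorm₂ _ _) (B.le_opNorm₂ _ _)
    _ ≤ ‖B‖ * (C * ‖p.1 - p.2‖ ^ α) * (‖g x‖ + 1) + ‖B‖ * (‖f x‖ + 1) * (D * ‖p.1 - p.2‖ ^ α) := by
      gcongr
    _ = _ := by ring

theorem LHf.smul {f : Eu N → ℝ} {g : Eu N → G} (hα : 0 < α)
    (hf : LHf α f x) (hg : LHf α g x) : LHf α (fun y => f y • g y) x :=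
  LHf.bilin (ContinuousLinearMap.lsmul ℝ ℝ) hα hf hg

theorem LHf.smulRight {f : Eu N → (F →L[ℝ] ℝ)} {g : Eu N → G} (hα : 0 < α)
    (hf : LHf α f x) (hg : LHf α g x) : LHf α (fun y => (f y).smulRight (g y)) x :=
  LHf.bilin (ContinuousLinearMap.smulRightL ℝ F G) hα hf hg

theorem LHf.of_c1 {f : Eu N → F} (hα1 : α < 1) (hf : ContDiffAt ℝ 1 f x) : LHf α f x := by
  obtain ⟨K, t, ht, hK⟩ := hf.exists_lipschitzOnWith
  refine ⟨K, K.2, ?_⟩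
  have h1 : t ∩ Metric.ball x (1 / 2) ∈ 𝓝 x := inter_mem ht (Metric.ball_mem_nhds x (by norm_num))
  filter_upwards [prod_mem_nhds h1 h1] with p hp
  obtain ⟨⟨h2, h3⟩, h4, h5⟩ := hp
  refine (hK.norm_sub_le h2 h4).trans (mul_le_mul_of_nonneg_left ?_ K.2)
  have hle1 : ‖p.1 - p.2‖ ≤ 1 := by
    rw [Metric.mem_ball] at h3 h5
    rw [← dist_eq_norm]
    linarith [dist_triangle_right p.1 p.2 x]
  conv_lhs => rw [← Real.rpow_one ‖p.1 - p.2‖]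
  exact Real.rpow_le_rpow_of_exponent_ge_of_imp (norm_nonneg _) hle1 hα1.le
    (fun _ h => absurd h one_ne_zero)

theorem holder_compact {f : Eu N → F} {K : Set (Eu N)} (hK : IsCompact K) (hα : 0 < α)
    (h : ∀ x ∈ K, LHf α f x) :
    ∃ C, 0 ≤ C ∧ ∀ y ∈ K, ∀ z ∈ K, ‖f y - f z‖ ≤ C * ‖y - z‖ ^ α := by
  have := (hK.prod hK).induction_on (p := fun S => ∃ C, 0 ≤ C ∧ ∀ p ∈ S,
    ‖f p.1 - f p.2‖ ≤ C * ‖p.1 - p.2‖ ^ α) ⟨0, le_rfl, by simp⟩ ?_ ?_ ?_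
  · obtain ⟨C, hC, h⟩ := this
    exact ⟨C, hC, fun y hy z hz => h (y, z) ⟨hy, hz⟩⟩
  · rintro s t hst ⟨C, hC, h⟩
    exact ⟨C, hC, fun p hp => h p (hst hp)⟩
  · rintro s t ⟨C, hC, h⟩ ⟨D, hD, k⟩
    refine ⟨C + D, by positivity, ?_⟩
    rintro p (hp | hp)
    · have := h p hp
      have hp : 0 ≤ D * ‖p.1 - p.2‖ ^ α := by positivity
      linarith
    · have := k p hp
      have hp : 0 ≤ C * ‖p.1 - p.2‖ ^ α := by positivity
      linarith
  · rintro ⟨x1, x2⟩ ⟨h1, h2⟩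
    by_cases hx : x1 = x2
    · subst hx
      obtain ⟨C, hC, h⟩ := h x1 h1
      exact ⟨_, mem_nhdsWithin_of_mem_nhds h, C, hC, fun p hp => hp⟩
    · have hp : 0 < ‖x1 - x2‖ ^ α := Real.rpow_pos_of_pos (norm_pos_iff.2 (sub_ne_zero.2 hx)) _
      refine ⟨_, mem_nhdsWithin_of_mem_nhds ?_, (‖f x1 - f x2‖ + 1) / ‖x1 - x2‖ ^ α, by positivity,
        fun p hp => hp⟩
      have c1 : ContinuousAt (fun p : Eu N × Eu N => ‖f p.1 - f p.2‖) (x1, x2) :=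
        ((ContinuousAt.comp (x := (x1, x2)) ((h x1 h1).continuousAt hα) continuousAt_fst).sub
          (ContinuousAt.comp (x := (x1, x2)) ((h x2 h2).continuousAt hα) continuousAt_snd)).norm
      have c2 : ContinuousAt (fun p : Eu N × Eu N =>
          (‖f x1 - f x2‖ + 1) / ‖x1 - x2‖ ^ α * ‖p.1 - p.2‖ ^ α) (x1, x2) := by
        refine continuousAt_const.mul (ContinuousAt.rpow_const ?_ (Or.inr hα.le))
        fun_prop
      refine (c1.eventually_lt c2 ?_).mono fun p hp => hp.le
      rw [div_mul_cancel₀ _ hp.ne']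
      exact lt_add_one _

end

theorem LH.lhf {α : ℝ} {u : Eu N → ℝ} {x : Eu N} (h : LH α u x) : LHf α (D2 u) x := by
  obtain ⟨ρ, C, hρ, hC, h⟩ := h
  refine ⟨C, hC, ?_⟩
  filter_upwards [prod_mem_nhds (Metric.ball_mem_nhds x hρ) (Metric.ball_mem_nhds x hρ)] with p hp
  exact h p.1 hp.1 p.2 hp.2

theorem lhf_exp {α : ℝ} (hα : 0 < α) (hα1 : α < 1) {u : Eu N → ℝ} {x : Eu N}
    (hu : ContDiffAt ℝ 2 u x) (h : LHf α (D2 u) x) :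
    LHf α (D2 (fun y => Real.exp (u y))) x := by
  have hU : ContDiffAt ℝ 2 (fun y => Real.exp (u y)) x := hu.exp
  have e : ∀ᶠ y in 𝓝 x, Real.exp (u y) • D2 u y +
      (fderiv ℝ (fun y => Real.exp (u y)) y).smulRight (fderiv ℝ u y)
      = D2 (fun y => Real.exp (u y)) y := by
    filter_upwards [hu.ev2.eventually_nhds] with y hy
    have h1 : fderiv ℝ (fun y => Real.exp (u y)) =ᶠ[𝓝 y] fun y => Real.exp (u y) • fderiv ℝ u y := by
      filter_upwards [hy] with z hz
      exact fderiv_exp (hz.differentiableAt two_ne_zero)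
    have h2 := hy.self_of_nhds
    unfold D2
    rw [h1.fderiv_eq, fderiv_fun_smul (h2.exp.differentiableAt two_ne_zero) h2.fderiv_diff]
  refine LHf.congr (LHf.add (LHf.smul hα ?_ h) (LHf.smulRight hα ?_ ?_)) e
  · exact LHf.of_c1 hα1 (hU.of_le (by norm_num))
  · exact LHf.of_c1 hα1 (hU.fderiv_right (m := 1) (by norm_num))
  · exact LHf.of_c1 hα1 (hu.fderiv_right (m := 1) (by norm_num))

theorem iter_le {U : Eu N → ℝ} (y z : Eu N) :
    ‖iteratedFDeriv ℝ 2 U y - iteratedFDeriv ℝ 2 U z‖ ≤ ‖D2 U y - D2 U z‖ := by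
  refine ContinuousMultilinearMap.opNorm_le_bound (norm_nonneg (D2 U y - D2 U z)) fun m => ?_
  rw [ContinuousMultilinearMap.sub_apply, iteratedFDeriv_two_apply, iteratedFDeriv_two_apply]
  have := (D2 U y - D2 U z).le_opNorm₂ (m 0) (m 1)
  rw [Fin.prod_univ_two, ← mul_assoc]
  exact this

theorem final_aux (hN : 0 < N) {α : NNReal} (hα0 : 0 < α) (hα1 : α < 1) {Ω : Set (Eu N)}
    (hΩ : IsOpen Ω) (hne : Ω.Nonempty) (hΩb : Bornology.IsBounded Ω)
    (hbd : IsC2HolderBoundary α Ω) {a c : Eu N → ℝ}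
    (ha : ∃ C : NNReal, HolderOnWith C α a (closure Ω))
    (hc : ∃ C : NNReal, HolderOnWith C α c (closure Ω))
    (hapos : ∀ x ∈ closure Ω, 0 < a x) (hcpos : ∀ x ∈ closure Ω, 0 < c x) :
    ∃ u : Eu N → ℝ,
      ContinuousOn u (closure Ω) ∧
      HolderC2On α u Ω ∧
      (∀ x ∈ Ω, 0 < u x) ∧
      (∀ x ∈ frontier Ω, u x = 0) ∧
      (∀ x ∈ Ω, -lap u x + c x * (u x)⁻¹ * ‖gradient u x‖ ^ 2 = a x) := by
  obtain ⟨Ca, ha⟩ := ha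
  obtain ⟨Cc, hc⟩ := hc
  have hK : IsCompact (closure Ω) := hΩb.isCompact_closure
  have hneK : (closure Ω).Nonempty := hne.closure
  obtain ⟨xm, hxm, hmin⟩ := hK.exists_isMinOn hneK (ha.continuousOn hα0)
  obtain ⟨xM, hxM, hmax⟩ := hK.exists_isMaxOn hneK (ha.continuousOn hα0)
  obtain ⟨xc, hxc, hcmax⟩ := hK.exists_isMaxOn hneK (hc.continuousOn hα0)
  have hα0' : (0:ℝ) < α := hα0
  have hα1' : (α:ℝ) < 1 := hα1
  have hd : Data Ω a (fun x => c x - 1) (a xm) (a xM) (max 1 (c xc)) Ca Cc α := by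
    refine ⟨hapos _ hxm, le_max_left _ _, Ca.2, Cc.2, hα0', hα1',
      fun x hx => isMinOn_iff.1 hmin x (subset_closure hx),
      fun x hx => isMaxOn_iff.1 hmax x (subset_closure hx),
      fun x hx => by linarith [hcpos x (subset_closure hx)], fun x hx => ?_,
      fun x hx y hy => ?_, fun x hx y hy => ?_⟩
    · have := isMaxOn_iff.1 hcmax x (subset_closure hx)
      linarith [le_max_right 1 (c xc)]
    · have := ha.dist_le (subset_closure hx) (subset_closure hy)
      rwa [Real.dist_eq, dist_eq_norm] at this
    · have := hc.dist_le (subset_closure hx) (subset_closure hy)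
      rw [Real.dist_eq, dist_eq_norm] at this
      rwa [sub_sub_sub_cancel_right]
  obtain ⟨u, hu, huW⟩ := solve_log hN hΩ hne hΩb hd
  obtain ⟨U, hU⟩ : ∃ U : Eu N → ℝ, U = Ω.indicator (fun y => Real.exp (u y)) := ⟨_, rfl⟩
  have hUin : ∀ x ∈ Ω, U x = Real.exp (u x) := fun x hx => by rw [hU, indicator_of_mem hx]
  have hUout : ∀ x, x ∉ Ω → U x = 0 := fun x hx => by rw [hU, indicator_of_notMem hx]
  have hUe : ∀ x ∈ Ω, U =ᶠ[𝓝 x] fun y => Real.exp (u y) := fun x hx => by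
    filter_upwards [hΩ.mem_nhds hx] with y hy using hUin y hy
  have hfr : ∀ x ∈ frontier Ω, x ∉ Ω := fun x hx => by
    rw [hΩ.frontier_eq] at hx; exact hx.2
  have hUc2 : ∀ x ∈ Ω, ContDiffAt ℝ 2 U x := fun x hx =>
    ((hu x hx).1.exp).congr_of_eventuallyEq (hUe x hx)
  have hU0 : ∀ x, 0 ≤ U x := fun x => by
    by_cases hx : x ∈ Ω
    · rw [hUin x hx]; exact (Real.exp_pos _).le
    · rw [hUout x hx]
  refine ⟨U, fun x hx => ?_, ⟨fun x hx => (hUc2 x hx).contDiffWithinAt, fun K hKs hKc => ?_⟩,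
    fun x hx => by rw [hUin x hx]; exact Real.exp_pos _, fun x hx => hUout x (hfr x hx),
    fun x hx => ?_⟩
  · by_cases hxΩ : x ∈ Ω
    · exact (hUc2 x hxΩ).continuousAt.continuousWithinAt
    · have hxf : x ∈ frontier Ω := by rw [hΩ.frontier_eq]; exact ⟨hx, hxΩ⟩
      obtain ⟨y0, R, hR, hxR, hball⟩ := exterior_ball hΩ hbd hxf
      obtain ⟨W, hW, hWc, hW0⟩ := barrier_of_ball hΩb (hapos _ hxM) hR hball
      refine ContinuousAt.continuousWithinAt ?_
      rw [ContinuousAt, hUout x hxΩ]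
      have hlim : Tendsto (fun y => |W y|) (𝓝 x) (𝓝 0) := by
        have := hWc.abs.tendsto x
        rwa [hW0 x hxR, abs_zero] at this
      refine squeeze_zero hU0 (fun y => ?_) hlim
      by_cases hy : y ∈ Ω
      · rw [hUin y hy]; exact (huW W hW y hy).trans (le_abs_self _)
      · rw [hUout y hy]; exact abs_nonneg _
  · have hl : ∀ x ∈ K, LHf α (D2 U) x := fun x hx => by
      have hxΩ := hKs hx
      refine (lhf_exp hα0' hα1' (hu x hxΩ).1 (hu x hxΩ).2.2.lhf).congr ?_
      filter_upwards [hΩ.mem_nhds hxΩ] with y hy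
      unfold D2
      exact ((hUe y hy).fderiv).fderiv_eq.symm
    obtain ⟨C, hC, hb⟩ := holder_compact hKc hα0' hl
    refine ⟨⟨C, hC⟩, fun y hy z hz => ?_⟩
    have hy' := iteratedFDerivWithin_of_isOpen (𝕜 := ℝ) (f := U) 2 hΩ (hKs hy)
    have hz' := iteratedFDerivWithin_of_isOpen (𝕜 := ℝ) (f := U) 2 hΩ (hKs hz)
    have h1 := (iter_le (U := U) y z).trans (hb y hy z hz)
    rw [hy', hz', edist_dist, edist_dist, dist_eq_norm, dist_eq_norm,
      ENNReal.ofReal_rpow_of_nonneg (norm_nonneg _) hα0'.le]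
    refine (ENNReal.ofReal_le_ofReal h1).trans (le_of_eq ?_)
    rw [ENNReal.ofReal_mul hC]
    congr 1
    exact ENNReal.ofReal_eq_coe_nnreal hC
  · have hux := hu x hx
    have hg : ‖gradient U x‖ = Real.exp (u x) * ‖fderiv ℝ u x‖ := by
      unfold gradient
      rw [LinearIsometryEquiv.norm_map, (hUe x hx).fderiv_eq,
        fderiv_exp (hux.1.differentiableAt two_ne_zero), norm_smul, Real.norm_eq_abs,
        abs_of_pos (Real.exp_pos _)]
    have hlap : lap U x = Real.exp (u x) * ‖fderiv ℝ u x‖ ^ 2 + Real.exp (u x) * lap u x := by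
      rw [lap_congr (hUe x hx)]
      exact lap_comp (γ := Real.exp) (γ' := Real.exp) hux.1 Real.contDiff_exp.contDiffAt
        (Eventually.of_forall Real.hasDerivAt_exp) (Real.hasDerivAt_exp _)
    rw [hlap, hg, hUin x hx, hux.2.1, Real.exp_neg]
    have := (Real.exp_pos (u x)).ne'
    field_simp
    ring

end

/-- **Theorem 1 (existence on a bounded domain).** If `Ω ⊂ ℝ^N` (`N > 2`) is a bounded domain
with boundary of class `C^{2,α}` for some `α ∈ (0,1)`, and `a, c ∈ C^{0,α}(Ω̄)` with
`a > 0`, `c > 0` on `Ω̄`, then the problem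
`-Δu + c(x) u⁻¹ |∇u|² = a(x)` in `Ω`, `u = 0` on `∂Ω`
has at least one positive solution `u ∈ C(Ω̄) ∩ C^{2,α}(Ω)`. -/
theorem singular_elliptic_existence_bounded_domain
    {N : ℕ} (hN : 2 < N) (α : NNReal) (hα0 : 0 < α) (hα1 : α < 1)
    (Ω : Set (EuclideanSpace ℝ (Fin N)))
    (hΩo : IsOpen Ω) (hΩconn : IsConnected Ω) (hΩb : Bornology.IsBounded Ω)
    (hbd : IsC2HolderBoundary α Ω)
    (a c : EuclideanSpace ℝ (Fin N) → ℝ)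
    (ha : ∃ C : NNReal, HolderOnWith C α a (closure Ω))
    (hc : ∃ C : NNReal, HolderOnWith C α c (closure Ω))
    (hapos : ∀ x ∈ closure Ω, 0 < a x) (hcpos : ∀ x ∈ closure Ω, 0 < c x) :
    ∃ u : EuclideanSpace ℝ (Fin N) → ℝ,
      ContinuousOn u (closure Ω) ∧
      HolderC2On α u Ω ∧
      (∀ x ∈ Ω, 0 < u x) ∧
      (∀ x ∈ frontier Ω, u x = 0) ∧
      (∀ x ∈ Ω, -lap u x + c x * (u x)⁻¹ * ‖gradient u x‖ ^ 2 = a x) := by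
  exact final_aux (by omega) hα0 hα1 hΩo hΩconn.nonempty hΩb hbd ha hc hapos hcpos
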